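/- arXiv:1607.03901 — 15 statements merged into one kernel-verified Lean document; each statement's English description precedes it below -/
import Mathlib

section
/- Let a be a partial isometry on ℂ^n, i.e. a matrix a : Matrix n n ℂ such that p := aᴴ * a is a projection. Then q := a * aᴴ is also a projection, the ranks of p and q are equal, and there exists a unitary matrix u : Matrix n n ℂ such that q = u * p * uᴴ and a = u * p. -/
open Matrix

/-- A projection is a matrix `p` with `pᴴ = p` and `p * p = p`. -/
def Matrix.IsProjection {n : Type*} [Fintype n] (p : Matrix n n ℂ) : Prop :=
  pᴴ = p ∧ p * p = p

open scoped ComplexOrder in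
/-- A partial isometry `a` satisfies `a * (aᴴ * a) = a`. -/
theorem Matrix.IsProjection.mul_conjTranspose_mul_self {n : Type*} [Fintype n]
    {a : Matrix n n ℂ} (hp : Matrix.IsProjection (aᴴ * a)) : a * (aᴴ * a) = a := by
  have h : (a * (aᴴ * a) - a)ᴴ * (a * (aᴴ * a) - a) = 0 := by
    have h₂ : aᴴ * (a * (aᴴ * a)) = aᴴ * a := by simpa only [Matrix.mul_assoc] using hp.2
    simp only [conjTranspose_sub, conjTranspose_mul, conjTranspose_conjTranspose,
      Matrix.sub_mul, Matrix.mul_sub, Matrix.mul_assoc, h₂, sub_self]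
  exact sub_eq_zero.mp (conjTranspose_mul_self_eq_zero.mp h)

/-- A partial isometry agrees with some unitary on its initial space. -/
theorem Matrix.IsProjection.exists_unitary_mul_eq {n : Type*} [Fintype n] [DecidableEq n]
    {a : Matrix n n ℂ} (hp : Matrix.IsProjection (aᴴ * a)) :
    ∃ u : Matrix n n ℂ, uᴴ * u = 1 ∧ a = u * (aᴴ * a) := by
  let Φ := toEuclideanCLM (n := n) (𝕜 := ℂ)
  have hΦ : Φ (aᴴ * a) = (Φ a).adjoint * Φ a := by
    rw [map_mul, ← star_eq_conjTranspose, map_star, ContinuousLinearMap.star_eq_adjoint]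
  let S : Submodule ℂ (EuclideanSpace ℂ n) := (Φ (aᴴ * a)).toLinearMap.range
  have hnorm (s : S) : ‖(Φ a).toLinearMap.domRestrict S s‖ = ‖s‖ := by
    obtain ⟨_, x, rfl⟩ := s
    have hfix : Φ (aᴴ * a) (Φ (aᴴ * a) x) = Φ (aᴴ * a) x := by
      rw [← mul_apply_eq_comp, ← map_mul, hp.2]
    have hsq : ‖Φ a (Φ (aᴴ * a) x)‖ ^ 2 = ‖Φ (aᴴ * a) x‖ ^ 2 := by
      rw [ContinuousLinearMap.apply_norm_sq_eq_inner_adjoint_left,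
        ← ContinuousLinearMap.mul_def, ← hΦ, hfix, inner_self_eq_norm_sq]
    exact (sq_eq_sq₀ (norm_nonneg _) (norm_nonneg _)).mp hsq
  let U := LinearIsometry.extend ⟨(Φ a).toLinearMap.domRestrict S, hnorm⟩
  refine ⟨Φ.symm U.toContinuousLinearMap, EquivLike.injective Φ ?_, EquivLike.injective Φ ?_⟩
  · rw [← star_eq_conjTranspose, map_mul, map_star, StarAlgEquiv.apply_symm_apply, map_one]
    exact (ContinuousLinearMap.norm_map_iff_adjoint_comp_self _).mp U.norm_map
  · ext1 x
    rw [map_mul, StarAlgEquiv.apply_symm_apply]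
    have hU : U (Φ (aᴴ * a) x) = Φ a (Φ (aᴴ * a) x) :=
      LinearIsometry.extend_apply _ (⟨Φ (aᴴ * a) x, x, rfl⟩ : S)
    refine Eq.trans ?_ hU.symm
    rw [← mul_apply_eq_comp, ← map_mul, hp.mul_conjTranspose_mul_self]

/-- **Partial isometries**: if `a` is a partial isometry, i.e. `aᴴ * a` is a projection,
then `a * aᴴ` is also a projection, `aᴴ * a` and `a * aᴴ` have equal rank, and there is a
unitary `u` with `a * aᴴ = u * (aᴴ * a) * uᴴ` and `a = u * (aᴴ * a)`. -/
theorem partial_isometry_structure {n : Type*} [Fintype n] [DecidableEq n] [Nonempty n]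
    (a : Matrix n n ℂ) (hp : Matrix.IsProjection (aᴴ * a)) :
    Matrix.IsProjection (a * aᴴ) ∧
    (aᴴ * a).rank = (a * aᴴ).rank ∧
    ∃ u : Matrix n n ℂ, uᴴ * u = 1 ∧
      a * aᴴ = u * (aᴴ * a) * uᴴ ∧ a = u * (aᴴ * a) := by
  refine ⟨⟨isHermitian_mul_conjTranspose_self a, ?_⟩, ?_, ?_⟩
  · rw [← Matrix.mul_assoc, Matrix.mul_assoc a aᴴ a, hp.mul_conjTranspose_mul_self]
  · open scoped ComplexOrder in
    rw [rank_conjTranspose_mul_self, rank_self_mul_conjTranspose]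
  · obtain ⟨u, hu, ha⟩ := hp.exists_unitary_mul_eq
    refine ⟨u, hu, ?_, ha⟩
    have ha' : aᴴ = aᴴ * a * uᴴ := by
      conv_lhs => rw [ha, conjTranspose_mul, hp.1]
    calc a * aᴴ = a * (aᴴ * a) * uᴴ := by rw [Matrix.mul_assoc, ← ha']
      _ = u * (aᴴ * a) * uᴴ := by rw [hp.mul_conjTranspose_mul_self, ← ha]
end

section
/- (Finite-dimensional bicommutant theorem.) Let M be a star-subalgebra of Matrix n n ℂ containing the identity. Then the double commutant of M equals M: Set.centralizer (Set.centralizer (M : Set (Matrix n n ℂ))) = (M : Set (Matrix n n ℂ)). -/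
open Matrix

open scoped ComplexOrder

/-- A linear endomorphism of the matrices that is equivariant for left multiplication by every
element of `S` is equivariant for left multiplication by the double commutant of `S`. -/
theorem map_mul_of_mem_centralizer_centralizer {n R : Type*} [Fintype n] [DecidableEq n]
    [CommSemiring R] {S : Set (Matrix n n R)} {P : Matrix n n R →ₗ[R] Matrix n n R}
    (hP : ∀ a ∈ S, ∀ x, P (a * x) = a * P x) {T : Matrix n n R}
    (hT : T ∈ Set.centralizer (Set.centralizer S)) (x : Matrix n n R) :
    P (T * x) = T * P x := by
  let A (k j : n) : Matrix n n R := of fun i l ↦ P (single l k 1) i j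
  have hleft (B : Matrix n n R) (l k i j : n) :
      P (B * single l k 1) i j = (A k j * B) i l := by
    have h : B * single l k 1 = ∑ m, B m l • single m k 1 := by
      ext p q
      simp [Matrix.sum_apply, mul_apply, single_apply, ite_and, eq_comm]
    simp [h, Matrix.sum_apply, mul_apply, A, mul_comm, -smul_single]
  have hright (B : Matrix n n R) (l k i j : n) :
      (B * P (single l k 1)) i j = (B * A k j) i l := by
    simp [mul_apply, A]
  have hA (k j : n) : A k j ∈ Set.centralizer S := fun a ha ↦ by
    ext i l
    rw [← hleft, ← hright, hP a ha]
  suffices h : P ∘ₗ LinearMap.mulLeft R T = LinearMap.mulLeft R T ∘ₗ P from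
    LinearMap.congr_fun h x
  refine Matrix.ext_linearMap R fun l k ↦ LinearMap.ext_ring ?_
  ext i j
  simpa [hleft, hright] using congr_fun₂ (hT _ (hA k j)) i l

/-- The orthogonal projection onto a star-subalgebra for the Frobenius inner product is
equivariant for left multiplication by that subalgebra. -/
theorem StarSubalgebra.exists_equivariant_projection {n : Type*} [Fintype n] [DecidableEq n]
    (M : StarSubalgebra ℂ (Matrix n n ℂ)) :
    ∃ P : Matrix n n ℂ →ₗ[ℂ] Matrix n n ℂ, (∀ x, P x ∈ M) ∧ (∀ x ∈ M, P x = x) ∧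
      ∀ a ∈ M, ∀ x, P (a * x) = a * P x := by
  let _ : NormedAddCommGroup (Matrix n n ℂ) := toMatrixNormedAddCommGroup 1 PosDef.one
  let _ : InnerProductSpace ℂ (Matrix n n ℂ) := toMatrixInnerProductSpace 1 PosSemidef.one
  have inner_mul (a x y : Matrix n n ℂ) : inner ℂ x (a * y) = inner ℂ (aᴴ * x) y := by
    change (a * y * 1 * xᴴ).trace = (y * 1 * (aᴴ * x)ᴴ).trace
    simp [mul_assoc, trace_mul_comm a]
  let U : Submodule ℂ (Matrix n n ℂ) := Subalgebra.toSubmodule M.toSubalgebra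
  have hU : IsCompl U Uᗮ := Submodule.isCompl_orthogonal _
  have hM (a) (ha : a ∈ M) (x) (hx : x ∈ U) : a * x ∈ U := M.mul_mem ha hx
  have hM' (a) (ha : a ∈ M) (x) (hx : x ∈ Uᗮ) : a * x ∈ Uᗮ := by
    rw [Submodule.mem_orthogonal] at hx ⊢
    intro u hu
    rw [inner_mul]
    exact hx _ (hM _ (star_mem ha) u hu)
  have hl (w) (hw : w ∈ U) : U.projection Uᗮ hU w = w :=
    Submodule.projection_apply_of_mem_left hU hw
  have hr (w) (hw : w ∈ Uᗮ) : U.projection Uᗮ hU w = 0 :=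
    (Submodule.projection_apply_eq_zero_iff hU).mpr hw
  refine ⟨U.projection Uᗮ hU, Submodule.projection_apply_mem hU, hl, fun a ha x ↦ ?_⟩
  obtain ⟨u, hu, v, hv, rfl⟩ : ∃ u ∈ U, ∃ v ∈ Uᗮ, u + v = x :=
    Submodule.mem_sup.mp (hU.sup_eq_top ▸ Submodule.mem_top)
  simp [mul_add, hl, hr, hu, hv, hM, hM', ha]

/-- **The finite-dimensional bicommutant theorem**: for a von Neumann algebra `M` on `ℂ^n`
(a star-subalgebra of `Matrix n n ℂ`, which in particular contains the identity), the
double commutant of `M` equals `M`. -/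
theorem bicommutant {n : Type*} [Fintype n] [DecidableEq n] [Nonempty n]
    (M : StarSubalgebra ℂ (Matrix n n ℂ)) :
    Set.centralizer (Set.centralizer (M : Set (Matrix n n ℂ))) = (M : Set (Matrix n n ℂ)) := by
  refine Set.Subset.antisymm (fun T hT ↦ ?_) Set.subset_centralizer_centralizer
  obtain ⟨P, hmem, hid, hmul⟩ := M.exists_equivariant_projection
  have h := map_mul_of_mem_centralizer_centralizer hmul hT 1
  rw [hid 1 M.one_mem, mul_one] at h
  exact h ▸ hmem T
end

section
/- Let M be a star-subalgebra of Matrix n n ℂ containing the identity, and let x ∈ M be Hermitian (xᴴ = x). Then for every function f : ℝ → ℝ, the matrix obtained by applying f to the eigenvalues of x in a spectral decomposition (the continuous functional calculus applied to the Hermitian matrix x) is again an element of M. In particular, the orthogonal projection onto each eigenspace of x belongs to M. -/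
open Matrix

/-- For a Hermitian matrix `x` with spectral decomposition `x = U * diag(λ) * Uᴴ` and a
function `f : ℝ → ℝ`, this is the matrix `f(x) = U * diag(f(λ)) * Uᴴ` obtained by applying
`f` to the eigenvalues of `x` (the functional calculus for Hermitian matrices). -/
noncomputable def Matrix.IsHermitian.applyFn {n : Type*} [Fintype n] [DecidableEq n]
    {x : Matrix n n ℂ} (hx : x.IsHermitian) (f : ℝ → ℝ) : Matrix n n ℂ :=
  (hx.eigenvectorUnitary : Matrix n n ℂ) *
    Matrix.diagonal (fun i => (f (hx.eigenvalues i) : ℂ)) *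
    (hx.eigenvectorUnitary : Matrix n n ℂ)ᴴ

/-- The functional calculus of a Hermitian matrix agrees with evaluation at `x` of any complex
polynomial that takes the same values on the eigenvalues of `x`. -/
theorem Matrix.IsHermitian.applyFn_eq_aeval {n : Type*} [Fintype n] [DecidableEq n]
    {x : Matrix n n ℂ} (hx : x.IsHermitian) (f : ℝ → ℝ) (p : Polynomial ℂ)
    (hp : ∀ i, p.eval (hx.eigenvalues i : ℂ) = (f (hx.eigenvalues i) : ℂ)) :
    hx.applyFn f = Polynomial.aeval x p := by
  have hdiag : Polynomial.aeval (diagonal (RCLike.ofReal ∘ hx.eigenvalues : n → ℂ)) p =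
      diagonal (fun i => (f (hx.eigenvalues i) : ℂ)) := by
    have h := Polynomial.aeval_algHom_apply (diagonalAlgHom (n := n) (α := ℂ) ℂ)
      (RCLike.ofReal ∘ hx.eigenvalues : n → ℂ) p
    simp only [diagonalAlgHom_apply] at h
    rw [h]
    congr 1
    funext i
    rw [← hp i, ← Polynomial.coe_aeval_eq_eval]
    exact (Polynomial.aeval_algHom_apply (Pi.evalAlgHom ℂ (fun _ : n => ℂ) i) _ p).symm
  conv_rhs => rw [hx.spectral_theorem]
  rw [Polynomial.aeval_algHom_apply, hdiag, Unitary.conjStarAlgAut_apply]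
  rfl

/-- A star-subalgebra containing a Hermitian matrix is closed under its functional calculus. -/
theorem Matrix.IsHermitian.applyFn_mem {n : Type*} [Fintype n] [DecidableEq n]
    (M : StarSubalgebra ℂ (Matrix n n ℂ)) {x : Matrix n n ℂ} (hxM : x ∈ M)
    (hx : x.IsHermitian) (f : ℝ → ℝ) : hx.applyFn f ∈ M := by
  rw [hx.applyFn_eq_aeval f (Lagrange.interpolate (Finset.univ.image hx.eigenvalues)
    (fun t : ℝ => (t : ℂ)) (fun t : ℝ => (f t : ℂ)))]
  · exact Algebra.adjoin_le (S := M.toSubalgebra) (Set.singleton_subset_iff.mpr hxM)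
      (Polynomial.aeval_mem_adjoin_singleton ℂ x)
  · intro i
    exact Lagrange.eval_interpolate_at_node (v := fun t : ℝ => (t : ℂ))
      (fun t : ℝ => (f t : ℂ)) Complex.ofReal_injective.injOn
      (Finset.mem_image_of_mem _ (Finset.mem_univ i))

/-- If `M` is a von Neumann algebra on `ℂ^n` (a star-subalgebra of `Matrix n n ℂ`) and
`x ∈ M` is Hermitian, then for every `f : ℝ → ℝ` the matrix `f(x)` obtained by applying `f`
to the eigenvalues of `x` is again in `M`.  In particular (taking `f` to be an indicator
function) the orthogonal projection onto each eigenspace of `x` belongs to `M`. -/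
theorem functional_calculus_mem {n : Type*} [Fintype n] [DecidableEq n] [Nonempty n]
    (M : StarSubalgebra ℂ (Matrix n n ℂ)) (x : Matrix n n ℂ) (hxM : x ∈ M)
    (hx : x.IsHermitian) :
    (∀ f : ℝ → ℝ, hx.applyFn f ∈ M) ∧
    (∀ μ : ℝ, hx.applyFn (fun t => if t = μ then 1 else 0) ∈ M) := by
  exact ⟨fun f => hx.applyFn_mem M hxM f, fun _ => hx.applyFn_mem M hxM _⟩
end

section
/- Let M be a star-subalgebra of Matrix n n ℂ containing the identity. Then every element x ∈ M can be written as a linear combination of four unitary elements of M: there exist coefficients c₁, c₂, c₃, c₄ : ℂ and matrices u₁, u₂, u₃, u₄ ∈ M with uᵢᴴ * uᵢ = 1 for each i, such that x = c₁ • u₁ + c₂ • u₂ + c₃ • u₃ + c₄ • u₄. -/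
open Matrix

open scoped Matrix.Norms.L2Operator in
/-- Every element of a star-subalgebra `M` of `Matrix n n ℂ` is a linear combination of four
unitary elements of `M`, since `M` is a C⋆-algebra for the operator norm. -/
theorem StarSubalgebra.exists_sum_four_unitary_of_matrix {n : Type*} [Fintype n] [DecidableEq n]
    (M : StarSubalgebra ℂ (Matrix n n ℂ)) (x : M) :
    ∃ (u : Fin 4 → unitary M) (c : Fin 4 → ℂ), x = ∑ i, c i • (u i : M) := by
  have : IsClosed (M : Set (Matrix n n ℂ)) :=
    M.toSubalgebra.toSubmodule.closed_of_finiteDimensional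
  obtain ⟨u, c, h, -⟩ := CStarAlgebra.exists_sum_four_unitary x
  exact ⟨u, c, h⟩

/-- Every element of a von Neumann algebra `M` on `ℂ^n` (a star-subalgebra of
`Matrix n n ℂ`) is a linear combination of four unitary elements of `M`. -/
theorem linear_combination_of_four_unitaries {n : Type*} [Fintype n] [DecidableEq n]
    [Nonempty n] (M : StarSubalgebra ℂ (Matrix n n ℂ)) (x : Matrix n n ℂ) (hx : x ∈ M) :
    ∃ (c₁ c₂ c₃ c₄ : ℂ) (u₁ u₂ u₃ u₄ : Matrix n n ℂ),
      u₁ ∈ M ∧ u₂ ∈ M ∧ u₃ ∈ M ∧ u₄ ∈ M ∧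
      u₁ᴴ * u₁ = 1 ∧ u₂ᴴ * u₂ = 1 ∧ u₃ᴴ * u₃ = 1 ∧ u₄ᴴ * u₄ = 1 ∧
      x = c₁ • u₁ + c₂ • u₂ + c₃ • u₃ + c₄ • u₄ := by
  obtain ⟨u, c, h⟩ := M.exists_sum_four_unitary_of_matrix ⟨x, hx⟩
  have hu (i : Fin 4) : ((u i : M) : Matrix n n ℂ)ᴴ * ((u i : M) : Matrix n n ℂ) = 1 :=
    congrArg Subtype.val (Unitary.coe_star_mul_self (u i))
  refine ⟨c 0, c 1, c 2, c 3, (u 0 : M), (u 1 : M), (u 2 : M), (u 3 : M), (u 0 : M).2,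
    (u 1 : M).2, (u 2 : M).2, (u 3 : M).2, hu 0, hu 1, hu 2, hu 3, ?_⟩
  simpa [Fin.sum_univ_four] using congrArg Subtype.val h
end

section
/- Let M be a star-subalgebra of Matrix n n ℂ containing the identity, and let p ∈ M be a projection. Then for every matrix y : Matrix n n ℂ satisfying p * y * p = y, the following are equivalent: (i) y commutes with p * x * p for every x ∈ M; (ii) there exists z in the commutant of M (z commutes with every element of M) such that y = z * p. That is, on the subspace pℂ^n, the commutant of the algebra pMp is M'p. -/
open Matrix

open scoped InnerProductSpace TensorProduct

theorem LinearMap.exists_comp_eq_of_ker_le {K U V W : Type*} [Field K] [AddCommGroup U] [Module K U]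
    [AddCommGroup V] [Module K V] [AddCommGroup W] [Module K W] {f : U →ₗ[K] V} {g : U →ₗ[K] W}
    (h : LinearMap.ker f ≤ LinearMap.ker g) : ∃ k : V →ₗ[K] W, k ∘ₗ f = g := by
  obtain ⟨k, hk⟩ := LinearMap.exists_extend
    ((LinearMap.ker f).liftQ g h ∘ₗ f.quotKerEquivRange.symm.toLinearMap)
  refine ⟨k, LinearMap.ext fun t => ?_⟩
  have := DFunLike.congr_fun hk ⟨f t, LinearMap.mem_range_self f t⟩
  simpa [LinearMap.quotKerEquivRange_symm_apply_image] using this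

section StarSubalgebraAction

variable {E : Type*} [NormedAddCommGroup E] [InnerProductSpace ℂ E] [CompleteSpace E]

/-- The linear map `M ⊗ E → E` sending `x ⊗ v` to `x (q v)`. -/
noncomputable def StarSubalgebra.tensorAct (M : StarSubalgebra ℂ (E →L[ℂ] E)) (q : E →L[ℂ] E) :
    M ⊗[ℂ] E →ₗ[ℂ] E :=
  TensorProduct.lift
    { toFun := fun x => ((x : E →L[ℂ] E) * q : E →L[ℂ] E).toLinearMap
      map_add' := fun a b => by ext; simp
      map_smul' := fun c a => by ext; simp }

@[simp]
theorem StarSubalgebra.tensorAct_tmul (M : StarSubalgebra ℂ (E →L[ℂ] E)) (q : E →L[ℂ] E)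
    (x : M) (v : E) : M.tensorAct q (x ⊗ₜ[ℂ] v) = (x : E →L[ℂ] E) (q v) := rfl

theorem StarSubalgebra.tensorAct_mulLeft (M : StarSubalgebra ℂ (E →L[ℂ] E)) (q : E →L[ℂ] E)
    (a : M) (t : M ⊗[ℂ] E) :
    M.tensorAct q ((LinearMap.mulLeft ℂ a).rTensor E t) = (a : E →L[ℂ] E) (M.tensorAct q t) := by
  induction t with
  | zero => simp
  | add s t hs ht => simp [hs, ht]
  | tmul x v => simp

/-- If `y` is supported on the range of a projection `p` and commutes with `pMp`, then
`x p v ↦ x y v` is well defined on the span of `M p E`. -/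
theorem StarSubalgebra.ker_tensorAct_le (M : StarSubalgebra ℂ (E →L[ℂ] E)) {p y : E →L[ℂ] E}
    (hp : IsSelfAdjoint p) (hpy : p * y = y) (hyp : y * p = y)
    (h : ∀ x ∈ M, y * (p * x * p) = (p * x * p) * y) :
    LinearMap.ker (M.tensorAct p) ≤ LinearMap.ker (M.tensorAct y) := by
  have key (a : M) (t : M ⊗[ℂ] E) :
      p ((star a : M).1 (M.tensorAct y t)) = y ((star a : M).1 (M.tensorAct p t)) := by
    induction t with
    | zero => simp
    | add s t hs ht => simp only [map_add, hs, ht]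
    | tmul x v =>
      have h1 : y * (star a * x : M).1 * p = p * (star a * x : M).1 * y := by
        have := h _ (star a * x : M).2
        simpa only [← mul_assoc, hyp, mul_assoc _ p y, hpy] using this
      exact (DFunLike.congr_fun h1 v).symm
  intro t ht
  rw [LinearMap.mem_ker] at ht ⊢
  have orth (s : M ⊗[ℂ] E) : ⟪M.tensorAct y s, M.tensorAct y t⟫_ℂ = 0 := by
    induction s with
    | zero => simp
    | add s s' hs hs' => rw [map_add, inner_add_left, hs, hs', add_zero]
    | tmul x v =>
      have hy : y v = p (y v) := (DFunLike.congr_fun hpy v).symm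
      rw [tensorAct_tmul, ← ContinuousLinearMap.adjoint_inner_right, hy,
        ← ContinuousLinearMap.adjoint_inner_right, ← ContinuousLinearMap.star_eq_adjoint p, hp.star_eq]
      have := key x t
      rw [ht] at this
      simp only [map_zero] at this
      change ⟪y v, p ((star x : M).1 _)⟫_ℂ = 0
      rw [this, inner_zero_right]
  exact inner_self_eq_zero.mp (orth t)

/-- The orthogonal projection onto an invariant subspace of a star-subalgebra lies in its
commutant. -/
theorem StarSubalgebra.commute_starProjection (M : StarSubalgebra ℂ (E →L[ℂ] E))
    (N : Submodule ℂ E) [N.HasOrthogonalProjection] (hN : ∀ x ∈ M, ∀ v ∈ N, x v ∈ N)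
    (x : E →L[ℂ] E) (hx : x ∈ M) (v : E) : N.starProjection (x v) = x (N.starProjection v) := by
  refine Submodule.eq_starProjection_of_mem_of_inner_eq_zero (hN x hx _ (by simp)) fun w hw => ?_
  rw [← map_sub, ← ContinuousLinearMap.adjoint_inner_right]
  exact Submodule.starProjection_inner_eq_zero v _ (hN _ (star_mem hx) w hw)

theorem StarSubalgebra.exists_commutant_mul_eq [FiniteDimensional ℂ E]
    (M : StarSubalgebra ℂ (E →L[ℂ] E)) {p y : E →L[ℂ] E}
    (hp : IsSelfAdjoint p) (hpy : p * y = y) (hyp : y * p = y)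
    (h : ∀ x ∈ M, y * (p * x * p) = (p * x * p) * y) :
    ∃ z : E →L[ℂ] E, (∀ x ∈ M, z * x = x * z) ∧ y = z * p := by
  obtain ⟨g, hg⟩ := LinearMap.exists_comp_eq_of_ker_le (M.ker_tensorAct_le hp hpy hyp h)
  have hg' (t) : g (M.tensorAct p t) = M.tensorAct y t := DFunLike.congr_fun hg t
  set N := LinearMap.range (M.tensorAct p)
  have hN : ∀ x ∈ M, ∀ v ∈ N, x v ∈ N := by
    rintro x hx _ ⟨t, rfl⟩
    exact ⟨_, M.tensorAct_mulLeft p ⟨x, hx⟩ t⟩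
  refine ⟨LinearMap.toContinuousLinearMap g * N.starProjection, fun x hx => ?_, ?_⟩
  · ext v
    obtain ⟨t, ht⟩ : N.starProjection v ∈ N := by simp
    simp only [mul_apply_eq_comp, M.commute_starProjection N hN x hx v, ← ht,
      LinearMap.coe_toContinuousLinearMap']
    rw [← M.tensorAct_mulLeft p ⟨x, hx⟩ t, hg', hg', M.tensorAct_mulLeft]
  · ext v
    have hv : p v = M.tensorAct p (1 ⊗ₜ v) := by simp
    have : N.starProjection (p v) = p v :=
      Submodule.starProjection_eq_self_iff.mpr ⟨1 ⊗ₜ v, hv.symm⟩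
    simp only [mul_apply_eq_comp, this, LinearMap.coe_toContinuousLinearMap']
    rw [hv, hg']
    simp

end StarSubalgebraAction

/-- Let `M` be a von Neumann algebra on `ℂ^n` (a star-subalgebra of `Matrix n n ℂ`) and
`p ∈ M` a projection.  For every matrix `y` with `p * y * p = y` (i.e. supported on the
subspace `pℂ^n`), `y` commutes with all of `pMp` if and only if `y = z * p` for some `z`
in the commutant of `M`: the commutant of `pMp` on `pℂ^n` is `M'p`. -/
theorem commutant_of_corner_algebra {n : Type*} [Fintype n] [DecidableEq n] [Nonempty n]
    (M : StarSubalgebra ℂ (Matrix n n ℂ)) (p : Matrix n n ℂ) (hpM : p ∈ M)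
    (hp : Matrix.IsProjection p) (y : Matrix n n ℂ) (hy : p * y * p = y) :
    (∀ x ∈ M, y * (p * x * p) = (p * x * p) * y) ↔
    ∃ z : Matrix n n ℂ, (∀ x ∈ M, z * x = x * z) ∧ y = z * p := by
  obtain ⟨hps, hpp⟩ := hp
  constructor
  · intro h
    have hpy : p * y = y := by rw [← hy, ← mul_assoc, ← mul_assoc, hpp]
    have hyp : y * p = y := by rw [← hy, mul_assoc, hpp]
    let e := Matrix.toEuclideanCLM (n := n) (𝕜 := ℂ)
    obtain ⟨z, hz, hyz⟩ := (M.map (e : Matrix n n ℂ →⋆ₐ[ℂ] _)).exists_commutant_mul_eq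
      (p := e p) (y := e y) (by rw [IsSelfAdjoint, ← map_star]; exact congrArg e hps)
      (by rw [← map_mul, hpy]) (by rw [← map_mul, hyp])
      (by
        rintro _ ⟨x, hx, rfl⟩
        change e y * (e p * e x * e p) = e p * e x * e p * e y
        simpa only [map_mul] using congrArg e (h x hx))
    obtain ⟨z, rfl⟩ := e.surjective z
    refine ⟨z, fun x hx => e.injective ?_, e.injective ?_⟩
    · rw [map_mul, map_mul]
      exact hz (e x) ⟨x, hx, rfl⟩
    · rw [map_mul]
      exact hyz
  · rintro ⟨z, hz, rfl⟩ x hx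
    have hzp := hz p hpM
    have hc := hz (p * x * p) (mul_mem (mul_mem hpM hx) hpM)
    calc z * p * (p * x * p) = z * (p * p * x * p) := by simp only [mul_assoc]
      _ = p * x * p * z := by rw [hpp, hc]
      _ = p * x * (p * p) * z := by rw [hpp]
      _ = p * x * p * (z * p) := by rw [hzp]; simp only [mul_assoc]
end

section
/- Let M be a star-subalgebra of Matrix n n ℂ containing the identity which is a factor, and let p, q ∈ M be nonzero projections. Then there exists a unitary u ∈ M (uᴴ * u = 1) such that p * u * q ≠ 0. -/
open Matrix

open scoped Matrix.Norms.L2Operator in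
/-- A star-subalgebra of the complex matrices is linearly spanned by its unitaries. -/
theorem StarSubalgebra.mem_span_unitary_matrix {n : Type*} [Fintype n] [DecidableEq n]
    (M : StarSubalgebra ℂ (Matrix n n ℂ)) {x : Matrix n n ℂ} (hx : x ∈ M) :
    x ∈ Submodule.span ℂ {u : Matrix n n ℂ | u ∈ M ∧ uᴴ * u = 1} := by
  have hclosed : IsClosed (M : Set (Matrix n n ℂ)) :=
    Submodule.closed_of_finiteDimensional M.toSubalgebra.toSubmodule
  have hspan : (⟨x, hx⟩ : M) ∈ Submodule.span ℂ (unitary M : Set M) := by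
    rw [CStarAlgebra.span_unitary]
    trivial
  have hmap := Submodule.mem_map_of_mem (f := M.subtype.toAlgHom.toLinearMap) hspan
  rw [Submodule.map_span] at hmap
  refine Submodule.span_mono ?_ hmap
  rintro _ ⟨u, hu, rfl⟩
  exact ⟨u.2, congrArg Subtype.val (Unitary.mem_iff.mp hu).1⟩

open scoped ComplexOrder in
/-- Orthogonal decomposition of a matrix with respect to the trace inner product. -/
theorem Matrix.exists_add_trace_orthogonal {n : Type*} [Fintype n] [DecidableEq n]
    (I : Submodule ℂ (Matrix n n ℂ)) (a : Matrix n n ℂ) :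
    ∃ e ∈ I, ∃ f : Matrix n n ℂ, (∀ b ∈ I, (f * bᴴ).trace = 0) ∧ a = e + f := by
  let : NormedAddCommGroup (Matrix n n ℂ) :=
    Matrix.toMatrixNormedAddCommGroup 1 Matrix.PosDef.one
  let : InnerProductSpace ℂ (Matrix n n ℂ) :=
    Matrix.toMatrixInnerProductSpace 1 Matrix.PosSemidef.one
  obtain ⟨e, he, f, hf, hef⟩ := I.exists_add_mem_mem_orthogonal a
  refine ⟨e, he, f, fun b hb ↦ ?_, hef⟩
  have h : (f * 1 * bᴴ).trace = 0 := (Submodule.mem_orthogonal I f).mp hf b hb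
  rwa [mul_one] at h

open scoped ComplexOrder in
/-- In a factor, the product of two nonzero elements `p` and `q` can be made nonzero by
inserting a suitable element between them. -/
theorem StarSubalgebra.exists_mul_mul_ne_zero_of_factor {n : Type*} [Fintype n] [DecidableEq n]
    (M : StarSubalgebra ℂ (Matrix n n ℂ))
    (hfactor : ∀ z ∈ M, (∀ x ∈ M, z * x = x * z) → ∃ c : ℂ, z = c • (1 : Matrix n n ℂ))
    {p q : Matrix n n ℂ} (hqM : q ∈ M) (hp0 : p ≠ 0) (hq0 : q ≠ 0) :
    ∃ x ∈ M, p * x * q ≠ 0 := by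
  by_contra! hpq
  let I : Submodule ℂ (Matrix n n ℂ) :=
    { carrier := {x | x ∈ M ∧ ∀ y ∈ M, p * y * x = 0}
      add_mem' := fun ha hb ↦ ⟨add_mem ha.1 hb.1, fun y hy ↦ by
        rw [mul_add, ha.2 y hy, hb.2 y hy, add_zero]⟩
      zero_mem' := ⟨zero_mem M, fun y _ ↦ mul_zero _⟩
      smul_mem' := fun c x hx ↦ ⟨SMulMemClass.smul_mem c hx.1, fun y hy ↦ by
        rw [mul_smul_comm, hx.2 y hy, smul_zero]⟩ }
  have hI_left {x b : Matrix n n ℂ} (hx : x ∈ M) (hb : b ∈ I) : x * b ∈ I :=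
    ⟨mul_mem hx hb.1, fun y hy ↦ by
      simpa only [mul_assoc] using hb.2 (y * x) (mul_mem hy hx)⟩
  have hI_right {x b : Matrix n n ℂ} (hx : x ∈ M) (hb : b ∈ I) : b * x ∈ I :=
    ⟨mul_mem hb.1 hx, fun y hy ↦ by rw [← mul_assoc, hb.2 y hy, zero_mul]⟩
  have hstar {x : Matrix n n ℂ} (hx : x ∈ M) : xᴴ ∈ M := star_mem hx
  obtain ⟨e, he, f, hf, hef⟩ := Matrix.exists_add_trace_orthogonal I 1
  have hf_left {x : Matrix n n ℂ} (hx : x ∈ M) (b : Matrix n n ℂ) (hb : b ∈ I) :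
      (x * f * bᴴ).trace = 0 := by
    have h := hf _ (hI_left (hstar hx) hb)
    rwa [conjTranspose_mul, conjTranspose_conjTranspose, ← mul_assoc, trace_mul_comm,
      ← mul_assoc] at h
  have hf_right {x : Matrix n n ℂ} (hx : x ∈ M) (b : Matrix n n ℂ) (hb : b ∈ I) :
      (f * x * bᴴ).trace = 0 := by
    have h := hf _ (hI_right (hstar hx) hb)
    rwa [conjTranspose_mul, conjTranspose_conjTranspose, ← mul_assoc] at h
  have hcentral : ∀ x ∈ M, e * x = x * e := by
    intro x hx
    have heq : e * x - x * e = x * f - f * x := by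
      rw [eq_sub_of_add_eq' hef.symm]
      noncomm_ring
    have hmem : e * x - x * e ∈ I := sub_mem (hI_right hx he) (hI_left hx he)
    rw [← sub_eq_zero, ← trace_mul_conjTranspose_self_eq_zero_iff]
    nth_rewrite 1 [heq]
    rw [sub_mul, trace_sub, hf_left hx _ hmem, hf_right hx _ hmem, sub_zero]
  have hqI : q ∈ I := ⟨hqM, hpq⟩
  have hfq : f * q = 0 := by
    have hmem : f * q ∈ I := by
      rw [eq_sub_of_add_eq' hef.symm, sub_mul, one_mul]
      exact sub_mem hqI (hI_right hqM he)
    rw [← trace_mul_conjTranspose_self_eq_zero_iff]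
    exact hf_right hqM _ hmem
  obtain ⟨c, rfl⟩ := hfactor e he.1 hcentral
  have hc : c ≠ 0 := by
    rintro rfl
    rw [zero_smul, zero_add] at hef
    rw [← hef, one_mul] at hfq
    exact hq0 hfq
  have hpc : c • p = 0 := by simpa using he.2 1 (one_mem M)
  exact (smul_ne_zero hc hp0) hpc

/-- If `M` is a von Neumann algebra on `ℂ^n` (a star-subalgebra of `Matrix n n ℂ`) which
is a factor (its center consists of scalar multiples of the identity), and `p, q ∈ M` are
nonzero projections, then there is a unitary `u ∈ M` with `p * u * q ≠ 0`. -/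
theorem factor_projections_connected {n : Type*} [Fintype n] [DecidableEq n] [Nonempty n]
    (M : StarSubalgebra ℂ (Matrix n n ℂ))
    (hfactor : ∀ z ∈ M, (∀ x ∈ M, z * x = x * z) → ∃ c : ℂ, z = c • (1 : Matrix n n ℂ))
    (p q : Matrix n n ℂ) (hpM : p ∈ M) (hqM : q ∈ M)
    (hp : Matrix.IsProjection p) (hq : Matrix.IsProjection q)
    (hp0 : p ≠ 0) (hq0 : q ≠ 0) :
    ∃ u : Matrix n n ℂ, u ∈ M ∧ uᴴ * u = 1 ∧ p * u * q ≠ 0 := by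
  by_contra! hpq
  obtain ⟨x, hx, hne⟩ := M.exists_mul_mul_ne_zero_of_factor hfactor hqM hp0 hq0
  refine hne ?_
  have hspan := M.mem_span_unitary_matrix hx
  clear hne hx
  induction hspan using Submodule.span_induction with
  | mem u hu => exact hpq u hu.1 hu.2
  | zero => simp
  | add a b _ _ ha hb => rw [mul_add, add_mul, ha, hb, add_zero]
  | smul c a _ ha => rw [mul_smul_comm, smul_mul_assoc, ha, smul_zero]
end

section
/- Let M be a star-subalgebra of Matrix n n ℂ containing the identity, and let p ∈ M be a minimal projection, i.e. a nonzero projection such that every projection q ∈ M with q * p = q satisfies q = 0 or q = p. Then for every x ∈ M there exists a scalar c : ℂ such that p * x * p = c • p. -/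
open Matrix

open Polynomial in
/-- Real polynomials agreeing on the spectrum of a Hermitian matrix take the same value at it. -/
theorem Matrix.IsHermitian.aeval_eq_of_eqOn_spectrum {n : Type*} [Fintype n] [DecidableEq n]
    {y : Matrix n n ℂ} (hy : y.IsHermitian) {f g : ℝ[X]}
    (h : ∀ t ∈ spectrum ℝ y, f.eval t = g.eval t) : aeval y f = aeval y g := by
  have hy' : IsSelfAdjoint y := hy
  rw [← cfc_polynomial f y hy', ← cfc_polynomial g y hy']
  exact cfc_congr h

open Polynomial in
/-- A real polynomial in a Hermitian matrix is Hermitian. -/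
theorem Matrix.IsHermitian.aeval {n : Type*} [Fintype n] [DecidableEq n]
    {y : Matrix n n ℂ} (hy : y.IsHermitian) (f : ℝ[X]) :
    (Polynomial.aeval y f).IsHermitian := by
  have hy' : IsSelfAdjoint y := hy
  rw [← cfc_polynomial f y hy']
  exact cfc_predicate (R := ℝ) (p := IsSelfAdjoint) _ y

open Polynomial in
/-- A Hermitian element of the corner of a minimal projection is a scalar multiple of it. -/
theorem Matrix.IsHermitian.eq_smul_of_minimal_projection {n : Type*} [Fintype n] [DecidableEq n]
    (M : StarSubalgebra ℂ (Matrix n n ℂ)) {p y : Matrix n n ℂ} (hpM : p ∈ M)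
    (hp : Matrix.IsProjection p)
    (hmin : ∀ q ∈ M, Matrix.IsProjection q → q * p = q → q = 0 ∨ q = p)
    (hyM : y ∈ M) (hy : y.IsHermitian) (hpy : p * y = y) (hyp : y * p = y) :
    ∃ c : ℝ, y = c • p := by
  classical
  have hfin : (spectrum ℝ y).Finite := Matrix.finite_real_spectrum
  let S : Finset ℝ := insert 0 hfin.toFinset
  have hS : ∀ t ∈ spectrum ℝ y, t ∈ S := fun t ht => by simp [S, ht]
  let b : ℝ → ℝ[X] := Lagrange.basis S id
  have hb : ∀ s ∈ S, ∀ t ∈ S, (b s).eval t = if s = t then 1 else 0 := by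
    intro s hs t ht
    split_ifs with hst
    · subst hst
      exact Lagrange.eval_basis_self (v := id) Function.injective_id.injOn hs
    · exact Lagrange.eval_basis_of_ne (v := id) hst ht
  have hcomm (f : ℝ[X]) : Commute p (Polynomial.aeval y f) := by
    have hc : Commute p y := hpy.trans hyp.symm
    induction f using Polynomial.induction_on' with
    | add f g hf hg => rw [map_add]; exact hf.add_right hg
    | monomial k a =>
      rw [aeval_monomial]
      exact (Algebra.commute_algebraMap_right a p).mul_right (hc.pow_right k)
  have hmem (f : ℝ[X]) : Polynomial.aeval y f ∈ M :=
    Algebra.adjoin_le (S := M.toSubalgebra.restrictScalars ℝ)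
      (Set.singleton_subset_iff.mpr hyM) (aeval_mem_adjoin_singleton ℝ y)
  have hidem : ∀ s ∈ S, Polynomial.aeval y (b s) * Polynomial.aeval y (b s) =
      Polynomial.aeval y (b s) := by
    intro s hs
    rw [← map_mul]
    refine hy.aeval_eq_of_eqOn_spectrum fun t ht => ?_
    rw [eval_mul, hb s hs t (hS t ht)]
    split_ifs <;> simp
  have heig : ∀ s ∈ S, y * Polynomial.aeval y (b s) = s • Polynomial.aeval y (b s) := by
    intro s hs
    have h : Polynomial.aeval y (X * b s) = Polynomial.aeval y (C s * b s) := by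
      refine hy.aeval_eq_of_eqOn_spectrum fun t ht => ?_
      rw [eval_mul, eval_mul, hb s hs t (hS t ht), eval_X, eval_C]
      split_ifs with hst <;> simp [hst]
    rwa [map_mul, aeval_X, map_mul, aeval_C, ← Algebra.smul_def] at h
  have hdich : ∀ s ∈ S, p * Polynomial.aeval y (b s) = 0 ∨ p * Polynomial.aeval y (b s) = p := by
    intro s hs
    refine hmin _ (mul_mem hpM (hmem _)) ⟨?_, ?_⟩ ?_
    · rw [conjTranspose_mul, hp.1, (hy.aeval (b s)).eq, (hcomm (b s)).eq]
    · rw [(hcomm (b s)).symm.mul_mul_mul_comm, hp.2, hidem s hs]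
    · rw [mul_assoc, ← (hcomm (b s)).eq, ← mul_assoc, hp.2]
  have hsum : ∑ s ∈ S, p * Polynomial.aeval y (b s) = p := by
    rw [← Finset.mul_sum, ← map_sum,
      Lagrange.sum_basis (v := id) Function.injective_id.injOn ⟨0, by simp [S]⟩, map_one, mul_one]
  by_cases hall : ∀ s ∈ S, p * Polynomial.aeval y (b s) = 0
  · rw [Finset.sum_eq_zero hall] at hsum
    exact ⟨0, by rw [← hyp, ← hsum]; simp⟩
  · push Not at hall
    obtain ⟨s, hs, hne⟩ := hall
    have hps := (hdich s hs).resolve_left hne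
    refine ⟨s, ?_⟩
    calc y = y * (p * Polynomial.aeval y (b s)) := by rw [hps, hyp]
      _ = y * Polynomial.aeval y (b s) * p := by rw [(hcomm (b s)).eq, mul_assoc]
      _ = s • p := by rw [heig s hs, smul_mul_assoc, ← (hcomm (b s)).eq, hps]


/-- If `M` is a von Neumann algebra on `ℂ^n` (a star-subalgebra of `Matrix n n ℂ`) and
`p ∈ M` is a minimal projection (a nonzero projection such that the only projections
`q ∈ M` with `q ≤ p`, i.e. `q * p = q`, are `0` and `p`), then `p * M * p = ℂ p`:
for every `x ∈ M` there is `c : ℂ` with `p * x * p = c • p`. -/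
theorem minimal_projection_corner {n : Type*} [Fintype n] [DecidableEq n] [Nonempty n]
    (M : StarSubalgebra ℂ (Matrix n n ℂ)) (p : Matrix n n ℂ) (hpM : p ∈ M)
    (hp : Matrix.IsProjection p) (hp0 : p ≠ 0)
    (hmin : ∀ q ∈ M, Matrix.IsProjection q → q * p = q → q = 0 ∨ q = p) :
    ∀ x ∈ M, ∃ c : ℂ, p * x * p = c • p := by
  intro x hx
  have key : ∀ h ∈ M, hᴴ = h → ∃ c : ℝ, p * h * p = c • p := by
    intro h hM hh
    refine Matrix.IsHermitian.eq_smul_of_minimal_projection M hpM hp hmin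
      (mul_mem (mul_mem hpM hM) hpM) ?_ ?_ ?_
    · simp only [Matrix.IsHermitian, conjTranspose_mul, hp.1, hh, mul_assoc]
    · rw [← mul_assoc, ← mul_assoc, hp.2]
    · rw [mul_assoc, hp.2]
  have hx' : xᴴ ∈ M := star_mem hx
  obtain ⟨a, ha⟩ := key (x + xᴴ) (add_mem hx hx') (by simp [add_comm])
  obtain ⟨b, hb⟩ := key (Complex.I • (x - xᴴ)) (M.smul_mem (sub_mem hx hx') _)
    (by simp [conjTranspose_smul, smul_sub, neg_add_eq_sub])
  refine ⟨(a - Complex.I * b) / 2, ?_⟩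
  have hdecomp : x = (1 / 2 : ℂ) • (x + xᴴ) - (Complex.I / 2) • (Complex.I • (x - xᴴ)) := by
    rw [smul_smul, div_mul_eq_mul_div, Complex.I_mul_I]
    module
  rw [hdecomp, mul_sub, sub_mul, mul_smul_comm, smul_mul_assoc, mul_smul_comm (Complex.I / 2),
    smul_mul_assoc, ha, hb, ← Complex.coe_smul a, ← Complex.coe_smul b]
  module
end

section
/- (Classification of finite-dimensional factors.) Let M be a star-subalgebra of Matrix n n ℂ containing the identity which is a factor, and let N be the cardinality of n. Then there exist natural numbers d, m with N = d * m, an equivalence of index types e : n ≃ Fin d × Fin m, and a unitary matrix U : Matrix n n ℂ, such that M is exactly the set of matrices of the form U * (reindex of (x ⊗ₖ 1)) * Uᴴ where x ranges over all of Matrix (Fin d) (Fin d) ℂ, x ⊗ₖ 1 denotes the Kronecker product of x with the identity matrix of Matrix (Fin m) (Fin m) ℂ, and the reindexing is along e. Moreover the commutant of M is then exactly the set of matrices U * (reindex of (1 ⊗ₖ y)) * Uᴴ with y ranging over Matrix (Fin m) (Fin m) ℂ. -/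
open Matrix Kronecker
section

open scoped ComplexOrder MatrixOrder

theorem Matrix.single_mul_eq_sum {ι R : Type*} [Fintype ι] [DecidableEq ι] [Semiring R] (i j : ι)
    (y : Matrix ι ι R) : single i j 1 * y = ∑ l, y j l • single i l 1 := by
  ext a b
  simp [Matrix.sum_apply, mul_apply, single_apply, ite_and]

theorem Matrix.mul_single_eq_sum {ι R : Type*} [Fintype ι] [DecidableEq ι] [Semiring R] (i j : ι)
    (y : Matrix ι ι R) : y * single i j 1 = ∑ l, y l i • single l j 1 := by
  ext a b
  simp [Matrix.sum_apply, mul_apply, single_apply, ite_and]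

theorem Matrix.IsHermitian.eq_zero_of_isNilpotent {n : Type*} [Fintype n] [DecidableEq n]
    {y : Matrix n n ℂ} (hy : y.IsHermitian) (hnil : IsNilpotent y) : y = 0 := by
  have pow_two_pow_eq_zero (k : ℕ) : y ^ 2 ^ k = 0 → y = 0 := by
    induction k with
    | zero => simp
    | succ k ih =>
      intro h
      refine ih (conjTranspose_mul_self_eq_zero.mp ?_)
      rw [(hy.pow _).eq, ← pow_two, ← pow_mul, ← pow_succ, h]
  obtain ⟨k, hk⟩ := hnil
  exact pow_two_pow_eq_zero k (pow_eq_zero_of_le k.lt_two_pow_self.le hk)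

/-- A star-subalgebra of a complex matrix algebra is semisimple. -/
theorem StarSubalgebra.isSemisimpleRing_matrix {n : Type*} [Fintype n] [DecidableEq n]
    (M : StarSubalgebra ℂ (Matrix n n ℂ)) : IsSemisimpleRing M := by
  have : FiniteDimensional ℂ M :=
    FiniteDimensional.of_injective M.subtype.toLinearMap Subtype.val_injective
  have : IsArtinianRing M := IsArtinianRing.of_finite ℂ M
  rw [IsArtinianRing.isSemisimpleRing_iff_jacobson, eq_bot_iff]
  intro x hx
  obtain ⟨k, hk⟩ := IsSemiprimaryRing.isNilpotent (R := M)
  have hmem : star x * x ∈ Ring.jacobson M := Ideal.mul_mem_left _ _ hx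
  have hnil : (star x * x) ^ k = 0 := by
    have := Ideal.pow_mem_pow hmem k
    rwa [hk] at this
  have hnil' : IsNilpotent ((x : Matrix n n ℂ)ᴴ * (x : Matrix n n ℂ)) :=
    ⟨k, by simpa [star_eq_conjTranspose] using congrArg Subtype.val hnil⟩
  have := (isHermitian_conjTranspose_mul_self _).eq_zero_of_isNilpotent hnil'
  exact Subtype.ext (conjTranspose_mul_self_eq_zero.mp this)

/-- A finite-dimensional semisimple algebra over an algebraically closed field whose center
consists of scalars is a matrix algebra. -/
theorem IsSemisimpleRing.exists_algEquiv_matrix_of_central (F R : Type*) [Field F]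
    [IsAlgClosed F] [Ring R] [Nontrivial R] [Algebra F R] [FiniteDimensional F R]
    [IsSemisimpleRing R]
    (hR : ∀ z : R, (∀ x, z * x = x * z) → ∃ c : F, z = algebraMap F R c) :
    ∃ (d : ℕ) (_ : NeZero d), Nonempty (R ≃ₐ[F] Matrix (Fin d) (Fin d) F) := by
  have : IsSimpleRing R := by
    obtain ⟨k, d, hd, ⟨e⟩⟩ := IsSemisimpleRing.exists_algEquiv_pi_matrix_of_isAlgClosed F R
    have hsub : Subsingleton (Fin k) := by
      refine ⟨fun i j => ?_⟩
      by_contra hij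
      obtain ⟨c, hc⟩ := hR (e.symm (Pi.single i 1)) fun x => by
        apply e.injective
        simp only [map_mul, AlgEquiv.apply_symm_apply]
        ext l : 1
        by_cases hl : l = i
        · subst hl; simp
        · simp [hl]
      have hc' : (Pi.single i 1 : Π i, Matrix (Fin (d i)) (Fin (d i)) F) =
          algebraMap F _ c := by
        rw [← e.apply_symm_apply (Pi.single i 1), hc, AlgEquiv.commutes]
      have hi := congrFun (congrFun (congrFun hc' i) 0) 0
      have hj := congrFun (congrFun (congrFun hc' j) 0) 0
      simp [Pi.algebraMap_apply, algebraMap_matrix_apply, Ne.symm hij] at hi hj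
      exact one_ne_zero (hi.trans hj.symm)
    have : Nonempty (Fin k) := by
      by_contra h
      rw [not_nonempty_iff] at h
      exact not_subsingleton R e.toEquiv.subsingleton
    have : Unique (Fin k) := uniqueOfSubsingleton (Classical.arbitrary _)
    let e' := e.toRingEquiv.trans
      (RingEquiv.piUnique (fun i : Fin k => Matrix (Fin (d i)) (Fin (d i)) F))
    exact IsSimpleRing.of_ringEquiv e'.symm inferInstance
  exact IsSimpleRing.exists_algEquiv_matrix_of_isAlgClosed F R

theorem AlgHom.isUnit_of_isUnit_map_matrix {ι n : Type*} [Fintype ι] [DecidableEq ι] [Fintype n]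
    [DecidableEq n] (f : Matrix ι ι ℂ →ₐ[ℂ] Matrix n n ℂ) (hf : Function.Injective f)
    {x : Matrix ι ι ℂ} (hx : IsUnit (f x)) : IsUnit x := by
  have : IsArtinianRing (Matrix ι ι ℂ) := IsArtinianRing.of_finite ℂ _
  refine IsArtinianRing.isUnit_iff_isRightRegular.mpr fun y z h => hf (hx.mul_right_cancel ?_)
  simpa using congrArg f h

/-- An injective algebra homomorphism between matrix algebras with star-closed range is an inner
perturbation of a star-homomorphism. -/
theorem AlgHom.exists_starAlgHom_range_eq {ι n : Type*} [Fintype ι] [DecidableEq ι] [Fintype n]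
    [DecidableEq n] (f : Matrix ι ι ℂ →ₐ[ℂ] Matrix n n ℂ) (hf : Function.Injective f)
    (hstar : ∀ x, ∃ y, f y = (f x)ᴴ) :
    ∃ g : Matrix ι ι ℂ →⋆ₐ[ℂ] Matrix n n ℂ, Set.range g = Set.range f := by
  choose s hs using hstar
  let a : Matrix ι ι ℂ := ∑ i, ∑ j, s (single i j 1) * single i j 1
  let B : Matrix ((ι × ι) × n) n ℂ := of fun p b => f (single p.1.1 p.1.2 1) p.2 b
  have hsum : f a = ∑ i, ∑ j, (f (single i j 1))ᴴ * f (single i j 1) := by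
    simp [a, hs]
  have hB : f a = Bᴴ * B := by
    rw [hsum]
    ext b c
    rw [Matrix.mul_apply (M := Bᴴ), Fintype.sum_prod_type, Fintype.sum_prod_type]
    simp only [Matrix.sum_apply]
    rfl
  have hpos : (f a).PosDef := by
    rw [hB]
    refine PosDef.conjTranspose_mul_self _ ?_
    rw [← coe_mulVecLin, injective_iff_map_eq_zero]
    intro v hv
    have hii (i : ι) : f (single i i 1) *ᵥ v = 0 := by
      ext b
      exact congrFun hv ((i, i), b)
    calc v = f (∑ i, single i i 1) *ᵥ v := by
            rw [sum_single_one, map_one, one_mulVec]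
      _ = 0 := by simp [Matrix.sum_mulVec, hii]
  have hunit : IsUnit (f a) := hpos.isUnit
  have hrel (x : Matrix ι ι ℂ) : (f x)ᴴ * f a = f a * f xᴴ := by
    have hmul (i j : ι) (y : Matrix ι ι ℂ) :
        f (single i j 1) * f y = ∑ l, y j l • f (single i l 1) := by
      rw [← map_mul, single_mul_eq_sum, map_sum]
      simp only [map_smul]
    rw [hsum]
    simp only [Finset.mul_sum, Finset.sum_mul, Matrix.mul_assoc, hmul]
    simp only [← Matrix.mul_assoc, ← conjTranspose_mul, hmul, conjTranspose_sum, conjTranspose_smul,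
      Finset.sum_mul, conjTranspose_apply, mul_smul_comm, smul_mul_assoc]
    exact Finset.sum_congr rfl fun i _ => Finset.sum_comm
  have hher : a.IsHermitian := by
    apply hf
    have h := hrel aᴴ
    rw [conjTranspose_conjTranspose] at h
    have h' := hunit.mul_right_cancel h
    rw [← conjTranspose_conjTranspose (f aᴴ), h', hpos.1.eq]
  have haunit : IsUnit a := f.isUnit_of_isUnit_map_matrix hf hunit
  have hspec : spectrum ℂ a ⊆ spectrum ℂ (f a) := by
    intro c hc h
    refine hc (f.isUnit_of_isUnit_map_matrix hf ?_)
    simpa [resolventSet] using h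
  have hapos : a.PosDef := by
    refine PosSemidef.posDef_iff_isUnit ?_ |>.mpr haunit
    exact posSemidef_iff_isHermitian_and_spectrum_nonneg.mpr ⟨hher,
      hspec.trans (posSemidef_iff_isHermitian_and_spectrum_nonneg.mp hpos.posSemidef).2⟩
  obtain ⟨b, hbu, hb⟩ : ∃ b : Matrix ι ι ℂ, IsUnit b ∧ a = bᴴ * b := by
    obtain ⟨b, hb⟩ := CStarAlgebra.nonneg_iff_eq_star_mul_self.mp hapos.posSemidef.nonneg
    refine ⟨b, ?_, hb⟩
    rw [hb, isUnit_iff_isUnit_det, det_mul] at haunit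
    exact (isUnit_iff_isUnit_det b).mpr (isUnit_of_mul_isUnit_right haunit)
  have hbdet : IsUnit b.det := (isUnit_iff_isUnit_det _).mp hbu
  have hbdet' : IsUnit bᴴ.det := by simpa [det_conjTranspose] using hbdet
  let g₀ : Matrix ι ι ℂ →ₗ[ℂ] Matrix n n ℂ :=
    f.toLinearMap ∘ₗ LinearMap.mulLeft ℂ bᴴ ∘ₗ LinearMap.mulRight ℂ (bᴴ)⁻¹
  have hg₀ (x) : g₀ x = f (bᴴ * (x * (bᴴ)⁻¹)) := rfl
  let g : Matrix ι ι ℂ →ₐ[ℂ] Matrix n n ℂ := AlgHom.ofLinearMap g₀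
    (by simp [hg₀, mul_nonsing_inv _ hbdet'])
    (fun x y => by
      rw [hg₀, hg₀, hg₀, ← map_mul]
      congr 1
      simp only [Matrix.mul_assoc, nonsing_inv_mul_cancel_left _ _ hbdet'])
  refine ⟨{ g with map_star' := fun x => ?_ }, ?_⟩
  · change f (bᴴ * (xᴴ * (bᴴ)⁻¹)) = (f (bᴴ * (x * (bᴴ)⁻¹)))ᴴ
    apply hunit.mul_right_cancel
    rw [hrel, ← map_mul, ← map_mul, hb]
    refine congrArg f ?_
    simp only [conjTranspose_mul, conjTranspose_nonsing_inv, conjTranspose_conjTranspose,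
      Matrix.mul_assoc, nonsing_inv_mul_cancel_left _ _ hbdet',
      mul_nonsing_inv_cancel_left _ _ hbdet]
  · ext y
    constructor
    · rintro ⟨x, rfl⟩
      exact ⟨_, rfl⟩
    · rintro ⟨x, rfl⟩
      refine ⟨(bᴴ)⁻¹ * (x * bᴴ), ?_⟩
      change f (bᴴ * ((bᴴ)⁻¹ * (x * bᴴ) * (bᴴ)⁻¹)) = f x
      refine congrArg f ?_
      simp only [Matrix.mul_assoc, mul_nonsing_inv _ hbdet', mul_nonsing_inv_cancel_left _ _ hbdet',
        mul_one]

/-- A Hermitian idempotent is the range projection of an isometry. -/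
theorem Matrix.IsHermitian.exists_isometry_of_isIdempotentElem {n : Type*} [Fintype n]
    [DecidableEq n] {P : Matrix n n ℂ} (hP : P.IsHermitian) (hidem : IsIdempotentElem P) :
    ∃ (m : ℕ) (V : Matrix n (Fin m) ℂ), Vᴴ * V = 1 ∧ V * Vᴴ = P := by
  let W : Matrix n n ℂ := hP.eigenvectorUnitary
  have hW : Wᴴ * W = 1 := Unitary.coe_star_mul_self hP.eigenvectorUnitary
  let D : Matrix n n ℂ := diagonal fun i => (hP.eigenvalues i : ℂ)
  have hspec : P = W * D * Wᴴ := hP.spectral_theorem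
  have hD : D = Wᴴ * P * W := by
    rw [hspec]
    simp only [Matrix.mul_assoc, hW, mul_one]
    rw [← Matrix.mul_assoc, hW, one_mul]
  have hWW : W * Wᴴ = 1 := mul_eq_one_comm.mp hW
  have hDD : D * D = D := by
    calc D * D = Wᴴ * (P * (W * Wᴴ) * P) * W := by rw [hD]; simp only [Matrix.mul_assoc]
      _ = D := by rw [hWW, mul_one, hidem.eq, hD]
  have hev (i : n) : hP.eigenvalues i = 0 ∨ hP.eigenvalues i = 1 := by
    have h := congrFun (congrFun hDD i) i
    simp only [D, diagonal_mul_diagonal, diagonal_apply_eq] at h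
    have h' : hP.eigenvalues i * hP.eigenvalues i = hP.eigenvalues i := by exact_mod_cast h
    rcases eq_or_ne (hP.eigenvalues i) 0 with h0 | h0
    · exact .inl h0
    · exact .inr (mul_left_cancel₀ h0 (by rw [h', mul_one]))
  let κ := {i : n // hP.eigenvalues i = 1}
  let e : κ ≃ Fin (Fintype.card κ) := Fintype.equivFin κ
  refine ⟨Fintype.card κ, W.submatrix id (fun k => (e.symm k).1), ?_, ?_⟩
  · rw [conjTranspose_submatrix, ← submatrix_mul _ _ _ _ _ Function.bijective_id, hW]
    exact submatrix_one _ (Subtype.val_injective.comp e.symm.injective)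
  · refine Eq.trans ?_ hspec.symm
    ext a b
    rw [mul_apply, mul_apply]
    simp only [conjTranspose_apply, submatrix_apply, id, D, mul_diagonal]
    rw [e.symm.sum_comp (fun k : κ => W a k.1 * star (W b k.1)),
      ← Finset.sum_subtype (Finset.univ.filter fun i => hP.eigenvalues i = 1) (by simp)
        (fun i => W a i * star (W b i)), Finset.sum_filter]
    refine Finset.sum_congr rfl fun i _ => ?_
    rcases hev i with h | h <;> simp [h]

/-- Every unital star-representation of a matrix algebra is unitarily equivalent to an
amplification. -/
theorem StarAlgHom.exists_unitary_kronecker {n : Type*} [Fintype n] [DecidableEq n] {d : ℕ}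
    [NeZero d] (g : Matrix (Fin d) (Fin d) ℂ →⋆ₐ[ℂ] Matrix n n ℂ) :
    ∃ (m : ℕ) (W : Matrix n (Fin d × Fin m) ℂ), Wᴴ * W = 1 ∧ W * Wᴴ = 1 ∧
      ∀ x, g x = W * (x ⊗ₖ (1 : Matrix (Fin m) (Fin m) ℂ)) * Wᴴ := by
  have hgstar (i j : Fin d) : (g (single i j 1))ᴴ = g (single j i 1) := by
    rw [← star_eq_conjTranspose, ← map_star, star_eq_conjTranspose, conjTranspose_single, star_one]
  have hgmul (i j k : Fin d) : g (single i j 1) * g (single j k 1) = g (single i k 1) := by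
    rw [← map_mul, single_mul_single_same, mul_one]
  obtain ⟨m, V, hV, hVP⟩ := IsHermitian.exists_isometry_of_isIdempotentElem
    (P := g (single 0 0 1)) (hgstar 0 0) (hgmul 0 0 0)
  have hPV : g (single 0 0 1) * V = V := by rw [← hVP, Matrix.mul_assoc, hV, Matrix.mul_one]
  let W : Matrix n (Fin d × Fin m) ℂ := of fun a p => (g (single p.1 0 1) * V) a p.2
  have hWW : Wᴴ * W = 1 := by
    ext ⟨i, k⟩ ⟨j, l⟩
    have : (Wᴴ * W) (i, k) (j, l) =
        ((g (single i 0 1) * V)ᴴ * (g (single j 0 1) * V)) k l := rfl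
    rw [this, conjTranspose_mul, hgstar, Matrix.mul_assoc, ← Matrix.mul_assoc (g _), ← map_mul]
    by_cases hij : i = j
    · subst hij
      rw [single_mul_single_same, mul_one, hPV, hV]
      simp [one_apply]
    · rw [single_mul_single_of_ne (h := hij), map_zero]
      simp [one_apply, hij]
  have hWW' : W * Wᴴ = 1 := by
    calc W * Wᴴ = ∑ i, (g (single i 0 1) * V) * (g (single i 0 1) * V)ᴴ := by
          ext a b
          simp only [mul_apply (M := W), Fintype.sum_prod_type, Matrix.sum_apply]
          rfl
      _ = ∑ i, g (single i i 1) := by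
          refine Finset.sum_congr rfl fun i _ => ?_
          rw [conjTranspose_mul, hgstar, Matrix.mul_assoc, ← Matrix.mul_assoc V, hVP, hgmul, hgmul]
      _ = 1 := by
          rw [← map_sum, sum_single_one, map_one]
  refine ⟨m, W, hWW, hWW', fun x => ?_⟩
  have hint : g x * W = W * (x ⊗ₖ (1 : Matrix (Fin m) (Fin m) ℂ)) := by
    ext a ⟨j, k⟩
    have h1 : (g x * W) a (j, k) = (g x * (g (single j 0 1) * V)) a k := rfl
    rw [h1, ← Matrix.mul_assoc, ← map_mul, mul_single_eq_sum]
    simp [mul_apply (M := W), Fintype.sum_prod_type, Matrix.sum_apply, Matrix.sum_mul, W,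
      one_apply, mul_comm, -smul_single]
  rw [← hint, Matrix.mul_assoc, hWW', mul_one]

/-- A matrix commuting with every `x ⊗ₖ 1` is of the form `1 ⊗ₖ z`. -/
theorem Matrix.exists_eq_one_kronecker_of_commute {ι κ : Type*} [Fintype ι] [DecidableEq ι]
    [Nonempty ι] [Fintype κ] [DecidableEq κ] {w : Matrix (ι × κ) (ι × κ) ℂ}
    (hw : ∀ x : Matrix ι ι ℂ, Commute (x ⊗ₖ (1 : Matrix κ κ ℂ)) w) :
    ∃ z : Matrix κ κ ℂ, w = (1 : Matrix ι ι ℂ) ⊗ₖ z := by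
  obtain ⟨j⟩ := ‹Nonempty ι›
  refine ⟨of fun a b => w (j, a) (j, b), ?_⟩
  ext ⟨k, a⟩ ⟨i, b⟩
  have h := congrFun (congrFun (hw (single i j 1)).eq (k, a)) (j, b)
  simp only [mul_apply, kroneckerMap_apply, Fintype.sum_prod_type, one_apply, single_apply] at h
  by_cases hki : k = i
  · subst hki
    simpa [eq_comm] using h.symm
  · simpa [hki, Ne.symm hki] using h.symm

end

/-- **Classification of finite-dimensional factors**: if `M` is a von Neumann algebra on
`ℂ^n` (a star-subalgebra of `Matrix n n ℂ`) which is a factor, then, with `N` the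
cardinality of `n`, there are `d, m` with `N = d * m`, an identification
`e : n ≃ Fin d × Fin m` and a unitary `U` such that `M` consists exactly of the matrices
`U * (x ⊗ₖ 1) * Uᴴ` with `x : Matrix (Fin d) (Fin d) ℂ` arbitrary, and the commutant of
`M` consists exactly of the matrices `U * (1 ⊗ₖ y) * Uᴴ` with
`y : Matrix (Fin m) (Fin m) ℂ` arbitrary (Kronecker factors reindexed along `e`). -/
theorem factor_classification {n : Type*} [Fintype n] [DecidableEq n] [Nonempty n]
    (M : StarSubalgebra ℂ (Matrix n n ℂ))
    (hfactor : ∀ z ∈ M, (∀ x ∈ M, z * x = x * z) → ∃ c : ℂ, z = c • (1 : Matrix n n ℂ)) :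
    ∃ (d m : ℕ) (e : n ≃ Fin d × Fin m) (U : Matrix n n ℂ),
      Fintype.card n = d * m ∧
      Uᴴ * U = 1 ∧
      (M : Set (Matrix n n ℂ)) =
        {y | ∃ x : Matrix (Fin d) (Fin d) ℂ,
          y = U * (Matrix.reindex e.symm e.symm
                (x ⊗ₖ (1 : Matrix (Fin m) (Fin m) ℂ))) * Uᴴ} ∧
      Set.centralizer (M : Set (Matrix n n ℂ)) =
        {y | ∃ z : Matrix (Fin m) (Fin m) ℂ,
          y = U * (Matrix.reindex e.symm e.symm
                ((1 : Matrix (Fin d) (Fin d) ℂ) ⊗ₖ z)) * Uᴴ} := by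
  have : FiniteDimensional ℂ M :=
    FiniteDimensional.of_injective M.subtype.toLinearMap Subtype.val_injective
  have := M.isSemisimpleRing_matrix
  obtain ⟨d, _, ⟨φ⟩⟩ := IsSemisimpleRing.exists_algEquiv_matrix_of_central ℂ M fun z hz => by
    obtain ⟨c, hc⟩ := hfactor z z.2 fun x hx => congrArg Subtype.val (hz ⟨x, hx⟩)
    exact ⟨c, Subtype.ext (by rw [hc, ← Algebra.algebraMap_eq_smul_one]; rfl)⟩
  let f : Matrix (Fin d) (Fin d) ℂ →ₐ[ℂ] Matrix n n ℂ :=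
    M.subtype.toAlgHom.comp φ.symm.toAlgHom
  have hf_apply (x) : f x = (φ.symm x : Matrix n n ℂ) := rfl
  have hf : Function.Injective f := Subtype.val_injective.comp φ.symm.injective
  have hrange : Set.range f = M := by
    ext y
    exact ⟨fun ⟨x, hx⟩ => hx ▸ (φ.symm x).2, fun hy => ⟨φ ⟨y, hy⟩, by simp [hf_apply]⟩⟩
  obtain ⟨g, hg⟩ := f.exists_starAlgHom_range_eq hf fun x => by
    have : (f x)ᴴ ∈ Set.range f := by
      rw [hrange]
      exact star_mem (φ.symm x).2
    exact this
  obtain ⟨m, W, hW, hW', hgW⟩ := g.exists_unitary_kronecker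
  have hcard : Fintype.card n = d * m := by
    have h := trace_mul_comm W Wᴴ
    rw [hW, hW', trace_one, trace_one] at h
    have h' : Fintype.card n = Fintype.card (Fin d × Fin m) := by exact_mod_cast h
    simpa using h'
  let e : n ≃ Fin d × Fin m := Fintype.equivOfCardEq (by simpa using hcard)
  have hconj (x : Matrix (Fin d × Fin m) (Fin d × Fin m) ℂ) :
      W.submatrix id e * reindex e.symm e.symm x * (W.submatrix id e)ᴴ = W * x * Wᴴ := by
    simp [reindex_apply, conjTranspose_submatrix, submatrix_mul_equiv]
  have hM : (M : Set (Matrix n n ℂ)) =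
      {y | ∃ x : Matrix (Fin d) (Fin d) ℂ,
        y = W * (x ⊗ₖ (1 : Matrix (Fin m) (Fin m) ℂ)) * Wᴴ} := by
    rw [← hrange, ← hg]
    ext y
    simp only [Set.mem_range, hgW, Set.mem_ofPred_eq, eq_comm]
  have hconj_mul (x y : Matrix (Fin d × Fin m) (Fin d × Fin m) ℂ) :
      W * x * Wᴴ * (W * y * Wᴴ) = W * (x * y) * Wᴴ := by
    calc W * x * Wᴴ * (W * y * Wᴴ) = W * (x * (Wᴴ * W) * y) * Wᴴ := by simp only [Matrix.mul_assoc]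
      _ = _ := by rw [hW, mul_one]
  have hconj_symm (x : Matrix (Fin d × Fin m) (Fin d × Fin m) ℂ) :
      Wᴴ * (W * x * Wᴴ) * W = x := by
    calc Wᴴ * (W * x * Wᴴ) * W = (Wᴴ * W) * x * (Wᴴ * W) := by simp only [Matrix.mul_assoc]
      _ = x := by rw [hW, mul_one, one_mul]
  refine ⟨d, m, e, W.submatrix id e, hcard, ?_, ?_, ?_⟩
  · rw [conjTranspose_submatrix, ← submatrix_mul _ _ _ _ _ Function.bijective_id, hW,
      submatrix_one_equiv]
  · simpa only [hconj] using hM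
  · simp only [hconj]
    ext y
    rw [Set.mem_centralizer_iff, hM]
    constructor
    · intro hy
      have hy_eq : y = W * (Wᴴ * y * W) * Wᴴ := by
        calc y = (W * Wᴴ) * y * (W * Wᴴ) := by rw [hW', mul_one, one_mul]
          _ = _ := by simp only [Matrix.mul_assoc]
      obtain ⟨z, hz⟩ := exists_eq_one_kronecker_of_commute (w := Wᴴ * y * W) fun x => by
        have h := hy _ ⟨x, rfl⟩
        rw [hy_eq, hconj_mul, hconj_mul] at h
        rw [Commute, SemiconjBy, ← hconj_symm (_ * (_ * _ * _)), h, hconj_symm]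
      exact ⟨z, hz ▸ hy_eq⟩
    · rintro ⟨z, rfl⟩ _ ⟨x, rfl⟩
      rw [hconj_mul, hconj_mul, ← mul_kronecker_mul, ← mul_kronecker_mul]
      simp
end

section
/- (Classification of von Neumann algebras on a finite-dimensional Hilbert space.) Let M be a star-subalgebra of Matrix n n ℂ containing the identity. Then there exist a natural number N, functions d, m : Fin N → ℕ, an equivalence of index types e : n ≃ Σ (α : Fin N), Fin (d α) × Fin (m α), and a unitary matrix U : Matrix n n ℂ, such that M is exactly the set of matrices of the form U * (reindex along e of the block-diagonal matrix whose α-block is x α ⊗ₖ 1) * Uᴴ, where (x α) ranges over all families with x α : Matrix (Fin (d α)) (Fin (d α)) ℂ; here the block-diagonal matrix y indexed by Σ α, Fin (d α) × Fin (m α) is defined by y (α,(i,j)) (β,(i',j')) = (if α = β ∧ j = j' then x α i i' else 0). Moreover the commutant of M is then the analogous set with blocks 1 ⊗ₖ (y α), y α : Matrix (Fin (m α)) (Fin (m α)) ℂ. -/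
open Matrix Kronecker

theorem Submodule.exists_matrix_orthonormal_columns {n : Type*} [Fintype n] [DecidableEq n]
    (W : Submodule ℂ (n → ℂ)) :
    ∃ (d : ℕ) (V : Matrix n (Fin d) ℂ), Vᴴ * V = 1 ∧ ∀ v, v ∈ W ↔ (V * Vᴴ) *ᵥ v = v := by
  let W' : Submodule ℂ (EuclideanSpace ℂ n) :=
    W.comap (WithLp.linearEquiv 2 ℂ (n → ℂ)).toLinearMap
  let b := stdOrthonormalBasis ℂ W'
  let V : Matrix n (Fin (Module.finrank ℂ W')) ℂ :=
    Matrix.of fun i j => (b j : EuclideanSpace ℂ n) i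
  have hV : ∀ y, V *ᵥ y ∈ W := by
    intro y
    have : V *ᵥ y = ∑ j, y j • (WithLp.ofLp (b j : EuclideanSpace ℂ n)) := by
      ext i
      simp [V, Matrix.mulVec, dotProduct, mul_comm]
    rw [this]
    exact W.sum_mem fun j _ => W.smul_mem _ (b j).2
  refine ⟨_, V, ?_, fun v => ⟨fun hv => ?_, fun hv => ?_⟩⟩
  · ext i j
    have := orthonormal_iff_ite.mp b.orthonormal i j
    rw [Submodule.coe_inner, EuclideanSpace.inner_eq_star_dotProduct] at this
    rw [Matrix.one_apply, ← this, dotProduct_comm]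
    simp [Matrix.mul_apply, V, dotProduct]
  · have := congrArg (fun w : W' => WithLp.ofLp (w : EuclideanSpace ℂ n))
      (b.sum_repr' ⟨WithLp.toLp 2 v, hv⟩)
    simp only at this
    conv_rhs => rw [← this]
    ext i
    rw [← Matrix.mulVec_mulVec]
    simp [Matrix.mulVec, dotProduct, V, PiLp.inner_apply, mul_comm]
  · rw [← hv, ← Matrix.mulVec_mulVec]
    exact hV _

theorem Matrix.commute_of_forall_mulVec_mem {n k : Type*} [Fintype n] [DecidableEq n] [Fintype k]
    [DecidableEq k] {S : Set (Matrix n n ℂ)} (hS : ∀ a ∈ S, aᴴ ∈ S) {V : Matrix n k ℂ}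
    (hV : Vᴴ * V = 1)
    (h : ∀ a ∈ S, ∀ v, (V * Vᴴ) *ᵥ v = v → (V * Vᴴ) *ᵥ (a *ᵥ v) = a *ᵥ v) :
    V * Vᴴ ∈ S.centralizer := by
  have hq : V * Vᴴ * (V * Vᴴ) = V * Vᴴ := by
    rw [Matrix.mul_assoc, ← Matrix.mul_assoc Vᴴ, hV, Matrix.one_mul]
  have key : ∀ a ∈ S, V * Vᴴ * a * (V * Vᴴ) = a * (V * Vᴴ) := by
    intro a ha
    refine Matrix.ext_of_mulVec_single fun i => ?_
    have := h a ha ((V * Vᴴ) *ᵥ Pi.single i 1) (by rw [Matrix.mulVec_mulVec, hq])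
    simpa only [Matrix.mulVec_mulVec, Matrix.mul_assoc] using this
  intro a ha
  have := congrArg conjTranspose (key _ (hS a ha))
  simp only [conjTranspose_mul, conjTranspose_conjTranspose] at this
  exact (key a ha).symm.trans ((Matrix.mul_assoc _ _ _).trans this)

theorem StarSubalgebra.mem_of_mem_centralizer_centralizer {n : Type*} [Fintype n] [DecidableEq n]
    (M : StarSubalgebra ℂ (Matrix n n ℂ)) {x : Matrix n n ℂ}
    (hx : x ∈ (M : Set (Matrix n n ℂ)).centralizer.centralizer) : x ∈ M := by
  let f : Matrix n n ℂ →ₗ[ℂ] (n × n → ℂ) :=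
    { toFun := fun a p => a p.1 p.2
      map_add' := fun _ _ => rfl
      map_smul' := fun _ _ => rfl }
  have hfa : ∀ a i j, f a (i, j) = a i j := fun _ _ _ => rfl
  have hf : ∀ a y, (a ⊗ₖ (1 : Matrix n n ℂ)) *ᵥ f y = f (a * y) := by
    intro a y
    ext ⟨i, j⟩
    simp [hfa, Matrix.mulVec, dotProduct, Matrix.mul_apply, Fintype.sum_prod_type, Matrix.one_apply]
  have hinj : ∀ a y, f a = f y → a = y := fun a y h => by
    ext i j
    exact congrFun h (i, j)
  obtain ⟨d, V, hV, hW⟩ := ((M.toSubalgebra.toSubmodule).map f).exists_matrix_orthonormal_columns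
  have hc := Matrix.commute_of_forall_mulVec_mem
    (S := (fun a => a ⊗ₖ (1 : Matrix n n ℂ)) '' (M : Set (Matrix n n ℂ))) (V := V)
    (by
      rintro _ ⟨a, ha, rfl⟩
      exact ⟨aᴴ, star_mem (s := M) ha, by simp [conjTranspose_kronecker]⟩) hV
    (by
      rintro _ ⟨a, ha, rfl⟩ v hv
      rw [← hW] at hv ⊢
      obtain ⟨y, hy, rfl⟩ := hv
      exact ⟨a * y, mul_mem (S := StarSubalgebra ℂ (Matrix n n ℂ)) ha hy, (hf a y).symm⟩)
  generalize V * Vᴴ = q at hc hW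
  have hblock : ∀ j k, (Matrix.of fun i i' => q (i, j) (i', k)) ∈
      (M : Set (Matrix n n ℂ)).centralizer := by
    intro j k a ha
    ext i i'
    have := congrFun (congrFun (hc _ ⟨a, ha, rfl⟩) (i, j)) (i', k)
    simpa [Matrix.mul_apply, Fintype.sum_prod_type, Matrix.one_apply] using this
  have hqx : q * (x ⊗ₖ (1 : Matrix n n ℂ)) = (x ⊗ₖ (1 : Matrix n n ℂ)) * q := by
    ext ⟨i, j⟩ ⟨i', k⟩
    have := congrFun (congrFun (hx _ (hblock j k)) i) i'
    simpa [Matrix.mul_apply, Fintype.sum_prod_type, Matrix.one_apply] using this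
  have h1 : q *ᵥ f 1 = f 1 := (hW _).1 ⟨1, one_mem M, rfl⟩
  have h2 : q *ᵥ f x = f x := by
    have := hf x 1
    rw [mul_one] at this
    rw [← this, Matrix.mulVec_mulVec, hqx, ← Matrix.mulVec_mulVec, h1]
  obtain ⟨a, ha, hax⟩ := (hW _).2 h2
  rwa [← hinj a x hax]

/-- A nonzero orthogonal projection of `C` whose corner `q C q` consists of scalar multiples
of `q`. -/
structure IsMinimalProjection {n : Type*} [Fintype n] [DecidableEq n]
    (C : StarSubalgebra ℂ (Matrix n n ℂ)) (q : Matrix n n ℂ) : Prop where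
  mem : q ∈ C
  conjTranspose_eq : qᴴ = q
  mul_self : q * q = q
  ne_zero : q ≠ 0
  exists_smul : ∀ c ∈ C, ∃ z : ℂ, q * c * q = z • q
  exists_isometry : ∃ (d : ℕ) (V : Matrix n (Fin d) ℂ), Vᴴ * V = 1 ∧ V * Vᴴ = q

theorem exists_isMinimalProjection_mul_eq {n : Type*} [Fintype n] [DecidableEq n]
    {M C : StarSubalgebra ℂ (Matrix n n ℂ)}
    (hC : (C : Set (Matrix n n ℂ)) = (M : Set (Matrix n n ℂ)).centralizer)
    {p : Matrix n n ℂ} (hp : p ∈ C) (hpp : p * p = p) (hp0 : p ≠ 0) :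
    ∃ q, IsMinimalProjection C q ∧ p * q = q := by
  have comm : ∀ c ∈ C, ∀ a ∈ M, a * c = c * a := by
    intro c hc
    have : c ∈ (C : Set (Matrix n n ℂ)) := hc
    rw [hC] at this
    exact this
  obtain ⟨W, ⟨hW0, hWinv, hWp⟩, hmin⟩ := (wellFounded_lt (α := Submodule ℂ (n → ℂ))).has_min
    {W | W ≠ ⊥ ∧ (∀ a ∈ M, ∀ v ∈ W, a *ᵥ v ∈ W) ∧ ∀ v ∈ W, p *ᵥ v = v}
    ⟨LinearMap.range p.mulVecLin, by
      refine ⟨fun h => hp0 ?_, ?_, ?_⟩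
      · rw [LinearMap.range_eq_bot] at h
        refine Matrix.ext_of_mulVec_single fun i => ?_
        rw [Matrix.zero_mulVec]
        exact LinearMap.congr_fun h (Pi.single i 1)
      · rintro a ha _ ⟨v, rfl⟩
        exact ⟨a *ᵥ v, by simp [comm p hp a ha]⟩
      · rintro _ ⟨v, rfl⟩
        simp [hpp]⟩
  obtain ⟨d, V, hV, hWV⟩ := W.exists_matrix_orthonormal_columns
  have hVq : V * Vᴴ * V = V := by rw [Matrix.mul_assoc, hV, Matrix.mul_one]
  have hVW : ∀ y, V *ᵥ y ∈ W := fun y => (hWV _).2 (by rw [Matrix.mulVec_mulVec, hVq])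
  have hqC : V * Vᴴ ∈ C := by
    change V * Vᴴ ∈ (C : Set (Matrix n n ℂ))
    rw [hC]
    refine Matrix.commute_of_forall_mulVec_mem (fun a ha => star_mem (s := M) ha) hV ?_
    intro a ha v hv
    rw [← hWV] at hv ⊢
    exact hWinv a ha v hv
  have hpV : p * V = V := by
    refine Matrix.ext_of_mulVec_single fun i => ?_
    rw [← Matrix.mulVec_mulVec]
    exact hWp _ (hVW _)
  have hd : Nonempty (Fin d) := by
    by_contra hd
    rw [not_nonempty_iff] at hd
    refine hW0 ((Submodule.eq_bot_iff _).2 fun v hv => ?_)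
    rw [← (hWV v).1 hv, ← Matrix.mulVec_mulVec]
    ext i
    simp [Matrix.mulVec, dotProduct]
  refine ⟨V * Vᴴ, ⟨hqC, by simp, ?_, ?_, ?_, d, V, hV, rfl⟩, ?_⟩
  · rw [← Matrix.mul_assoc, hVq]
  · intro h
    rw [h, Matrix.zero_mul] at hVq
    rw [← hVq, Matrix.mul_zero] at hV
    exact zero_ne_one hV
  · intro c hc
    obtain ⟨z, hz⟩ := Module.End.exists_eigenvalue (Matrix.toLin' (Vᴴ * c * V))
    obtain ⟨y, hy⟩ := hz.exists_hasEigenvector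
    have hyz : (Vᴴ * c * V) *ᵥ y = z • y := hy.apply_eq_smul
    let E : Submodule ℂ (n → ℂ) := W ⊓ LinearMap.eqLocus (V * Vᴴ * c).mulVecLin (z • LinearMap.id)
    have hE : ∀ v, v ∈ E ↔ v ∈ W ∧ (V * Vᴴ * c) *ᵥ v = z • v := fun v => Iff.rfl
    have hEW : E = W := by
      refine eq_of_le_of_not_lt inf_le_left (hmin E ⟨fun h => ?_, ?_, fun v hv => hWp v hv.1⟩)
      · have : V *ᵥ y ∈ E := by
          refine (hE _).2 ⟨hVW y, ?_⟩
          rw [← Matrix.mulVec_smul, ← hyz]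
          simp only [Matrix.mulVec_mulVec, Matrix.mul_assoc]
        rw [h, Submodule.mem_bot] at this
        apply hy.2
        rw [← Matrix.one_mulVec y, ← hV, ← Matrix.mulVec_mulVec, this, Matrix.mulVec_zero]
      · intro a ha v hv
        rw [hE] at hv ⊢
        refine ⟨hWinv a ha v hv.1, ?_⟩
        rw [Matrix.mulVec_mulVec, ← comm _ (mul_mem hqC hc) a ha, ← Matrix.mulVec_mulVec, hv.2,
          Matrix.mulVec_smul]
    refine ⟨z, Matrix.ext_of_mulVec_single fun i => ?_⟩
    have := ((hE _).1 (hEW.symm ▸ hVW (Vᴴ *ᵥ Pi.single i 1))).2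
    rw [Matrix.smul_mulVec, ← Matrix.mulVec_mulVec, ← Matrix.mulVec_mulVec _ V]
    exact this
  · rw [← Matrix.mul_assoc, hpV]

theorem exists_finset_isMinimalProjection_sum_eq {n : Type*} [Fintype n] [DecidableEq n]
    {M C : StarSubalgebra ℂ (Matrix n n ℂ)}
    (hC : (C : Set (Matrix n n ℂ)) = (M : Set (Matrix n n ℂ)).centralizer)
    (p : Matrix n n ℂ) (hp : p ∈ C) (hpp : p * p = p) (hph : pᴴ = p) :
    ∃ s : Finset (Matrix n n ℂ), (∀ q ∈ s, IsMinimalProjection C q) ∧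
      (∀ q ∈ s, ∀ q' ∈ s, q ≠ q' → q * q' = 0) ∧ ∑ q ∈ s, q = p := by
  classical
  induction h : LinearMap.range p.mulVecLin using WellFoundedLT.induction generalizing p with
  | ind R ih =>
    subst h
    by_cases hp0 : p = 0
    · exact ⟨∅, by simp, by simp, by simp [hp0]⟩
    obtain ⟨q, hq, hpq⟩ := exists_isMinimalProjection_mul_eq hC hp hpp hp0
    have hqp : q * p = q := by
      have := congrArg conjTranspose hpq
      rwa [conjTranspose_mul, hq.conjTranspose_eq, hph] at this
    have hpq' : (p - q) * q = 0 := by rw [sub_mul, hpq, hq.mul_self, sub_self]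
    have hlt : LinearMap.range (p - q).mulVecLin < LinearMap.range p.mulVecLin := by
      have hpp' : p * (p - q) = p - q := by rw [mul_sub, hpp, hpq]
      have hqp' : q * (p - q) = 0 := by rw [mul_sub, hqp, hq.mul_self, sub_self]
      refine lt_of_le_of_ne ?_ fun h => hq.ne_zero ?_
      · rintro _ ⟨v, rfl⟩
        exact ⟨(p - q) *ᵥ v, by simp only [Matrix.mulVecLin_apply, Matrix.mulVec_mulVec, hpp']⟩
      · refine Matrix.ext_of_mulVec_single fun i => ?_
        have hmem : q *ᵥ Pi.single i 1 ∈ LinearMap.range p.mulVecLin :=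
          ⟨q *ᵥ Pi.single i 1, by simp only [Matrix.mulVecLin_apply, Matrix.mulVec_mulVec, hpq]⟩
        rw [← h] at hmem
        obtain ⟨v, hv⟩ := hmem
        rw [Matrix.mulVecLin_apply] at hv
        rw [← hq.mul_self, ← Matrix.mulVec_mulVec, ← hv, Matrix.mulVec_mulVec, hqp',
          Matrix.zero_mulVec, Matrix.zero_mulVec]
    obtain ⟨s, hs, horth, hsum⟩ := ih _ hlt (p - q) (sub_mem hp hq.mem)
      (by rw [mul_sub, hpq', sub_zero, sub_mul, hpp, hqp])
      (by rw [conjTranspose_sub, hph, hq.conjTranspose_eq]) rfl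
    have h1 : ∀ q' ∈ s, q' * q = 0 := by
      intro q' hq'
      have : q' * (p - q) = q' := by
        rw [← hsum, Finset.mul_sum, Finset.sum_eq_single_of_mem q' hq', (hs q' hq').mul_self]
        exact fun b hb hne => horth q' hq' b hb hne.symm
      rw [← this, Matrix.mul_assoc, hpq', Matrix.mul_zero]
    have h2 : ∀ q' ∈ s, q * q' = 0 := by
      intro q' hq'
      have := congrArg conjTranspose (h1 q' hq')
      rwa [conjTranspose_mul, hq.conjTranspose_eq, (hs q' hq').conjTranspose_eq,
        conjTranspose_zero] at this
    have hqs : q ∉ s := fun h => hq.ne_zero (by rw [← hq.mul_self, h1 q h])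
    refine ⟨insert q s, ?_, ?_, by rw [Finset.sum_insert hqs, hsum, add_sub_cancel]⟩
    · simpa [hq] using hs
    · intro a ha b hb hab
      rcases Finset.mem_insert.1 ha with rfl | ha' <;> rcases Finset.mem_insert.1 hb with rfl | hb'
      · exact absurd rfl hab
      · exact h2 b hb'
      · exact h1 a ha'
      · exact horth a ha' b hb' hab

open scoped ComplexOrder in
theorem IsMinimalProjection.exists_partialIsometry {n : Type*} [Fintype n] [DecidableEq n]
    {C : StarSubalgebra ℂ (Matrix n n ℂ)} {p q c : Matrix n n ℂ} (hp : IsMinimalProjection C p)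
    (hq : IsMinimalProjection C q) (hc : c ∈ C) (h : p * c * q ≠ 0) :
    ∃ u ∈ C, uᴴ * u = q ∧ u * uᴴ = p := by
  have hcH : cᴴ ∈ C := star_mem (s := C) hc
  obtain ⟨z, hz⟩ := hq.exists_smul _ (mul_mem (mul_mem hcH hp.mem) hc)
  obtain ⟨w, hw⟩ := hp.exists_smul _ (mul_mem (mul_mem hc hq.mem) hcH)
  set t := p * c * q with ht
  have htC : t ∈ C := mul_mem (mul_mem hp.mem hc) hq.mem
  have htz : tᴴ * t = z • q := by
    rw [← hz, ht]
    simp only [conjTranspose_mul, hp.conjTranspose_eq, hq.conjTranspose_eq]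
    calc q * (cᴴ * p) * (p * c * q) = q * (cᴴ * (p * p) * c) * q := by noncomm_ring
      _ = _ := by rw [hp.mul_self]
  have htw : t * tᴴ = w • p := by
    rw [← hw, ht]
    simp only [conjTranspose_mul, hp.conjTranspose_eq, hq.conjTranspose_eq]
    calc p * c * q * (q * (cᴴ * p)) = p * (c * (q * q) * cᴴ) * p := by noncomm_ring
      _ = _ := by rw [hq.mul_self]
  have hpos : ∀ a : Matrix n n ℂ, a ≠ 0 → 0 < (aᴴ * a).trace := by
    intro a ha
    refine lt_of_le_of_ne (posSemidef_conjTranspose_mul_self a).trace_nonneg fun h0 => ha ?_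
    exact trace_conjTranspose_mul_self_eq_zero_iff.1 h0.symm
  have hz0 : 0 < z := by
    have h1 := hpos t h
    have h2 := hpos q hq.ne_zero
    rw [hq.conjTranspose_eq, hq.mul_self] at h2
    rw [htz, trace_smul, smul_eq_mul] at h1
    exact pos_of_mul_pos_left h1 h2.le
  have hwz : w = z := by
    have htq : t * q = t := by rw [ht, Matrix.mul_assoc, hq.mul_self]
    have hpt : p * t = t := by rw [ht, ← Matrix.mul_assoc, ← Matrix.mul_assoc, hp.mul_self]
    have h1 : z • t = w • t := by
      calc z • t = t * (z • q) := by rw [Matrix.mul_smul, htq]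
        _ = (w • p) * t := by rw [← htz, ← htw, ← Matrix.mul_assoc]
        _ = w • t := by rw [Matrix.smul_mul, hpt]
    exact (smul_left_injective ℂ h h1).symm
  subst hwz
  obtain ⟨hre, him⟩ := Complex.pos_iff.1 hz0
  obtain ⟨r, rfl⟩ : ∃ r : ℝ, w = r := ⟨w.re, Complex.ext rfl (by simp [him])⟩
  rw [Complex.ofReal_re] at hre
  have hs : (((√r)⁻¹ : ℝ) : ℂ) * (((√r)⁻¹ : ℝ) : ℂ) * r = 1 := by
    rw [← Complex.ofReal_mul, ← Complex.ofReal_mul, ← mul_inv, Real.mul_self_sqrt hre.le,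
      inv_mul_cancel₀ hre.ne', Complex.ofReal_one]
  refine ⟨(((√r)⁻¹ : ℝ) : ℂ) • t, C.smul_mem htC _, ?_, ?_⟩
  · rw [conjTranspose_smul, Matrix.smul_mul, Matrix.mul_smul, htz, smul_smul, smul_smul,
      Complex.star_def, Complex.conj_ofReal, hs, one_smul]
  · rw [conjTranspose_smul, Matrix.smul_mul, Matrix.mul_smul, htw, smul_smul, smul_smul,
      Complex.star_def, Complex.conj_ofReal, hs, one_smul]

open scoped ComplexOrder in
theorem Matrix.mul_eq_self_of_conjTranspose_mul_self_eq {n : Type*} [Fintype n]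
    {u q : Matrix n n ℂ} (hu : uᴴ * u = q) (hq : q * q = q) : u * q = u := by
  have hqh : qᴴ = q := by rw [← hu, conjTranspose_mul, conjTranspose_conjTranspose]
  rw [← sub_eq_zero, ← conjTranspose_mul_self_eq_zero]
  calc (u * q - u)ᴴ * (u * q - u)
      = q * (uᴴ * u) * q - q * (uᴴ * u) - (uᴴ * u) * q + uᴴ * u := by
        rw [conjTranspose_sub, conjTranspose_mul, hqh]
        noncomm_ring
    _ = 0 := by simp [hu, hq]

/-- The matrix units of a finite-dimensional von Neumann algebra: partial isometries `c α j` in the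
commutant `C`, with a common source projection `V α * (V α)ᴴ` for each `α`, whose ranges decompose
the space into irreducible subspaces. -/
theorem exists_isometries_partialIsometries {n : Type*} [Fintype n] [DecidableEq n]
    {M C : StarSubalgebra ℂ (Matrix n n ℂ)}
    (hC : (C : Set (Matrix n n ℂ)) = (M : Set (Matrix n n ℂ)).centralizer) :
    ∃ (N : ℕ) (d m : Fin N → ℕ) (V : ∀ α, Matrix n (Fin (d α)) ℂ)
      (c : ∀ α, Fin (m α) → Matrix n n ℂ),
      (∀ α j, c α j ∈ C) ∧ (∀ α, (V α)ᴴ * V α = 1) ∧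
      (∀ α j j', (c α j)ᴴ * c α j' = if j = j' then V α * (V α)ᴴ else 0) ∧
      (∑ α, ∑ j, c α j * (c α j)ᴴ = 1) ∧
      (∀ x ∈ C, ∀ α j j', ∃ z : ℂ, (c α j)ᴴ * x * c α j' = z • (V α * (V α)ᴴ)) ∧
      (∀ x ∈ C, ∀ α β j j', α ≠ β → (c α j)ᴴ * x * c β j' = 0) := by
  classical
  obtain ⟨s, hs, horth, hsum⟩ := exists_finset_isMinimalProjection_sum_eq hC 1 (one_mem C)
    (one_mul 1) conjTranspose_one
  let S : Setoid s :=
    { r := fun k l => ∃ u ∈ C, uᴴ * u = l.1 ∧ u * uᴴ = k.1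
      iseqv :=
        { refl := fun k => ⟨k, (hs k k.2).mem, by
            rw [(hs k k.2).conjTranspose_eq, (hs k k.2).mul_self], by
            rw [(hs k k.2).conjTranspose_eq, (hs k k.2).mul_self]⟩
          symm := by
            rintro k l ⟨u, hu, h1, h2⟩
            exact ⟨uᴴ, star_mem (s := C) hu, by rwa [conjTranspose_conjTranspose],
              by rwa [conjTranspose_conjTranspose]⟩
          trans := by
            rintro k l m ⟨u, hu, h1, h2⟩ ⟨v, hv, h3, h4⟩
            refine ⟨u * v, mul_mem hu hv, ?_, ?_⟩
            · rw [conjTranspose_mul, Matrix.mul_assoc, ← Matrix.mul_assoc uᴴ, h1, ← h4,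
                Matrix.mul_assoc, h3, ← Matrix.mul_assoc, h3, (hs m m.2).mul_self]
            · rw [conjTranspose_mul, Matrix.mul_assoc, ← Matrix.mul_assoc v, h4,
                ← Matrix.mul_assoc,
                mul_eq_self_of_conjTranspose_mul_self_eq h1 (hs l l.2).mul_self, h2] } }
  let f : Fin (Fintype.card (Quotient S)) ≃ Quotient S := (Fintype.equivFin _).symm
  let r : Fin (Fintype.card (Quotient S)) → s := fun α => (f α).out
  let F : Fin (Fintype.card (Quotient S)) → Type _ := fun α => {k : s // f.symm ⟦k⟧ = α}
  let g : ∀ α, Fin (Fintype.card (F α)) ≃ F α := fun α => (Fintype.equivFin _).symm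
  have hgr : ∀ α j, ∃ u ∈ C, uᴴ * u = (r α).1 ∧ u * uᴴ = (g α j).1.1 := fun α j => by
    have h : (⟦(g α j).1⟧ : Quotient S) = ⟦r α⟧ := by
      rw [Quotient.out_eq]
      exact (f.symm_apply_eq).1 (g α j).2
    exact Quotient.exact h
  choose c hcC hcr hcg using hgr
  choose d V hV hVr using fun α => (hs (r α) (r α).2).exists_isometry
  have hr := fun α => hs (r α) (r α).2
  have hcr' : ∀ α j, c α j * (r α).1 = c α j := fun α j =>
    mul_eq_self_of_conjTranspose_mul_self_eq (hcr α j) (hr α).mul_self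
  have hrc : ∀ α j, (r α).1 * (c α j)ᴴ = (c α j)ᴴ := fun α j => by
    have := congrArg conjTranspose (hcr' α j)
    rwa [conjTranspose_mul, (hr α).conjTranspose_eq] at this
  have hgc : ∀ α j, (g α j).1.1 * c α j = c α j := fun α j => by
    rw [← hcg, Matrix.mul_assoc, hcr, hcr']
  have hcg' : ∀ α j, (c α j)ᴴ * (g α j).1.1 = (c α j)ᴴ := fun α j => by
    rw [← hcg, ← Matrix.mul_assoc, hcr, hrc]
  refine ⟨_, d, _, V, c, hcC, hV, ?_, ?_, ?_, ?_⟩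
  · intro α j j'
    split_ifs with h
    · rw [← h, hcr, hVr]
    · rw [← hcg', ← hgc α j', Matrix.mul_assoc, ← Matrix.mul_assoc (g α j).1.1,
        horth _ (g α j).1.2 _ (g α j').1.2, Matrix.zero_mul, Matrix.mul_zero]
      exact fun h' => h ((g α).injective (Subtype.ext (Subtype.ext h')))
  · simp_rw [hcg]
    rw [← hsum, ← Finset.sum_coe_sort s]
    rw [← (Equiv.sigmaFiberEquiv fun k : s => f.symm ⟦k⟧).sum_comp, Fintype.sum_sigma]
    exact Finset.sum_congr rfl fun α _ => (g α).sum_comp fun k => k.1.1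
  · intro x hx α j j'
    have hcH : (c α j)ᴴ ∈ C := star_mem (s := C) (hcC α j)
    obtain ⟨z, hz⟩ := (hr α).exists_smul _ (mul_mem (mul_mem hcH hx) (hcC α j'))
    refine ⟨z, ?_⟩
    rw [hVr, ← hz, Matrix.mul_assoc _ _ (r α).1, Matrix.mul_assoc _ _ (r α).1, hcr',
      ← Matrix.mul_assoc, ← Matrix.mul_assoc, hrc]
  · intro x hx α β j j' hαβ
    have h0 : (g α j).1.1 * x * (g β j').1.1 = 0 := by
      by_contra h
      have h' : (⟦(g α j).1⟧ : Quotient S) = ⟦(g β j').1⟧ :=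
        Quotient.sound ((hs _ (g α j).1.2).exists_partialIsometry (hs _ (g β j').1.2) hx h)
      apply hαβ
      rw [← (g α j).2, ← (g β j').2, h']
    calc (c α j)ᴴ * x * c β j'
        = (c α j)ᴴ * ((g α j).1.1 * x * (g β j').1.1) * c β j' := by
          conv_lhs => rw [← hcg', ← hgc β j']
          simp only [Matrix.mul_assoc]
      _ = 0 := by rw [h0, Matrix.mul_zero, Matrix.zero_mul]

theorem Matrix.mul_reindex_mul_conjTranspose {n k : Type*} [Fintype n] [Fintype k]
    (e : n ≃ k) (W : Matrix n k ℂ) (B : Matrix k k ℂ) :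
    W.submatrix id e * Matrix.reindex e.symm e.symm B * (W.submatrix id e)ᴴ = W * B * Wᴴ := by
  rw [reindex_apply, Equiv.symm_symm, conjTranspose_submatrix, submatrix_mul_equiv,
    submatrix_mul_equiv, submatrix_id_id]

/-- **Classification of von Neumann algebras on a finite-dimensional Hilbert space**: if
`M` is a von Neumann algebra on `ℂ^n` (a star-subalgebra of `Matrix n n ℂ`), then there
are `N : ℕ`, block dimensions `d m : Fin N → ℕ`, an identification
`e : n ≃ Σ α, Fin (d α) × Fin (m α)` and a unitary `U` such that `M` consists exactly of
the matrices `U * blockDiag(α ↦ x α ⊗ₖ 1) * Uᴴ` with `x α : Matrix (Fin (d α)) (Fin (d α)) ℂ`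
arbitrary, and the commutant of `M` consists exactly of the matrices
`U * blockDiag(α ↦ 1 ⊗ₖ y α) * Uᴴ` with `y α : Matrix (Fin (m α)) (Fin (m α)) ℂ`
arbitrary (block-diagonal matrices reindexed along `e`). -/
theorem vonNeumann_classification {n : Type*} [Fintype n] [DecidableEq n] [Nonempty n]
    (M : StarSubalgebra ℂ (Matrix n n ℂ)) :
    ∃ (N : ℕ) (d m : Fin N → ℕ) (e : n ≃ Σ α : Fin N, Fin (d α) × Fin (m α))
      (U : Matrix n n ℂ),
      Uᴴ * U = 1 ∧
      (M : Set (Matrix n n ℂ)) =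
        {y | ∃ x : ∀ α : Fin N, Matrix (Fin (d α)) (Fin (d α)) ℂ,
          y = U * (Matrix.reindex e.symm e.symm
                (Matrix.blockDiagonal'
                  (fun α => x α ⊗ₖ (1 : Matrix (Fin (m α)) (Fin (m α)) ℂ)))) * Uᴴ} ∧
      Set.centralizer (M : Set (Matrix n n ℂ)) =
        {y | ∃ z : ∀ α : Fin N, Matrix (Fin (m α)) (Fin (m α)) ℂ,
          y = U * (Matrix.reindex e.symm e.symm
                (Matrix.blockDiagonal'
                  (fun α => (1 : Matrix (Fin (d α)) (Fin (d α)) ℂ) ⊗ₖ z α))) * Uᴴ} := by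
  let C := StarSubalgebra.centralizer ℂ (M : Set (Matrix n n ℂ))
  have hC : (C : Set (Matrix n n ℂ)) = (M : Set (Matrix n n ℂ)).centralizer := by
    have : star (M : Set (Matrix n n ℂ)) = M := by
      ext x
      exact star_mem_iff (s := M)
    rw [StarSubalgebra.coe_centralizer, this, Set.union_self]
  obtain ⟨N, d, m, V, c, hcC, hV, hcc, hsum, hsame, hdiff⟩ :=
    exists_isometries_partialIsometries hC
  let W : Matrix n (Σ α : Fin N, Fin (d α) × Fin (m α)) ℂ :=
    Matrix.of fun i p => (c p.1 p.2.2 * V p.1) i p.2.1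
  have hentry : ∀ (x : Matrix n n ℂ) p q, (Wᴴ * x * W) p q =
      ((V p.1)ᴴ * ((c p.1 p.2.2)ᴴ * x * c q.1 q.2.2) * V q.1) p.2.1 q.2.1 := by
    intro x p q
    have : ((V p.1)ᴴ * ((c p.1 p.2.2)ᴴ * x * c q.1 q.2.2) * V q.1) =
        (c p.1 p.2.2 * V p.1)ᴴ * x * (c q.1 q.2.2 * V q.1) := by
      rw [conjTranspose_mul]
      simp only [Matrix.mul_assoc]
    rw [this]
    simp only [Matrix.mul_apply, W, conjTranspose_apply, Matrix.of_apply]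
  have hVV : ∀ α (A : Matrix n n ℂ), (V α)ᴴ * (V α * (V α)ᴴ * A) * V α = (V α)ᴴ * A * V α := by
    intro α A
    rw [← Matrix.mul_assoc (V α)ᴴ (V α * (V α)ᴴ), ← Matrix.mul_assoc (V α)ᴴ (V α), hV,
      Matrix.one_mul]
  have hcr : ∀ α j, c α j * (V α * (V α)ᴴ) = c α j := fun α j =>
    mul_eq_self_of_conjTranspose_mul_self_eq (by rw [hcc, if_pos rfl])
      (by rw [Matrix.mul_assoc, ← Matrix.mul_assoc (V α)ᴴ, hV, Matrix.one_mul])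
  have hcomm : ∀ α j, ∀ a ∈ M, a * c α j = c α j * a := by
    intro α j
    have : c α j ∈ (C : Set (Matrix n n ℂ)) := hcC α j
    rw [hC] at this
    exact this
  have hM : ∀ a ∈ M, Wᴴ * a * W = blockDiagonal' fun α =>
      ((V α)ᴴ * a * V α) ⊗ₖ (1 : Matrix (Fin (m α)) (Fin (m α)) ℂ) := by
    intro a ha
    ext ⟨α, i, j⟩ ⟨β, i', j'⟩
    rw [hentry, Matrix.mul_assoc _ a, hcomm β j' a ha, ← Matrix.mul_assoc _ _ a]
    by_cases h : α = β
    · subst h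
      rw [blockDiagonal'_apply_eq, kronecker_apply, hcc]
      dsimp only
      by_cases hj : j = j'
      · subst hj
        rw [if_pos rfl, hVV, Matrix.one_apply_eq, mul_one]
      · rw [if_neg hj, Matrix.zero_mul, Matrix.mul_zero, Matrix.zero_mul, Matrix.one_apply_ne hj,
          mul_zero, Matrix.zero_apply]
    · rw [blockDiagonal'_apply_ne _ _ _ h]
      have := hdiff 1 (one_mem C) α β j j' h
      rw [Matrix.mul_one] at this
      simp only [this, Matrix.zero_mul, Matrix.mul_zero, Matrix.zero_apply]
  have hWW : Wᴴ * W = 1 := by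
    have := hM 1 (one_mem M)
    simp only [Matrix.mul_one, hV, one_kronecker_one] at this
    exact this.trans blockDiagonal'_one
  have hWW' : W * Wᴴ = 1 := by
    rw [← hsum]
    have : ∀ α j, c α j * (c α j)ᴴ = (c α j * V α) * (c α j * V α)ᴴ := by
      intro α j
      conv_lhs => enter [1]; rw [← hcr α j]
      rw [conjTranspose_mul]
      simp only [Matrix.mul_assoc]
    simp_rw [this]
    ext i k
    rw [Matrix.mul_apply, Fintype.sum_sigma, Matrix.sum_apply]
    refine Finset.sum_congr rfl fun α _ => ?_
    rw [Fintype.sum_prod_type_right, Matrix.sum_apply]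
    exact Finset.sum_congr rfl fun j _ => rfl
  have hcard : Fintype.card n = Fintype.card (Σ α : Fin N, Fin (d α) × Fin (m α)) :=
    Matrix.square_of_invertible W Wᴴ hWW' hWW
  let e : n ≃ Σ α : Fin N, Fin (d α) × Fin (m α) := Fintype.equivOfCardEq hcard
  have hback : ∀ (x : Matrix n n ℂ) B, Wᴴ * x * W = B → x = W * B * Wᴴ := by
    rintro x _ rfl
    calc x = (W * Wᴴ) * x * (W * Wᴴ) := by rw [hWW', Matrix.one_mul, Matrix.mul_one]
      _ = _ := by simp only [Matrix.mul_assoc]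
  have hMsub : ∀ a ∈ M, ∃ x : ∀ α : Fin N, Matrix (Fin (d α)) (Fin (d α)) ℂ,
      a = W * (blockDiagonal' fun α => x α ⊗ₖ (1 : Matrix (Fin (m α)) (Fin (m α)) ℂ)) * Wᴴ :=
    fun a ha => ⟨_, hback _ _ (hM a ha)⟩
  have hCsub : ∀ a ∈ C, ∃ z : ∀ α : Fin N, Matrix (Fin (m α)) (Fin (m α)) ℂ,
      a = W * (blockDiagonal' fun α => (1 : Matrix (Fin (d α)) (Fin (d α)) ℂ) ⊗ₖ z α) * Wᴴ := by
    intro a ha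
    choose z hz using hsame a ha
    refine ⟨fun α => Matrix.of (z α), hback _ _ ?_⟩
    ext ⟨α, i, j⟩ ⟨β, i', j'⟩
    rw [hentry]
    by_cases h : α = β
    · subst h
      rw [blockDiagonal'_apply_eq, kroneckerMap_apply, hz, Matrix.mul_smul, Matrix.smul_mul,
        ← Matrix.mul_assoc, hV, Matrix.one_mul, hV, Matrix.smul_apply, smul_eq_mul, mul_comm]
      rfl
    · rw [blockDiagonal'_apply_ne _ _ _ h]
      simp only [hdiff a ha α β j j' h, Matrix.zero_mul, Matrix.mul_zero, Matrix.zero_apply]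
  have hXZ : ∀ (x : ∀ α : Fin N, Matrix (Fin (d α)) (Fin (d α)) ℂ)
      (z : ∀ α : Fin N, Matrix (Fin (m α)) (Fin (m α)) ℂ),
      Commute
        (W * (blockDiagonal' fun α => x α ⊗ₖ (1 : Matrix (Fin (m α)) (Fin (m α)) ℂ)) * Wᴴ)
        (W * (blockDiagonal' fun α => (1 : Matrix (Fin (d α)) (Fin (d α)) ℂ) ⊗ₖ z α) * Wᴴ) := by
    intro x z
    have hmul : ∀ A B : Matrix (Σ α : Fin N, Fin (d α) × Fin (m α))
        (Σ α : Fin N, Fin (d α) × Fin (m α)) ℂ,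
        (W * A * Wᴴ) * (W * B * Wᴴ) = W * (A * B) * Wᴴ := fun A B => by
      calc (W * A * Wᴴ) * (W * B * Wᴴ) = W * A * (Wᴴ * W) * B * Wᴴ := by
            simp only [Matrix.mul_assoc]
        _ = _ := by rw [hWW, Matrix.mul_one, Matrix.mul_assoc W A B]
    rw [commute_iff_eq, hmul, hmul, ← blockDiagonal'_mul, ← blockDiagonal'_mul]
    simp only [← mul_kronecker_mul, Matrix.one_mul, Matrix.mul_one]
  refine ⟨N, d, m, e, W.submatrix id e, ?_, ?_, ?_⟩
  · rw [conjTranspose_submatrix, ← submatrix_mul _ _ _ id _ Function.bijective_id, hWW,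
      submatrix_one_equiv]
  · simp only [Matrix.mul_reindex_mul_conjTranspose]
    ext y
    refine ⟨hMsub y, ?_⟩
    rintro ⟨x, rfl⟩
    refine M.mem_of_mem_centralizer_centralizer fun a ha => ?_
    rw [← hC] at ha
    obtain ⟨z, rfl⟩ := hCsub a ha
    exact (hXZ x z).symm
  · simp only [Matrix.mul_reindex_mul_conjTranspose]
    ext y
    refine ⟨fun hy => hCsub y (by rwa [← hC] at hy), ?_⟩
    rintro ⟨z, rfl⟩ a ha
    obtain ⟨x, rfl⟩ := hMsub a ha
    exact hXZ x z
end

section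
/- Let M be a star-subalgebra of Matrix n n ℂ containing the identity, and let ρ : Matrix n n ℂ be a state, i.e. a positive semidefinite matrix with trace 1. Then there exists a unique matrix ρ_M ∈ M which is positive semidefinite, has trace 1, and satisfies trace (ρ * x) = trace (ρ_M * x) for every x ∈ M. -/
open Matrix ComplexOrder

open scoped MatrixOrder in
theorem Matrix.PosSemidef.trace_mul_nonneg {n : Type*} [Fintype n] [DecidableEq n]
    {A B : Matrix n n ℂ} (hA : A.PosSemidef) (hB : B.PosSemidef) : 0 ≤ (A * B).trace := by
  obtain ⟨C, rfl⟩ := CStarAlgebra.nonneg_iff_eq_star_mul_self.mp hA.nonneg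
  rw [Matrix.mul_assoc, Matrix.trace_mul_comm]
  exact (hB.mul_mul_conjTranspose_same C).trace_nonneg

open scoped MatrixOrder in
/-- The negative part of a Hermitian matrix is a real polynomial in it. -/
theorem Matrix.IsHermitian.exists_polynomial_negPart {n : Type*} [Fintype n] [DecidableEq n]
    {A : Matrix n n ℂ} (hA : A.IsHermitian) :
    ∃ q : Polynomial ℝ, (Polynomial.aeval A q).PosSemidef ∧
      (A + Polynomial.aeval A q).PosSemidef ∧
      A * Polynomial.aeval A q = -(Polynomial.aeval A q * Polynomial.aeval A q) := by
  have hfin : (spectrum ℝ A).Finite := Matrix.finite_real_spectrum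
  let q := Lagrange.interpolate hfin.toFinset id fun x : ℝ ↦ x⁻
  have hq : ∀ x ∈ spectrum ℝ A, q.eval x = x⁻ := fun x hx ↦
    Lagrange.eval_interpolate_at_node (v := id) (fun x : ℝ ↦ x⁻) Function.injective_id.injOn
      (hfin.mem_toFinset.mpr hx)
  have hsa : IsSelfAdjoint A := hA
  have nonneg : ∀ p : Polynomial ℝ, (∀ x ∈ spectrum ℝ A, 0 ≤ p.eval x) →
      (Polynomial.aeval A p).PosSemidef := fun p hp ↦ by
    rw [← cfc_polynomial p A hsa]
    exact (cfc_nonneg hp).posSemidef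
  refine ⟨q, nonneg q fun x hx ↦ ?_, ?_, ?_⟩
  · rw [hq x hx]
    exact negPart_nonneg x
  · have := nonneg (Polynomial.X + q) fun x hx ↦ by
      rw [Polynomial.eval_add, Polynomial.eval_X, hq x hx]
      obtain h | h := le_total 0 x
      · simpa [negPart_of_nonneg h] using h
      · simp [negPart_of_nonpos h]
    simpa using this
  · have : cfc (Polynomial.X * q).eval A = cfc (-(q * q)).eval A := cfc_congr fun x hx ↦ by
      simp only [Polynomial.eval_mul, Polynomial.eval_X, Polynomial.eval_neg, hq x hx]
      obtain h | h := le_total 0 x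
      · simp [negPart_of_nonneg h]
      · simp [negPart_of_nonpos h]
    rw [cfc_polynomial _ A hsa, cfc_polynomial _ A hsa] at this
    simpa using this

theorem StarSubalgebra.posSemidef_of_trace_mul_nonneg {n : Type*} [Fintype n] [DecidableEq n]
    (M : StarSubalgebra ℂ (Matrix n n ℂ)) {A : Matrix n n ℂ} (hAM : A ∈ M) (hA : A.IsHermitian)
    (h : ∀ N ∈ M, N.PosSemidef → 0 ≤ (A * N).trace) : A.PosSemidef := by
  obtain ⟨q, hN, hAN, hmul⟩ := hA.exists_polynomial_negPart
  have hNM : Polynomial.aeval A q ∈ M :=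
    Algebra.adjoin_le (S := M.toSubalgebra.restrictScalars ℝ) (Set.singleton_subset_iff.mpr hAM)
      (Polynomial.aeval_mem_adjoin_singleton ℝ A)
  have h0 := h _ hNM hN
  generalize Polynomial.aeval A q = N at *
  rw [hmul, Matrix.trace_neg, neg_nonneg] at h0
  have h1 := (Matrix.posSemidef_conjTranspose_mul_self N).trace_nonneg
  have h2 : (Nᴴ * N).trace = 0 := le_antisymm (by rwa [hN.isHermitian.eq]) h1
  rwa [Matrix.trace_conjTranspose_mul_self_eq_zero_iff.mp h2, add_zero] at hAN

theorem StarSubalgebra.eq_of_trace_mul_eq {n : Type*} [Fintype n] [DecidableEq n]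
    (M : StarSubalgebra ℂ (Matrix n n ℂ)) {A B : Matrix n n ℂ} (hA : A ∈ M) (hB : B ∈ M)
    (h : ∀ x ∈ M, (A * x).trace = (B * x).trace) : A = B := by
  have := h (A - B)ᴴ (star_mem (sub_mem hA hB))
  rw [← sub_eq_zero, ← Matrix.trace_sub, ← Matrix.sub_mul,
    Matrix.trace_mul_conjTranspose_self_eq_zero_iff] at this
  exact sub_eq_zero.mp this

/-- The trace form represents every functional on a star-subalgebra of matrices by an element
of the subalgebra. -/
theorem StarSubalgebra.exists_trace_mul_eq {n : Type*} [Fintype n] [DecidableEq n]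
    (M : StarSubalgebra ℂ (Matrix n n ℂ)) (f : Module.Dual ℂ M.toSubalgebra) :
    ∃ A ∈ M, ∀ x : M.toSubalgebra, (A * (x : Matrix n n ℂ)).trace = f x := by
  let T : M.toSubalgebra →ₗ[ℂ] Module.Dual ℂ M.toSubalgebra :=
    (LinearMap.mul ℂ M.toSubalgebra).compr₂
      (Matrix.traceLinearMap n ℂ ℂ ∘ₗ M.toSubalgebra.val.toLinearMap)
  have hT : Function.Injective T := fun A B hAB ↦
    Subtype.ext <| M.eq_of_trace_mul_eq A.2 B.2 fun x hx ↦ DFunLike.congr_fun hAB ⟨x, hx⟩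
  obtain ⟨A, hA⟩ := (LinearMap.injective_iff_surjective_of_finrank_eq_finrank
    Subspace.dual_finrank_eq.symm).mp hT f
  exact ⟨A, A.2, fun x ↦ DFunLike.congr_fun hA x⟩

/-- If `M` is a von Neumann algebra on `ℂ^n` (a star-subalgebra of `Matrix n n ℂ`) and
`ρ` is a state (a positive semidefinite matrix of trace `1`), then there is a unique state
`ρ_M ∈ M` giving the same expectation values as `ρ` on all elements of `M`. -/
theorem state_restriction_to_algebra {n : Type*} [Fintype n] [DecidableEq n] [Nonempty n]
    (M : StarSubalgebra ℂ (Matrix n n ℂ)) (ρ : Matrix n n ℂ)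
    (hρ : ρ.PosSemidef) (hρtr : ρ.trace = 1) :
    ∃! ρM : Matrix n n ℂ, ρM ∈ M ∧ ρM.PosSemidef ∧ ρM.trace = 1 ∧
      ∀ x ∈ M, (ρ * x).trace = (ρM * x).trace := by
  obtain ⟨A, hAM, hA⟩ := M.exists_trace_mul_eq
    (Matrix.traceLinearMap n ℂ ℂ ∘ₗ LinearMap.mulLeft ℂ ρ ∘ₗ M.toSubalgebra.val.toLinearMap)
  replace hA : ∀ x ∈ M, (A * x).trace = (ρ * x).trace := fun x hx ↦ hA ⟨x, hx⟩
  have hherm : A.IsHermitian := M.eq_of_trace_mul_eq (star_mem hAM) hAM fun x hx ↦ by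
    have hx' : (A * xᴴ).trace = (ρ * xᴴ).trace := hA _ (star_mem hx)
    have := congrArg star hx'
    rw [← Matrix.trace_conjTranspose, ← Matrix.trace_conjTranspose, Matrix.conjTranspose_mul,
      Matrix.conjTranspose_mul, Matrix.conjTranspose_conjTranspose, hρ.isHermitian.eq,
      Matrix.trace_mul_comm x, Matrix.trace_mul_comm x] at this
    rw [hA x hx, ← this]
  refine ⟨A, ⟨hAM, M.posSemidef_of_trace_mul_nonneg hAM hherm fun N hN hN' ↦ ?_, ?_,
    fun x hx ↦ (hA x hx).symm⟩, fun B ⟨hBM, _, _, hB⟩ ↦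
      M.eq_of_trace_mul_eq hBM hAM fun x hx ↦ by rw [hA x hx, hB x hx]⟩
  · rw [hA N hN]
    exact hρ.trace_mul_nonneg hN'
  · simpa [hρtr] using hA 1 (one_mem M)
end

section
/- (Erasure-correction conditions, operator representability ⟺ Knill–Laflamme condition.) The following are equivalent: (2) for every matrix o : Matrix (Fin k) (Fin k) ℂ there exists O_A : Matrix A A ℂ such that for every i, (O_A ⊗ₖ 1).mulVec (v i) = Σ_j (o j i) • v j and (O_A ⊗ₖ 1)ᴴ.mulVec (v i) = Σ_j (conj (o i j)) • v j (every logical operator on the code subspace is represented by an operator supported on A acting correctly, together with its adjoint, on the code subspace); (3) for every X : Matrix Ā Ā ℂ there exists c : ℂ such that P * (1 ⊗ₖ X) * P = c • P. -/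
open Matrix Kronecker

/-- The projection onto the code subspace spanned by the family `v`:
`P z z' = Σ_i v i z * conj (v i z')`. -/
noncomputable def codeProj {A B : Type*} [Fintype A] [Fintype B] {k : ℕ}
    (v : Fin k → A × B → ℂ) : Matrix (A × B) (A × B) ℂ :=
  Matrix.of fun z z' => ∑ i, v i z * (starRingEnd ℂ) (v i z')

/-- The `A × B` matrix of coefficients of a vector of `ℂ^(A × B)`. -/
def coeffMatrix {A B : Type*} (u : A × B → ℂ) : Matrix A B ℂ :=
  Matrix.of fun a b => u (a, b)

lemma coeffMatrix_injective {A B : Type*} :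
    Function.Injective (coeffMatrix : (A × B → ℂ) → Matrix A B ℂ) := by
  intro u w h
  ext ⟨a, b⟩
  exact congrFun (congrFun h a) b

lemma coeffMatrix_sum_smul {A B ι : Type*} [Fintype ι] (c : ι → ℂ) (u : ι → A × B → ℂ) :
    coeffMatrix (∑ j, c j • u j) = ∑ j, c j • coeffMatrix (u j) := by
  ext a b
  simp [coeffMatrix, Matrix.sum_apply, Finset.sum_apply]

lemma coeffMatrix_kronecker_one_mulVec {A B : Type*} [Fintype A] [Fintype B] [DecidableEq B]
    (O : Matrix A A ℂ) (u : A × B → ℂ) :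
    coeffMatrix ((O ⊗ₖ (1 : Matrix B B ℂ)).mulVec u) = O * coeffMatrix u := by
  ext a b
  simp [coeffMatrix, Matrix.mulVec, dotProduct, Fintype.sum_prod_type, Matrix.mul_apply,
    Matrix.one_apply]

lemma kronecker_one_mulVec_eq_iff {A B ι : Type*} [Fintype A] [Fintype B] [DecidableEq B]
    [Fintype ι] (O : Matrix A A ℂ) (u : A × B → ℂ) (c : ι → ℂ) (w : ι → A × B → ℂ) :
    (O ⊗ₖ (1 : Matrix B B ℂ)).mulVec u = ∑ j, c j • w j ↔
      O * coeffMatrix u = ∑ j, c j • coeffMatrix (w j) := by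
  rw [← coeffMatrix_injective.eq_iff, coeffMatrix_kronecker_one_mulVec, coeffMatrix_sum_smul]

/-- A Hermitian matrix has a Hermitian generalized inverse. -/
lemma Matrix.IsHermitian.exists_isHermitian_mul_mul_eq {B : Type*} [Fintype B] [DecidableEq B]
    {M : Matrix B B ℂ} (hM : M.IsHermitian) :
    ∃ R : Matrix B B ℂ, R.IsHermitian ∧ M * R * M = M := by
  set U : Matrix B B ℂ := (hM.eigenvectorUnitary : Matrix B B ℂ) with hU
  set d : B → ℂ := fun i => (hM.eigenvalues i : ℂ) with hd
  have hUU : star U * U = 1 := Unitary.coe_star_mul_self hM.eigenvectorUnitary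
  have hspec : M = U * diagonal d * star U := by
    have h := hM.spectral_theorem
    rw [Unitary.conjStarAlgAut_apply] at h
    exact h
  refine ⟨U * diagonal (fun i => (d i)⁻¹) * star U, ?_, ?_⟩
  · have hdiag : (diagonal (fun i => (d i)⁻¹))ᴴ = diagonal (fun i => (d i)⁻¹) := by
      rw [diagonal_conjTranspose]
      congr 1
      ext i
      simp [hd]
    simp only [Matrix.IsHermitian, Matrix.star_eq_conjTranspose, conjTranspose_mul,
      conjTranspose_conjTranspose, hdiag, Matrix.mul_assoc]
  · have hdd : diagonal d * diagonal (fun i => (d i)⁻¹) * diagonal d = diagonal d := by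
      simp [diagonal_mul_diagonal, mul_inv_mul_cancel]
    calc M * (U * diagonal (fun i => (d i)⁻¹) * star U) * M
        = U * diagonal d * (star U * U) * diagonal (fun i => (d i)⁻¹) * (star U * U)
            * diagonal d * star U := by
          nth_rw 1 2 [hspec]
          simp only [Matrix.mul_assoc]
      _ = U * (diagonal d * diagonal (fun i => (d i)⁻¹) * diagonal d) * star U := by
          simp only [hUU, Matrix.mul_one, Matrix.mul_assoc]
      _ = M := by rw [hdd, ← hspec]

open scoped ComplexOrder in
/-- A generalized inverse of `Vᴴ * V` acts trivially on `V`. -/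
lemma mul_genInverse_mul_eq {A B : Type*} [Fintype A] [Fintype B]
    {V : Matrix A B ℂ} {M R : Matrix B B ℂ} (hV : Vᴴ * V = M) (hRMR : M * R * M = M) :
    V * R * M = V := by
  rw [← sub_eq_zero, ← Matrix.conjTranspose_mul_self_eq_zero]
  have h : Vᴴ * (V * R * M - V) = 0 := by
    rw [Matrix.mul_sub, ← Matrix.mul_assoc, ← Matrix.mul_assoc, hV, hRMR, sub_self]
  have hM : Mᴴ = M := by rw [← hV]; simp
  rw [conjTranspose_sub, Matrix.sub_mul, h, conjTranspose_mul, conjTranspose_mul,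
    Matrix.mul_assoc, Matrix.mul_assoc, h]
  simp

/-- The Knill–Laflamme condition in terms of the partial inner products of the code basis. -/
lemma knillLaflamme_iff {A B : Type*} [Fintype A] [DecidableEq A] [Fintype B] [DecidableEq B]
    {k : ℕ} (v : Fin k → A × B → ℂ)
    (hv : ∀ i j, (∑ z, (starRingEnd ℂ) (v i z) * v j z) = if i = j then 1 else 0) :
    (∀ X : Matrix B B ℂ, ∃ c : ℂ,
      codeProj v * ((1 : Matrix A A ℂ) ⊗ₖ X) * codeProj v = c • codeProj v) ↔
    ∃ M : Matrix B B ℂ, ∀ i j,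
      (coeffMatrix (v i))ᴴ * coeffMatrix (v j) = if i = j then M else 0 := by
  set W : Matrix (A × B) (Fin k) ℂ := Matrix.of fun z i => v i z with hW
  have hP : codeProj v = W * Wᴴ := by
    ext z z'
    simp [codeProj, hW, Matrix.mul_apply]
  have hWW : Wᴴ * W = 1 := by
    ext i j
    simpa [hW, Matrix.mul_apply, Matrix.one_apply] using hv i j
  have hcompress : ∀ (Y : Matrix (A × B) (A × B) ℂ) (c : ℂ),
      codeProj v * Y * codeProj v = c • codeProj v ↔ Wᴴ * Y * W = c • 1 := by
    intro Y c
    rw [hP]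
    constructor
    · intro h
      calc Wᴴ * Y * W = (Wᴴ * W) * Wᴴ * Y * W * (Wᴴ * W) := by simp [hWW]
        _ = Wᴴ * (W * Wᴴ * Y * (W * Wᴴ)) * W := by simp only [Matrix.mul_assoc]
        _ = c • ((Wᴴ * W) * (Wᴴ * W)) := by
          rw [h]; simp only [Matrix.mul_assoc, Matrix.mul_smul, Matrix.smul_mul]
        _ = c • 1 := by simp [hWW]
    · intro h
      calc W * Wᴴ * Y * (W * Wᴴ) = W * (Wᴴ * Y * W) * Wᴴ := by simp only [Matrix.mul_assoc]
        _ = c • (W * Wᴴ) := by rw [h]; simp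
  have hentry : ∀ (X : Matrix B B ℂ) (i j : Fin k),
      (Wᴴ * ((1 : Matrix A A ℂ) ⊗ₖ X) * W) i j =
        ∑ b, ∑ b', X b b' * ((coeffMatrix (v i))ᴴ * coeffMatrix (v j)) b b' := by
    intro X i j
    have h : ∀ a b', (Wᴴ * ((1 : Matrix A A ℂ) ⊗ₖ X)) i (a, b') =
        ∑ b, (starRingEnd ℂ) (v i (a, b)) * X b b' := by
      intro a b'
      rw [Matrix.mul_apply, Fintype.sum_prod_type, Finset.sum_eq_single a]
      · simp [hW]
      · intro a' _ ha
        simp [Matrix.one_apply_ne ha]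
      · simp
    rw [Matrix.mul_apply, Fintype.sum_prod_type]
    simp only [h, Finset.sum_mul, Matrix.mul_apply, Finset.mul_sum]
    rw [Finset.sum_comm, Finset.sum_comm_cycle]
    refine Finset.sum_congr rfl fun b _ => Finset.sum_congr rfl fun b' _ =>
      Finset.sum_congr rfl fun a _ => ?_
    simp only [hW, coeffMatrix, conjTranspose_apply, of_apply, starRingEnd_apply]
    ring
  simp only [hcompress]
  constructor
  · intro h
    choose c hc using h
    refine ⟨Matrix.of fun b b' => c (Matrix.single b b' 1), fun i j => ?_⟩
    ext b b'
    have h := hentry (Matrix.single b b' 1) i j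
    rw [hc, Finset.sum_eq_single b, Finset.sum_eq_single b'] at h
    · simp only [Matrix.single_apply_same, one_mul] at h
      rw [← h]
      by_cases hij : i = j <;> simp [hij]
    all_goals simp +contextual [Matrix.single_apply, eq_comm]
  · rintro ⟨M, hM⟩ X
    refine ⟨∑ b, ∑ b', X b b' * M b b', ?_⟩
    ext i j
    rw [hentry, hM]
    by_cases hij : i = j <;> simp [hij]

/-- **Erasure-correction conditions (operator representability ⟺ Knill–Laflamme)**:
for a code subspace of `ℂ^(A × Ā)` spanned by an orthonormal family `v : Fin k → ℂ^(A × Ā)`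
with code projection `P`, the following are equivalent:
(2) every logical operator `o` on the code subspace has a representation `O_A` supported on
`A` that, together with its adjoint, acts correctly on the code subspace;
(3) for every operator `X` supported on `Ā`, `P * X * P` is a scalar multiple of `P`. -/
theorem erasure_correction_conditions {A B : Type*}
    [Fintype A] [DecidableEq A] [Nonempty A] [Fintype B] [DecidableEq B] [Nonempty B]
    {k : ℕ} (hk : 0 < k) (v : Fin k → A × B → ℂ)
    (hv : ∀ i j, (∑ z, (starRingEnd ℂ) (v i z) * v j z) = if i = j then 1 else 0) :
    (∀ o : Matrix (Fin k) (Fin k) ℂ, ∃ OA : Matrix A A ℂ,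
      (∀ i, (OA ⊗ₖ (1 : Matrix B B ℂ)).mulVec (v i) = ∑ j, o j i • v j) ∧
      (∀ i, (OA ⊗ₖ (1 : Matrix B B ℂ))ᴴ.mulVec (v i) = ∑ j, (starRingEnd ℂ) (o i j) • v j))
    ↔
    (∀ X : Matrix B B ℂ, ∃ c : ℂ,
      codeProj v * ((1 : Matrix A A ℂ) ⊗ₖ X) * codeProj v = c • codeProj v) := by
  rw [knillLaflamme_iff v hv]
  simp only [conjTranspose_kronecker, conjTranspose_one, kronecker_one_mulVec_eq_iff]
  constructor
  · intro h
    have hcomm : ∀ (o : Matrix (Fin k) (Fin k) ℂ) (i j : Fin k),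
        ∑ l, o l j • ((coeffMatrix (v i))ᴴ * coeffMatrix (v l)) =
          ∑ l, o i l • ((coeffMatrix (v l))ᴴ * coeffMatrix (v j)) := by
      intro o i j
      obtain ⟨O, hO, hO'⟩ := h o
      have hadj := congrArg conjTranspose (hO' i)
      rw [conjTranspose_mul, conjTranspose_conjTranspose] at hadj
      calc ∑ l, o l j • ((coeffMatrix (v i))ᴴ * coeffMatrix (v l))
          = (coeffMatrix (v i))ᴴ * (O * coeffMatrix (v j)) := by
            rw [hO j]; simp [Matrix.mul_sum]
        _ = _ := by
            rw [← Matrix.mul_assoc, hadj]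
            simp [conjTranspose_sum, conjTranspose_smul, Matrix.sum_mul]
    have hsingle : ∀ i j p q : Fin k,
        (if q = j then (coeffMatrix (v i))ᴴ * coeffMatrix (v p) else 0) =
          if p = i then (coeffMatrix (v q))ᴴ * coeffMatrix (v j) else 0 := by
      intro i j p q
      simpa [Matrix.single_apply, ite_and, ite_smul] using hcomm (Matrix.single p q 1) i j
    let z : Fin k := ⟨0, hk⟩
    refine ⟨(coeffMatrix (v z))ᴴ * coeffMatrix (v z), fun i j => ?_⟩
    by_cases hij : i = j
    · subst hij
      simpa using hsingle i z i z
    · simpa [hij, Ne.symm hij] using hsingle i j j j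
  · rintro ⟨M, hM⟩ o
    have hMherm : M.IsHermitian := by
      rw [← if_pos (rfl : (⟨0, hk⟩ : Fin k) = ⟨0, hk⟩) (t := M) (e := 0), ← hM]
      exact isHermitian_conjTranspose_mul_self _
    obtain ⟨R, hR, hMRM⟩ := hMherm.exists_isHermitian_mul_mul_eq
    have hVRM : ∀ j, coeffMatrix (v j) * R * M = coeffMatrix (v j) := fun j =>
      mul_genInverse_mul_eq (by simpa using hM j j) hMRM
    have hrep : ∀ (c : Matrix (Fin k) (Fin k) ℂ) (i : Fin k),
        (∑ m, ∑ l, c l m • (coeffMatrix (v l) * R * (coeffMatrix (v m))ᴴ)) * coeffMatrix (v i) =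
          ∑ l, c l i • coeffMatrix (v l) := by
      intro c i
      simp only [Matrix.sum_mul, Matrix.smul_mul]
      rw [Finset.sum_eq_single i]
      · simp only [Matrix.mul_assoc _ _ (coeffMatrix (v i)), hM, if_true, hVRM]
      · intro m _ hm
        simp [Matrix.mul_assoc _ _ (coeffMatrix (v i)), hM, hm]
      · simp
    refine ⟨∑ m, ∑ l, o l m • (coeffMatrix (v l) * R * (coeffMatrix (v m))ᴴ), hrep o, fun i => ?_⟩
    refine Eq.trans ?_ (hrep oᴴ i)
    rw [Finset.sum_comm]
    simp [conjTranspose_sum, conjTranspose_smul, hR.eq, Matrix.mul_assoc]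
end

section
/- (Knill–Laflamme condition ⟺ decoupling of the reference from the erased system.) Define the purifying state φ : Fin k × A × Ā → ℂ by φ (i, a, b) = (1 / √k) * v i (a, b), and the reduced density matrices ρ_{RĀ} : Matrix (Fin k × Ā) (Fin k × Ā) ℂ by ρ_{RĀ} (i,b) (i',b') = Σ_a φ (i,a,b) * conj (φ (i',a,b')), ρ_R : Matrix (Fin k) (Fin k) ℂ by ρ_R i i' = Σ_{a,b} φ (i,a,b) * conj (φ (i',a,b)), and ρ_Ā : Matrix Ā Ā ℂ by ρ_Ā b b' = Σ_{i,a} φ (i,a,b) * conj (φ (i,a,b')). Then the following are equivalent: (3) for every X : Matrix Ā Ā ℂ there exists c : ℂ with P * (1 ⊗ₖ X) * P = c • P; (4) ρ_{RĀ} (i,b) (i',b') = ρ_R i i' * ρ_Ā b b' for all i, i', b, b' (i.e. ρ_{RĀ} = ρ_R ⊗ ρ_Ā). -/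
open Matrix Kronecker

/-- The purifying state `φ (i, a, b) = (1/√k) * v i (a, b)` on `R × A × Ā`. -/
noncomputable def purifyingState {A B : Type*} {k : ℕ} (v : Fin k → A × B → ℂ) :
    Fin k × A × B → ℂ :=
  fun z => (1 / (Real.sqrt k : ℂ)) * v z.1 (z.2.1, z.2.2)

/-- The reduced density matrix `ρ_{RĀ}` of the purifying state `φ`. -/
noncomputable def rhoRAbar {A B : Type*} [Fintype A] {k : ℕ} (v : Fin k → A × B → ℂ) :
    Matrix (Fin k × B) (Fin k × B) ℂ :=
  Matrix.of fun z z' => ∑ a,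
    purifyingState v (z.1, a, z.2) * (starRingEnd ℂ) (purifyingState v (z'.1, a, z'.2))

/-- The reduced density matrix `ρ_R` of the purifying state `φ`. -/
noncomputable def rhoR {A B : Type*} [Fintype A] [Fintype B] {k : ℕ}
    (v : Fin k → A × B → ℂ) : Matrix (Fin k) (Fin k) ℂ :=
  Matrix.of fun i i' => ∑ a, ∑ b,
    purifyingState v (i, a, b) * (starRingEnd ℂ) (purifyingState v (i', a, b))

/-- The reduced density matrix `ρ_Ā` of the purifying state `φ`. -/
noncomputable def rhoAbar {A B : Type*} [Fintype A] {k : ℕ} [Fintype (Fin k)]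
    (v : Fin k → A × B → ℂ) : Matrix B B ℂ :=
  Matrix.of fun b b' => ∑ i, ∑ a,
    purifyingState v (i, a, b) * (starRingEnd ℂ) (purifyingState v (i, a, b'))

/-- The matrix whose columns are the code vectors. -/
def codeIsometry {A B : Type*} {k : ℕ} (v : Fin k → A × B → ℂ) : Matrix (A × B) (Fin k) ℂ :=
  Matrix.of fun z i => v i z

/-- The overlaps `⟨v i| (1 ⊗ |b⟩⟨b'|) |v j⟩` of the code vectors. -/
noncomputable def codeOverlap {A B : Type*} [Fintype A] {k : ℕ} (v : Fin k → A × B → ℂ)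
    (i j : Fin k) (b b' : B) : ℂ :=
  ∑ a, (starRingEnd ℂ) (v i (a, b)) * v j (a, b')

lemma purifyingState_mul_conj {A B : Type*} {k : ℕ} (v : Fin k → A × B → ℂ)
    (i i' : Fin k) (z z' : A × B) :
    purifyingState v (i, z) * (starRingEnd ℂ) (purifyingState v (i', z')) =
      (k : ℂ)⁻¹ * ((starRingEnd ℂ) (v i' z') * v i z) := by
  have hk : ((Real.sqrt k : ℝ) : ℂ) * (Real.sqrt k : ℝ) = k := by
    rw [← Complex.ofReal_mul, Real.mul_self_sqrt (Nat.cast_nonneg k), Complex.ofReal_natCast]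
  simp only [purifyingState, map_mul, one_div, map_inv₀, Complex.conj_ofReal]
  rw [← hk, mul_inv, Prod.mk.eta, Prod.mk.eta]
  ring

section

variable {A B : Type*} [Fintype A] {k : ℕ} (v : Fin k → A × B → ℂ)

lemma codeProj_eq_mul_conjTranspose [Fintype B] :
    codeProj v = codeIsometry v * (codeIsometry v)ᴴ := by
  ext z z'
  simp [codeProj, codeIsometry, Matrix.mul_apply]

lemma conjTranspose_mul_codeIsometry [Fintype B]
    (hv : ∀ i j, (∑ z, (starRingEnd ℂ) (v i z) * v j z) = if i = j then 1 else 0) :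
    (codeIsometry v)ᴴ * codeIsometry v = 1 := by
  ext i j
  simpa [codeIsometry, Matrix.mul_apply, Matrix.one_apply] using hv i j

/-- Compressing an operator to the code subspace gives a multiple of the projection exactly when
its matrix in the code basis is scalar. -/
lemma codeProj_mul_mul_codeProj_eq_smul_iff [Fintype B]
    (hv : ∀ i j, (∑ z, (starRingEnd ℂ) (v i z) * v j z) = if i = j then 1 else 0)
    (M : Matrix (A × B) (A × B) ℂ) (c : ℂ) :
    codeProj v * M * codeProj v = c • codeProj v ↔
      (codeIsometry v)ᴴ * M * codeIsometry v = c • 1 := by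
  have hV := conjTranspose_mul_codeIsometry v hv
  rw [codeProj_eq_mul_conjTranspose]
  generalize codeIsometry v = V at hV ⊢
  constructor
  · intro h
    calc Vᴴ * M * V = (Vᴴ * V) * Vᴴ * M * V * (Vᴴ * V) := by simp [hV]
      _ = Vᴴ * (V * Vᴴ * M * (V * Vᴴ)) * V := by simp only [Matrix.mul_assoc]
      _ = c • ((Vᴴ * V) * (Vᴴ * V)) := by
        rw [h]
        simp only [Matrix.mul_smul, Matrix.smul_mul, Matrix.mul_assoc]
      _ = c • 1 := by rw [hV, Matrix.mul_one]
  · intro h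
    calc V * Vᴴ * M * (V * Vᴴ) = V * (Vᴴ * M * V) * Vᴴ := by simp only [Matrix.mul_assoc]
      _ = c • (V * Vᴴ) := by rw [h]; simp

lemma conjTranspose_mul_kronecker_mul_codeIsometry_apply [DecidableEq A] [Fintype B]
    (X : Matrix B B ℂ) (i j : Fin k) :
    ((codeIsometry v)ᴴ * ((1 : Matrix A A ℂ) ⊗ₖ X) * codeIsometry v) i j =
      ∑ b, ∑ b', X b b' * codeOverlap v i j b b' := by
  simp only [Matrix.mul_apply, Matrix.conjTranspose_apply, codeIsometry, Matrix.of_apply,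
    Matrix.kroneckerMap_apply, Matrix.one_apply, Fintype.sum_prod_type, codeOverlap, ite_mul,
    one_mul, zero_mul, mul_ite, mul_zero]
  have inner (a' : A) (b' : B) :
      (∑ a, ∑ b, if a = a' then star (v i (a, b)) * X b b' else 0) =
        ∑ b, star (v i (a', b)) * X b b' := by
    rw [Finset.sum_comm]
    simp
  simp only [inner, Finset.sum_mul, Finset.mul_sum]
  rw [Finset.sum_comm]
  simp only [Finset.sum_comm (s := (Finset.univ : Finset A))]
  rw [Finset.sum_comm]
  refine Finset.sum_congr rfl fun b _ => Finset.sum_congr rfl fun b' _ =>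
    Finset.sum_congr rfl fun a _ => ?_
  rw [starRingEnd_apply]
  ring

lemma rhoRAbar_apply (i i' : Fin k) (b b' : B) :
    rhoRAbar v (i, b) (i', b') = (k : ℂ)⁻¹ * codeOverlap v i' i b' b := by
  simp only [rhoRAbar, Matrix.of_apply, purifyingState_mul_conj, codeOverlap, Finset.mul_sum]

lemma rhoR_apply [Fintype B]
    (hv : ∀ i j, (∑ z, (starRingEnd ℂ) (v i z) * v j z) = if i = j then 1 else 0)
    (i i' : Fin k) : rhoR v i i' = (k : ℂ)⁻¹ * if i' = i then 1 else 0 := by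
  simp only [rhoR, Matrix.of_apply, purifyingState_mul_conj, ← hv, Fintype.sum_prod_type,
    Finset.mul_sum]

lemma rhoAbar_apply (b b' : B) :
    rhoAbar v b b' = (k : ℂ)⁻¹ * ∑ i, codeOverlap v i i b' b := by
  simp only [rhoAbar, Matrix.of_apply, purifyingState_mul_conj, codeOverlap, Finset.mul_sum]

end

/-- **Knill–Laflamme ⟺ decoupling of the reference from the erased system**: for a code
subspace of `ℂ^(A × Ā)` spanned by an orthonormal family `v : Fin k → ℂ^(A × Ā)` with code
projection `P` and purifying state `φ`, the following are equivalent: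
(3) for every `X` supported on `Ā`, `P * X * P` is a scalar multiple of `P`;
(4) `ρ_{RĀ} = ρ_R ⊗ ρ_Ā`. -/
theorem knill_laflamme_iff_decoupling {A B : Type*}
    [Fintype A] [DecidableEq A] [Nonempty A] [Fintype B] [DecidableEq B] [Nonempty B]
    {k : ℕ} (hk : 0 < k) (v : Fin k → A × B → ℂ)
    (hv : ∀ i j, (∑ z, (starRingEnd ℂ) (v i z) * v j z) = if i = j then 1 else 0) :
    (∀ X : Matrix B B ℂ, ∃ c : ℂ,
      codeProj v * ((1 : Matrix A A ℂ) ⊗ₖ X) * codeProj v = c • codeProj v)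
    ↔
    (∀ i i' b b', rhoRAbar v (i, b) (i', b') = rhoR v i i' * rhoAbar v b b') := by
  have hk0 : (k : ℂ) ≠ 0 := Nat.cast_ne_zero.mpr hk.ne'
  simp only [codeProj_mul_mul_codeProj_eq_smul_iff v hv, rhoRAbar_apply, rhoR_apply v hv,
    rhoAbar_apply]
  constructor
  · intro h i i' b b'
    obtain ⟨c, hc⟩ := h (Matrix.single b' b 1)
    have overlap (i j : Fin k) : codeOverlap v i j b' b = c * if i = j then 1 else 0 := by
      have hij := congrFun (congrFun hc i) j
      rw [conjTranspose_mul_kronecker_mul_codeIsometry_apply] at hij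
      simpa [Matrix.single_apply, Matrix.one_apply, ite_and] using hij
    simp only [overlap, if_true, mul_one, Finset.sum_const, Finset.card_univ, Fintype.card_fin,
      nsmul_eq_mul]
    field_simp
  · intro h X
    refine ⟨∑ b, ∑ b', X b b' * ((k : ℂ)⁻¹ * ∑ l, codeOverlap v l l b b'), ?_⟩
    ext i j
    have overlap (b b' : B) : codeOverlap v i j b b' =
        ((k : ℂ)⁻¹ * ∑ l, codeOverlap v l l b b') * if i = j then 1 else 0 := by
      refine mul_left_cancel₀ (inv_ne_zero hk0) ((h j i b' b).trans ?_)
      ring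
    rw [conjTranspose_mul_kronecker_mul_codeIsometry_apply, Matrix.smul_apply, Matrix.one_apply,
      smul_eq_mul]
    simp only [Finset.sum_mul]
    refine Finset.sum_congr rfl fun b _ => Finset.sum_congr rfl fun b' _ => ?_
    rw [overlap, ← mul_assoc (X b b')]
end

section
/- (Decoupling implies the standard form of a correctable code.) Suppose that with φ (i, a, b) = (1 / √k) * v i (a, b) the reduced density matrix factorizes: Σ_a φ (i,a,b) * conj (φ (i',a,b')) = (Σ_{a,c} φ (i,a,c) * conj (φ (i',a,c))) * (Σ_{j,a} φ (j,a,b) * conj (φ (j,a,b'))) for all i, i', b, b'. Then k ≤ |A|, and writing |A| = k * s + t with 0 ≤ t < k (so s is the quotient of |A| by k), there exist an injective map ι : Fin k × Fin s → A, a unitary matrix U : Matrix A A ℂ, and a unit vector χ : Fin s × Ā → ℂ (Σ |χ|² = 1), such that for every i, v i = (U ⊗ₖ 1).mulVec (w i), where w i (a, b) = χ (a₂, b) whenever a = ι (i, a₂) for some a₂ : Fin s, w i (ι (i', a₂), b) = 0 for i' ≠ i, and w i (a, b) = 0 when a is not in the range of ι. -/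
open Matrix Kronecker

section StandardForm

variable {𝕜 E W I A : Type*} [RCLike 𝕜] [NormedAddCommGroup E] [InnerProductSpace 𝕜 E]
  [FiniteDimensional 𝕜 E] [AddCommGroup W] [Module 𝕜 W] [DecidableEq I]

/-- Linear maps with pairwise orthogonal ranges and a common pulled-back inner product
factor through pairwise orthogonal orthonormal families with common coefficients. -/
theorem exists_orthonormal_of_inner_eq (T : I → W →ₗ[𝕜] E) (i₀ : I)
    (hT : ∀ i j w w', inner 𝕜 (T i w) (T j w') =
      if i = j then inner 𝕜 (T i₀ w) (T i₀ w') else 0) :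
    ∃ (r : ℕ) (c : Fin r → W),
      Orthonormal 𝕜 (fun p : I × Fin r => T p.1 (c p.2)) ∧
      ∀ i w, T i w = ∑ l, inner 𝕜 (T i₀ (c l)) (T i₀ w) • T i (c l) := by
  let e := stdOrthonormalBasis 𝕜 (LinearMap.range (T i₀))
  choose c hc using fun l => (e l).2
  refine ⟨_, c, ?_, fun i w => ?_⟩
  · rw [orthonormal_iff_ite]
    rintro ⟨i, l⟩ ⟨j, m⟩
    have h := orthonormal_iff_ite.mp e.orthonormal l m
    rw [Submodule.coe_inner] at h
    simp only [hT, hc, h, Prod.mk.injEq, ← ite_and]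
  · have h₀ : T i₀ w = ∑ l, inner 𝕜 (T i₀ (c l)) (T i₀ w) • T i₀ (c l) := by
      have h := congrArg Subtype.val (e.sum_repr' ⟨T i₀ w, w, rfl⟩)
      simpa [hc, Submodule.coe_inner] using h.symm
    have h₁ : T i₀ (w - ∑ l, inner 𝕜 (T i₀ (c l)) (T i₀ w) • c l) = 0 := by
      simpa [sub_eq_zero] using h₀
    have h₂ : T i (w - ∑ l, inner 𝕜 (T i₀ (c l)) (T i₀ w) • c l) = 0 := by
      rw [← inner_self_eq_zero (𝕜 := 𝕜), hT, if_pos rfl, h₁, inner_zero_left]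
    simpa [sub_eq_zero] using h₂

/-- An orthonormal family placed at the indices in the range of an injection extends to an
orthonormal basis. -/
theorem Orthonormal.exists_orthonormalBasis_comp_eq [Fintype A] {J : Type*} {f : J → E}
    (hf : Orthonormal 𝕜 f) (hA : Module.finrank 𝕜 E = Fintype.card A)
    {g : J → A} (hg : Function.Injective g) :
    ∃ u : OrthonormalBasis A 𝕜 E, ∀ p, u (g p) = f p := by
  have h : Orthonormal 𝕜 ((Set.range g).domRestrict (Function.extend g f 0)) := by
    have h' : (Set.range g).domRestrict (Function.extend g f 0) =
        f ∘ (Equiv.ofInjective g hg).symm := by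
      funext ⟨_, p, rfl⟩
      rw [Function.comp_apply, Equiv.ofInjective_symm_apply, Set.domRestrict_apply,
        hg.extend_apply]
    rw [h']
    exact hf.comp _ (Equiv.injective _)
  obtain ⟨u, hu⟩ := h.exists_orthonormalBasis_extension_of_card_eq hA
  exact ⟨u, fun p => by rw [hu _ ⟨p, rfl⟩, hg.extend_apply]⟩

/-- Linear maps with pairwise orthogonal ranges and a common pulled-back inner product have,
in a suitable orthonormal basis, the same coordinates on disjoint blocks of indices. -/
theorem exists_orthonormalBasis_of_inner_eq [Fintype A] {k : ℕ} (hk : 0 < k)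
    (hA : Module.finrank 𝕜 E = Fintype.card A) (T : Fin k → W →ₗ[𝕜] E) (i₀ : Fin k)
    (hT : ∀ i j w w', inner 𝕜 (T i w) (T j w') =
      if i = j then inner 𝕜 (T i₀ w) (T i₀ w') else 0) (hT₀ : T i₀ ≠ 0) :
    k ≤ Fintype.card A ∧
    ∃ ι : Fin k × Fin (Fintype.card A / k) → A, Function.Injective ι ∧
    ∃ u : OrthonormalBasis A 𝕜 E,
      (∀ i j l w, inner 𝕜 (u (ι (i, l))) (T j w) =
        if i = j then inner 𝕜 (u (ι (i₀, l))) (T i₀ w) else 0) ∧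
      ∀ a ∉ Set.range ι, ∀ i w, inner 𝕜 (u a) (T i w) = 0 := by
  obtain ⟨r, c, hf, hexp⟩ := exists_orthonormal_of_inner_eq T i₀ hT
  have hcard : k * r ≤ Fintype.card A := by
    simpa [hA] using hf.linearIndependent.fintype_card_le_finrank
  have hr : 0 < r := by
    rcases Nat.eq_zero_or_pos r with rfl | h
    · exact absurd (LinearMap.ext fun w => by rw [hexp]; simp) hT₀
    · exact h
  have hrs : r ≤ Fintype.card A / k := (Nat.le_div_iff_mul_le hk).2 (by rwa [mul_comm])
  refine ⟨(Nat.le_mul_of_pos_right k hr).trans hcard, ?_⟩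
  obtain ⟨ι⟩ : Nonempty (Fin k × Fin (Fintype.card A / k) ↪ A) :=
    Function.Embedding.nonempty_of_card_le (by simpa using Nat.mul_div_le _ _)
  let g : Fin k × Fin r → A := fun p => ι (p.1, Fin.castLE hrs p.2)
  have hg : Function.Injective g := by
    rintro ⟨i, l⟩ ⟨j, m⟩ h
    simpa [g] using h
  obtain ⟨u, hu⟩ := hf.exists_orthonormalBasis_comp_eq hA hg
  have hzero : ∀ a ∉ Set.range g, ∀ i w, inner 𝕜 (u a) (T i w) = 0 := by
    intro a ha i w
    rw [hexp, inner_sum]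
    refine Finset.sum_eq_zero fun l _ => ?_
    have hne : a ≠ g (i, l) := fun h => ha ⟨_, h.symm⟩
    rw [inner_smul_right, ← hu (i, l), u.inner_eq_zero hne, mul_zero]
  refine ⟨ι, ι.injective, u, fun i j l w => ?_, fun a ha => hzero a ?_⟩
  · by_cases hl : (l : ℕ) < r
    · have h (i : Fin k) : u (ι (i, l)) = T i (c ⟨l, hl⟩) := hu (i, ⟨l, hl⟩)
      rw [h, h, hT]
    · have h (i : Fin k) : ι (i, l) ∉ Set.range g := by
        rintro ⟨⟨j, m⟩, hm⟩
        obtain ⟨-, rfl⟩ := Prod.mk.inj (ι.injective hm)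
        exact hl m.2
      rw [hzero _ (h i), hzero _ (h i₀), ite_self]
  · rintro ⟨p, rfl⟩
    exact ha ⟨_, rfl⟩

end StandardForm

/-- Decoupling for an orthonormal code: distinct code vectors have vanishing cross-reductions
and all code vectors have the same reduced matrix. -/
theorem sum_mul_star_eq_of_decoupling {A B : Type*} [Fintype A] [Fintype B]
    {k : ℕ} (hk : 0 < k) (v : Fin k → A × B → ℂ)
    (hv : ∀ i j, (∑ z, (starRingEnd ℂ) (v i z) * v j z) = if i = j then 1 else 0)
    (hdec : ∀ (i i' : Fin k) (b b' : B),
      (∑ a, purifyingState v (i, a, b) * (starRingEnd ℂ) (purifyingState v (i', a, b'))) =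
      (∑ a, ∑ c, purifyingState v (i, a, c) *
          (starRingEnd ℂ) (purifyingState v (i', a, c))) *
      (∑ j, ∑ a, purifyingState v (j, a, b) *
          (starRingEnd ℂ) (purifyingState v (j, a, b'))))
    (i₀ i i' : Fin k) (b b' : B) :
    (∑ a, v i (a, b) * (starRingEnd ℂ) (v i' (a, b'))) =
      if i' = i then ∑ a, v i₀ (a, b) * (starRingEnd ℂ) (v i₀ (a, b')) else 0 := by
  have hk0 : (k : ℂ) ≠ 0 := by exact_mod_cast hk.ne'
  have hφ (x y : Fin k × A × B) :
      purifyingState v x * (starRingEnd ℂ) (purifyingState v y) =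
        (k : ℂ)⁻¹ * (v x.1 x.2 * (starRingEnd ℂ) (v y.1 y.2)) := by
    have hs : ((Real.sqrt k : ℝ) : ℂ) * ((Real.sqrt k : ℝ) : ℂ) = k := by
      rw [← Complex.ofReal_mul, Real.mul_self_sqrt k.cast_nonneg, Complex.ofReal_natCast]
    simp only [purifyingState, map_mul, map_div₀, map_one, Complex.conj_ofReal, Prod.mk.eta,
      ← hs, mul_inv]
    ring
  have hi (i i' : Fin k) :
      (∑ a, ∑ c, v i (a, c) * (starRingEnd ℂ) (v i' (a, c))) = if i' = i then 1 else 0 := by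
    rw [← hv i' i, Fintype.sum_prod_type]
    simp only [mul_comm]
  have key (i i' : Fin k) : (∑ a, v i (a, b) * (starRingEnd ℂ) (v i' (a, b'))) =
      if i' = i then (k : ℂ)⁻¹ * ∑ j, ∑ a, v j (a, b) * (starRingEnd ℂ) (v j (a, b'))
      else 0 := by
    have h := hdec i i' b b'
    simp only [hφ, ← Finset.mul_sum, hi] at h
    rw [mul_assoc] at h
    rw [mul_left_cancel₀ (inv_ne_zero hk0) h]
    split_ifs <;> simp
  rw [key i i', key i₀ i₀, if_pos rfl]


/-- **Decoupling implies the standard form of a correctable code**: if the reduced density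
matrix of the purifying state `φ` factorizes as `ρ_{RĀ} = ρ_R ⊗ ρ_Ā`, then `k ≤ |A|` and,
with `s` the quotient of `|A|` by `k`, there are an injection `ι : Fin k × Fin s → A`, a
unitary `U` on `A` and a unit vector `χ : Fin s × Ā → ℂ` such that each code vector has the
standard form `v i = (U ⊗ₖ 1).mulVec (w i)` with `w i (ι (i, a₂), b) = χ (a₂, b)`,
`w i (ι (i', a₂), b) = 0` for `i' ≠ i`, and `w i (a, b) = 0` for `a` outside the range
of `ι`. -/
theorem decoupling_implies_standard_form {A B : Type*}
    [Fintype A] [DecidableEq A] [Nonempty A] [Fintype B] [DecidableEq B] [Nonempty B]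
    {k : ℕ} (hk : 0 < k) (v : Fin k → A × B → ℂ)
    (hv : ∀ i j, (∑ z, (starRingEnd ℂ) (v i z) * v j z) = if i = j then 1 else 0)
    (hdec : ∀ (i i' : Fin k) (b b' : B),
      (∑ a, purifyingState v (i, a, b) * (starRingEnd ℂ) (purifyingState v (i', a, b'))) =
      (∑ a, ∑ c, purifyingState v (i, a, c) *
          (starRingEnd ℂ) (purifyingState v (i', a, c))) *
      (∑ j, ∑ a, purifyingState v (j, a, b) *
          (starRingEnd ℂ) (purifyingState v (j, a, b')))) :
    k ≤ Fintype.card A ∧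
    ∃ ι : Fin k × Fin (Fintype.card A / k) → A, Function.Injective ι ∧
    ∃ U : Matrix A A ℂ, Uᴴ * U = 1 ∧
    ∃ χ : Fin (Fintype.card A / k) × B → ℂ, (∑ z, Complex.normSq (χ z)) = 1 ∧
    ∃ w : Fin k → A × B → ℂ,
      (∀ i, v i = (U ⊗ₖ (1 : Matrix B B ℂ)).mulVec (w i)) ∧
      (∀ i a₂ b, w i (ι (i, a₂), b) = χ (a₂, b)) ∧
      (∀ i i' a₂ b, i' ≠ i → w i (ι (i', a₂), b) = 0) ∧
      (∀ i a b, a ∉ Set.range ι → w i (a, b) = 0) := by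
  let i₀ : Fin k := ⟨0, hk⟩
  let x (i : Fin k) (b : B) : EuclideanSpace ℂ A := WithLp.toLp 2 fun a => v i (a, b)
  let T (i : Fin k) : (B → ℂ) →ₗ[ℂ] EuclideanSpace ℂ A := Fintype.linearCombination ℂ (x i)
  have hx (i i' : Fin k) (b b' : B) : inner ℂ (x i b) (x i' b') =
      if i = i' then inner ℂ (x i₀ b) (x i₀ b') else 0 := by
    simpa [x, PiLp.inner_apply] using
      sum_mul_star_eq_of_decoupling hk v hv hdec i₀ i' i b' b
  have hT (i j : Fin k) (c d : B → ℂ) : inner ℂ (T i c) (T j d) =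
      if i = j then inner ℂ (T i₀ c) (T i₀ d) else 0 := by
    simp only [T, Fintype.linearCombination_apply, sum_inner, inner_sum, inner_smul_left,
      inner_smul_right, hx i j]
    split_ifs <;> simp
  have hTx (i : Fin k) (b : B) : T i (Pi.single b 1) = x i b := by simp [T]
  have hnorm : ∑ b, ‖x i₀ b‖ ^ 2 = 1 := by
    have h := hv i₀ i₀
    simp only [if_true, ← Complex.normSq_eq_conj_mul_self] at h
    have h' : ∑ z, Complex.normSq (v i₀ z) = 1 := by exact_mod_cast h
    rw [Fintype.sum_prod_type_right] at h'
    simpa [x, EuclideanSpace.norm_sq_eq, Complex.normSq_eq_norm_sq] using h'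
  have hT₀ : T i₀ ≠ 0 := by
    intro h
    simp [← hTx, h] at hnorm
  obtain ⟨hle, ι, hι, u, hblock, hout⟩ :=
    exists_orthonormalBasis_of_inner_eq hk finrank_euclideanSpace T i₀ hT hT₀
  refine ⟨hle, ι, hι, Matrix.of fun a a' => u a' a, ?_,
    fun z => inner ℂ (u (ι (i₀, z.1))) (x i₀ z.2), ?_,
    fun i z => inner ℂ (u z.1) (x i z.2), fun i => ?_, fun i l b => ?_, fun i i' l b h => ?_,
    fun i a b ha => ?_⟩
  · ext a a'
    have h := orthonormal_iff_ite.mp u.orthonormal a a'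
    simpa [Matrix.mul_apply, Matrix.one_apply, PiLp.inner_apply, mul_comm] using h
  · have hinj : Function.Injective fun l => ι (i₀, l) := fun l m h => (Prod.mk.inj (hι h)).2
    rw [← hnorm, Fintype.sum_prod_type_right]
    refine Finset.sum_congr rfl fun b _ => ?_
    rw [← u.sum_sq_norm_inner_right]
    simp only [Complex.normSq_eq_norm_sq]
    refine Fintype.sum_of_injective _ hinj _ _ (fun a ha => ?_) fun _ => rfl
    suffices inner ℂ (u a) (x i₀ b) = 0 by simp [this]
    rw [← hTx]
    by_cases h : a ∈ Set.range ι
    · obtain ⟨⟨j, l⟩, rfl⟩ := h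
      rw [hblock, if_neg]
      rintro rfl
      exact ha ⟨l, rfl⟩
    · exact hout a h _ _
  · ext ⟨a, b⟩
    have h := congrArg (fun y : EuclideanSpace ℂ A => y a) (u.sum_repr' (x i b))
    simpa [Matrix.mulVec, dotProduct, Fintype.sum_prod_type, Matrix.one_apply, mul_comm] using h.symm
  · simpa [hTx] using hblock i i l (Pi.single b 1)
  · simpa [hTx, h] using hblock i' i l (Pi.single b 1)
  · simpa [hTx] using hout a ha i (Pi.single b 1)
end

section
/- (Structure of subsystem codes with complementary recovery.) Suppose: (i) for every o : Matrix (Fin k) (Fin k) ℂ there exists O_A : Matrix A A ℂ with (O_A ⊗ₖ 1).mulVec (v (i,j)) = Σ_{i'} (o i' i) • v (i', j) and (O_A ⊗ₖ 1)ᴴ.mulVec (v (i,j)) = Σ_{i'} (conj (o i i')) • v (i', j) for all i, j; and (ii) for every ō : Matrix (Fin l) (Fin l) ℂ there exists O_Ā : Matrix Ā Ā ℂ with (1 ⊗ₖ O_Ā).mulVec (v (i,j)) = Σ_{j'} (ō j' j) • v (i, j') and (1 ⊗ₖ O_Ā)ᴴ.mulVec (v (i,j)) = Σ_{j'} (conj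 (ō j j')) • v (i, j') for all i, j. Then there exist natural numbers s, s̄, injective maps ι : Fin k × Fin s → A and ῑ : Fin l × Fin s̄ → Ā, unitary matrices U_A : Matrix A A ℂ and U_Ā : Matrix Ā Ā ℂ, and a unit vector χ : Fin s × Fin s̄ → ℂ, such that for all i, j: v (i,j) = (U_A ⊗ₖ U_Ā).mulVec (w (i,j)), where w (i,j) (a,b) = χ (a₂, b₂) when a = ι (i, a₂) and b = ῑ (j, b₂) for some a₂, b₂, and w (i,j) (a,b) = 0 for all other (a,b). -/
open Matrix Kronecker

/-- The column space of a matrix `M` has an orthonormal basis, assembled in the columns of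
`M * X`. -/
lemma exists_orthonormal_columns {A B : Type*} [Fintype A] [Fintype B]
    [DecidableEq B] (M : Matrix A B ℂ) :
    ∃ (s : ℕ) (X : Matrix B (Fin s) ℂ),
      (M * X)ᴴ * (M * X) = 1 ∧ (M * X) * ((M * X)ᴴ * M) = M := by
  let L := Matrix.toEuclideanLin M
  let S := LinearMap.range L
  let b := stdOrthonormalBasis ℂ S
  have hx : ∀ a, ∃ x, L x = (b a : EuclideanSpace ℂ A) := fun a => (b a).2
  choose x hx using hx
  let X : Matrix B (Fin (Module.finrank ℂ S)) ℂ := Matrix.of fun y a => x a y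
  have hE : ∀ z a, (M * X) z a = (b a : EuclideanSpace ℂ A) z := by
    intro z a
    rw [← hx a]
    simp [L, X, Matrix.mul_apply, Matrix.toLpLin_apply, Matrix.mulVec, dotProduct]
  refine ⟨_, X, ?_, ?_⟩
  · ext a c
    have h := orthonormal_iff_ite.mp b.orthonormal a c
    rw [Submodule.coe_inner, PiLp.inner_apply] at h
    simp only [RCLike.inner_apply] at h
    rw [Matrix.mul_apply, Matrix.one_apply, ← h]
    refine Finset.sum_congr rfl fun z _ => ?_
    rw [Matrix.conjTranspose_apply, hE, hE, mul_comm]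
    rfl
  · ext z y
    let m : S := ⟨L (EuclideanSpace.single y 1), LinearMap.mem_range_self _ _⟩
    have hm : ∀ t, (m : EuclideanSpace ℂ A) t = M t y := by
      intro t
      simp [m, L, Matrix.toLpLin_apply]
    have h := congrArg (fun u : S => (u : EuclideanSpace ℂ A) z) (b.sum_repr' m)
    simp only [hm, Submodule.coe_sum, Submodule.coe_smul, WithLp.ofLp_sum, WithLp.ofLp_smul,
      Finset.sum_apply, Pi.smul_apply, smul_eq_mul] at h
    rw [Matrix.mul_apply, ← h]
    refine Finset.sum_congr rfl fun a _ => ?_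
    rw [hE, mul_comm, Submodule.coe_inner, PiLp.inner_apply, Matrix.mul_apply]
    congr 1
    refine Finset.sum_congr rfl fun t _ => ?_
    rw [Matrix.conjTranspose_apply, hE, RCLike.inner_apply, hm, mul_comm]
    rfl

/-- The columns of an isometry can be found among the columns of a unitary. -/
lemma exists_unitary_extending_isometry {A P : Type*} [Fintype A] [DecidableEq A] [Fintype P]
    [DecidableEq P] (V : Matrix A P ℂ) (hV : Vᴴ * V = 1) :
    ∃ (ι : P → A) (U : Matrix A A ℂ), Function.Injective ι ∧ Uᴴ * U = 1 ∧
      ∀ x p, U x (ι p) = V x p := by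
  let e : P → EuclideanSpace ℂ A := fun p => WithLp.toLp 2 fun x => V x p
  have he : Orthonormal ℂ e := by
    rw [orthonormal_iff_ite]
    intro p q
    rw [PiLp.inner_apply, ← Matrix.one_apply, ← hV, Matrix.mul_apply]
    refine Finset.sum_congr rfl fun z _ => ?_
    rw [RCLike.inner_apply, Matrix.conjTranspose_apply, mul_comm]
    rfl
  have hcard : Fintype.card P ≤ Fintype.card A := by
    simpa using he.linearIndependent.fintype_card_le_finrank
  obtain ⟨ι⟩ := Function.Embedding.nonempty_of_card_le hcard
  let f : A → EuclideanSpace ℂ A := Function.extend ι e 0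
  have hf : ∀ p, f (ι p) = e p := fun p => ι.injective.extend_apply _ _ _
  have ho : Orthonormal ℂ ((Set.range ι).domRestrict f) := by
    rw [orthonormal_iff_ite] at he ⊢
    rintro ⟨a, ha⟩ ⟨c, hc⟩
    obtain ⟨p, rfl⟩ := ha
    obtain ⟨q, rfl⟩ := hc
    simp only [Set.domRestrict_apply, hf, he]
    exact if_congr (by rw [Subtype.ext_iff, ι.injective.eq_iff]) rfl rfl
  obtain ⟨b, hb⟩ := ho.exists_orthonormalBasis_extension_of_card_eq (by simp)
  refine ⟨ι, Matrix.of fun x a => b a x, ι.injective, ?_, ?_⟩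
  · ext p q
    have h := orthonormal_iff_ite.mp b.orthonormal p q
    rw [PiLp.inner_apply] at h
    rw [Matrix.mul_apply, Matrix.one_apply, ← h]
    refine Finset.sum_congr rfl fun z _ => ?_
    rw [Matrix.conjTranspose_apply, RCLike.inner_apply, mul_comm]
    rfl
  · intro x p
    rw [Matrix.of_apply, hb _ ⟨p, rfl⟩, hf]

/-- If all operators on the first index of a family `W i j` of bipartite vectors (written as
matrices) are implemented by left multiplication, together with their adjoints, then the vectors
`W i j` arise from `W i₀ j` by operators `O i` that move the column space of `W i₀ j₀` to
mutually orthogonal subspaces, simultaneously straightened by a unitary. -/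
lemma exists_local_structure {A B n m : Type*} [Fintype A] [DecidableEq A] [Fintype B]
    [DecidableEq B] [Fintype n] [DecidableEq n] (W : n → m → Matrix A B ℂ)
    (h : ∀ o : Matrix n n ℂ, ∃ O : Matrix A A ℂ, ∀ i j,
      O * W i j = ∑ i', o i' i • W i' j ∧
      Oᴴ * W i j = ∑ i', (starRingEnd ℂ) (o i i') • W i' j) (i₀ : n) (j₀ : m) :
    ∃ (s : ℕ) (ι : n × Fin s → A) (U : Matrix A A ℂ) (O : n → Matrix A A ℂ)
      (E : Matrix A (Fin s) ℂ), Function.Injective ι ∧ Uᴴ * U = 1 ∧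
      E * (Eᴴ * W i₀ j₀) = W i₀ j₀ ∧ (∀ i j, O i * W i₀ j = W i j) ∧
      ∀ x i a, U x (ι (i, a)) = (O i * E) x a := by
  choose R hR using h
  let O : n → Matrix A A ℂ := fun i => R (Matrix.single i i₀ 1)
  have hO : ∀ i j, O i * W i₀ j = W i j := by
    intro i j
    rw [(hR _ i₀ j).1, Finset.sum_eq_single i] <;> simp +contextual [eq_comm]
  have hO' : ∀ i i' j, (O i)ᴴ * W i' j = if i = i' then W i₀ j else 0 := by
    intro i i' j
    rw [(hR _ i' j).2, Finset.sum_eq_single i₀] <;>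
      simp +contextual [Matrix.single_apply, eq_comm]
  obtain ⟨s, X, h1, h2⟩ := exists_orthonormal_columns (W i₀ j₀)
  let V : Matrix A (n × Fin s) ℂ := Matrix.of fun x p => (O p.1 * (W i₀ j₀ * X)) x p.2
  have hblock : ∀ i i', (O i * (W i₀ j₀ * X))ᴴ * (O i' * (W i₀ j₀ * X)) =
      if i = i' then 1 else 0 := by
    intro i i'
    rw [← Matrix.mul_assoc (O i'), hO, Matrix.conjTranspose_mul, Matrix.mul_assoc,
      ← Matrix.mul_assoc _ (W i' j₀), hO']
    split_ifs with hi
    · exact h1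
    · simp
  have hV : Vᴴ * V = 1 := by
    ext ⟨i, a⟩ ⟨i', a'⟩
    have hb := congrFun (congrFun (hblock i i') a) a'
    change ((O i * (W i₀ j₀ * X))ᴴ * (O i' * (W i₀ j₀ * X))) a a' = _
    rw [hb]
    by_cases hi : i = i' <;> simp [Matrix.one_apply, hi]
  obtain ⟨ι, U, hι, hU, hUV⟩ := exists_unitary_extending_isometry V hV
  exact ⟨s, ι, U, O, W i₀ j₀ * X, hι, hU, h2, hO, fun x i a => hUV x (i, a)⟩

/-- Squared entries of `C` sum to the trace of `Cᴴ * C`. -/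
lemma sum_normSq_eq_trace {A B : Type*} [Fintype A] [Fintype B] (C : Matrix A B ℂ) :
    ((∑ z : A × B, Complex.normSq (C z.1 z.2) : ℝ) : ℂ) = (Cᴴ * C).trace := by
  simp only [Matrix.trace, Matrix.diag, Matrix.mul_apply, Matrix.conjTranspose_apply]
  rw [Fintype.sum_prod_type_right]
  push_cast
  simp [Complex.normSq_eq_conj_mul_self]

/-- **Structure of subsystem codes with complementary recovery**: if every logical
operator on the first logical factor (with its adjoint) can be represented on `A`, and
every logical operator on the second logical factor (with its adjoint) can be represented
on `Ā`, then up to local unitaries `U_A`, `U_Ā` the code vectors take the standard form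
`v (i,j) = (U_A ⊗ₖ U_Ā).mulVec (w (i,j))` with `w (i,j) (ι (i,a₂), ῑ (j,b₂)) = χ (a₂,b₂)`
for a fixed unit vector `χ`, and `w (i,j)` vanishing at all other points. -/
theorem subsystem_code_structure {A B : Type*}
    [Fintype A] [DecidableEq A] [Nonempty A] [Fintype B] [DecidableEq B] [Nonempty B]
    {k l : ℕ} (hk : 0 < k) (hl : 0 < l) (v : Fin k × Fin l → A × B → ℂ)
    (hv : ∀ p q, (∑ z, (starRingEnd ℂ) (v p z) * v q z) = if p = q then 1 else 0)
    (hA : ∀ o : Matrix (Fin k) (Fin k) ℂ, ∃ OA : Matrix A A ℂ, ∀ i j,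
      ((OA ⊗ₖ (1 : Matrix B B ℂ)).mulVec (v (i, j)) = ∑ i', o i' i • v (i', j)) ∧
      ((OA ⊗ₖ (1 : Matrix B B ℂ))ᴴ.mulVec (v (i, j)) =
        ∑ i', (starRingEnd ℂ) (o i i') • v (i', j)))
    (hB : ∀ ob : Matrix (Fin l) (Fin l) ℂ, ∃ OB : Matrix B B ℂ, ∀ i j,
      (((1 : Matrix A A ℂ) ⊗ₖ OB).mulVec (v (i, j)) = ∑ j', ob j' j • v (i, j')) ∧
      (((1 : Matrix A A ℂ) ⊗ₖ OB)ᴴ.mulVec (v (i, j)) =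
        ∑ j', (starRingEnd ℂ) (ob j j') • v (i, j'))) :
    ∃ (s sb : ℕ) (ι : Fin k × Fin s → A) (ιb : Fin l × Fin sb → B),
      Function.Injective ι ∧ Function.Injective ιb ∧
    ∃ (UA : Matrix A A ℂ) (UB : Matrix B B ℂ), UAᴴ * UA = 1 ∧ UBᴴ * UB = 1 ∧
    ∃ χ : Fin s × Fin sb → ℂ, (∑ z, Complex.normSq (χ z)) = 1 ∧
    ∃ w : Fin k × Fin l → A × B → ℂ,
      (∀ i j, v (i, j) = (UA ⊗ₖ UB).mulVec (w (i, j))) ∧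
      (∀ i j a₂ b₂, w (i, j) (ι (i, a₂), ιb (j, b₂)) = χ (a₂, b₂)) ∧
      (∀ i j a b, (¬ ∃ a₂ b₂, a = ι (i, a₂) ∧ b = ιb (j, b₂)) → w (i, j) (a, b) = 0) := by
  let W : Fin k → Fin l → Matrix A B ℂ := fun i j => Matrix.of fun x y => v (i, j) (x, y)
  have hL : ∀ (O : Matrix A A ℂ) i j x y,
      (O ⊗ₖ (1 : Matrix B B ℂ)).mulVec (v (i, j)) (x, y) = (O * W i j) x y := by
    intro O i j x y
    simp [Matrix.mulVec, dotProduct, Fintype.sum_prod_type, Matrix.mul_apply,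
      Matrix.kroneckerMap_apply, Matrix.one_apply, W]
  have hR : ∀ (O : Matrix B B ℂ) i j x y,
      ((1 : Matrix A A ℂ) ⊗ₖ O).mulVec (v (i, j)) (x, y) = (O * (W i j)ᵀ) y x := by
    intro O i j x y
    simp [Matrix.mulVec, dotProduct, Fintype.sum_prod_type_right, Matrix.mul_apply,
      Matrix.kroneckerMap_apply, Matrix.one_apply, W]
  obtain ⟨s, ι, UA, O, E, hι, hUA, hE, hO, hUE⟩ := exists_local_structure W (by
    intro o
    obtain ⟨OA, h⟩ := hA o
    refine ⟨OA, fun i j => ⟨?_, ?_⟩⟩ <;> ext x y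
    · rw [← hL, (h i j).1]
      simp [Matrix.sum_apply, W]
    · have h' := (h i j).2
      rw [Matrix.conjTranspose_kronecker, Matrix.conjTranspose_one] at h'
      rw [← hL, h']
      simp [Matrix.sum_apply, W]) ⟨0, hk⟩ ⟨0, hl⟩
  obtain ⟨t, ιb, UB, Q, F, hιb, hUB, hF, hQ, hUF⟩ :=
    exists_local_structure (fun j i => (W i j)ᵀ) (by
      intro o
      obtain ⟨OB, h⟩ := hB o
      refine ⟨OB, fun j i => ⟨?_, ?_⟩⟩ <;> ext y x
      · rw [← hR, (h i j).1]
        simp [Matrix.sum_apply, W]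
      · have h' := (h i j).2
        rw [Matrix.conjTranspose_kronecker, Matrix.conjTranspose_one] at h'
        rw [← hR, h']
        simp [Matrix.sum_apply, W]) ⟨0, hl⟩ ⟨0, hk⟩
  set M := W ⟨0, hk⟩ ⟨0, hl⟩ with hM
  have hF' : M * Fᴴᵀ * Fᵀ = M := by
    have := congrArg Matrix.transpose hF
    simpa [Matrix.transpose_mul] using this
  let C : Matrix (Fin s) (Fin t) ℂ := Eᴴ * M * Fᴴᵀ
  have hEC : E * C * Fᵀ = M := by
    calc E * C * Fᵀ = E * (Eᴴ * (M * Fᴴᵀ * Fᵀ)) := by simp only [C, Matrix.mul_assoc]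
      _ = M := by rw [hF', hE]
  have hW : ∀ i j, W i j = (O i * E) * C * (Q j * F)ᵀ := by
    intro i j
    have h := congrArg Matrix.transpose (hQ j ⟨0, hk⟩)
    simp only [Matrix.transpose_mul, Matrix.transpose_transpose] at h
    rw [← hO i j, ← h, ← hM, ← hEC, Matrix.transpose_mul]
    simp only [Matrix.mul_assoc]
  have hC : (∑ z : Fin s × Fin t, Complex.normSq (C z.1 z.2)) = 1 := by
    have hCC : (Cᴴ * C).trace = (Mᴴ * M).trace := by
      have hFs : Fᴴᵀᴴ = Fᵀ := by ext; simp
      calc (Cᴴ * C).trace = (Fᵀ * (Mᴴ * (E * (Eᴴ * M)) * Fᴴᵀ)).trace := by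
            simp only [C, Matrix.conjTranspose_mul, Matrix.conjTranspose_conjTranspose, hFs,
              Matrix.mul_assoc]
        _ = (Mᴴ * (M * Fᴴᵀ * Fᵀ)).trace := by
            rw [hE, Matrix.trace_mul_comm]
            simp only [Matrix.mul_assoc]
        _ = (Mᴴ * M).trace := by rw [hF']
    have h1 := hv (⟨0, hk⟩, ⟨0, hl⟩) (⟨0, hk⟩, ⟨0, hl⟩)
    rw [if_pos rfl] at h1
    apply Complex.ofReal_injective
    rw [sum_normSq_eq_trace, hCC, ← sum_normSq_eq_trace]
    push_cast
    rw [← h1]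
    simp [Complex.normSq_eq_conj_mul_self, M, W]
  let w : Fin k × Fin l → A × B → ℂ := fun p z =>
    ∑ a₂, ∑ b₂, if z.1 = ι (p.1, a₂) ∧ z.2 = ιb (p.2, b₂) then C a₂ b₂ else 0
  refine ⟨s, t, ι, ιb, hι, hιb, UA, UB, hUA, hUB, fun z => C z.1 z.2, hC, w, ?_, ?_, ?_⟩
  · intro i j
    ext ⟨x, y⟩
    have h : v (i, j) (x, y) = ∑ a₂, ∑ b₂, UA x (ι (i, a₂)) * C a₂ b₂ * UB y (ιb (j, b₂)) := by
      change W i j x y = _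
      rw [hW, Matrix.mul_apply, Finset.sum_comm]
      refine Finset.sum_congr rfl fun b₂ _ => ?_
      rw [Matrix.mul_apply, Finset.sum_mul]
      simp only [hUE, hUF, Matrix.transpose_apply]
    rw [h]
    simp only [Matrix.mulVec, dotProduct, w, Finset.mul_sum]
    symm
    rw [Finset.sum_comm]
    refine Finset.sum_congr rfl fun a₂ _ => ?_
    rw [Finset.sum_comm]
    refine Finset.sum_congr rfl fun b₂ _ => ?_
    rw [Finset.sum_eq_single (ι (i, a₂), ιb (j, b₂))]
    · simp only [Matrix.kroneckerMap_apply, and_self, if_true]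
      ring
    · rintro ⟨a, b⟩ - hne
      rw [if_neg (by simpa using hne), mul_zero]
    · simp
  · intro i j a₂ b₂
    simp only [w]
    rw [Finset.sum_eq_single a₂, Finset.sum_eq_single b₂] <;>
      simp +contextual [hι.eq_iff, hιb.eq_iff, eq_comm]
  · intro i j a b hab
    simp only [w]
    refine Finset.sum_eq_zero fun a₂ _ => ?_
    refine Finset.sum_eq_zero fun b₂ _ => ?_
    exact if_neg fun h => hab ⟨a₂, b₂, h⟩
end

section
/- (Operator-algebra erasure-correction conditions.) Let M be a star-subalgebra of Matrix (Fin k) (Fin k) ℂ containing the identity (a von Neumann algebra of logical operators on the code subspace, expressed in the basis v). The following are equivalent: (2) for every o ∈ M there exists O_A : Matrix A A ℂ such that for every i, (O_A ⊗ₖ 1).mulVec (v i) = Σ_j (o j i) • v j and (O_A ⊗ₖ 1)ᴴ.mulVec (v i) = Σ_j ((oᴴ) j i) • v j; (3) for every X : Matrix Ā Ā ℂ there exists x' in the commutant of M (i.e. x' commutes with every element of M) such that P * (1 ⊗ₖ X) * P = Σ_{i, j} (x' j i) • E j i, where E j i is the matrix with entries E z z' = v j z * conj (v i z'). -/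
open Matrix Kronecker

/-- The vectors `v i` reshaped into one matrix from `B × Fin k` to `A`. -/
def codeReshape {A B : Type*} {k : ℕ} (v : Fin k → A × B → ℂ) : Matrix A (B × Fin k) ℂ :=
  Matrix.of fun a p => v p.2 (a, p.1)

/-- The block `(b, c)` of a matrix indexed by `B × I`. -/
def matrixBlock {B I : Type*} (G : Matrix (B × I) (B × I) ℂ) (b c : B) : Matrix I I ℂ :=
  Matrix.of fun i j => G (b, i) (c, j)

theorem commute_one_kronecker_iff {B I : Type*} [Fintype B] [DecidableEq B] [Fintype I]
    (G : Matrix (B × I) (B × I) ℂ) (m : Matrix I I ℂ) :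
    Commute G ((1 : Matrix B B ℂ) ⊗ₖ m) ↔ ∀ b c, Commute (matrixBlock G b c) m := by
  have hl (b i c j) : (G * ((1 : Matrix B B ℂ) ⊗ₖ m)) (b, i) (c, j) =
      (matrixBlock G b c * m) i j := by
    simp [Matrix.mul_apply, Fintype.sum_prod_type_right, matrixBlock, Matrix.one_apply]
  have hr (b i c j) : (((1 : Matrix B B ℂ) ⊗ₖ m) * G) (b, i) (c, j) =
      (m * matrixBlock G b c) i j := by
    simp [Matrix.mul_apply, Fintype.sum_prod_type_right, matrixBlock, Matrix.one_apply]
  constructor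
  · intro h b c
    ext i j
    rw [← hl, ← hr, h.eq]
  · intro h
    ext ⟨b, i⟩ ⟨c, j⟩
    rw [hl, hr, (h b c).eq]

/-- A Hermitian matrix has a Hermitian generalized inverse which commutes with every matrix
commuting with it. -/
theorem Matrix.IsHermitian.exists_generalized_inverse {n : Type*} [Fintype n] [DecidableEq n]
    {G : Matrix n n ℂ} (hG : G.IsHermitian) :
    ∃ Y : Matrix n n ℂ, Y.IsHermitian ∧ G * Y * G = G ∧ ∀ R, Commute G R → Commute Y R := by
  have hc (f : ℝ → ℝ) : ContinuousOn f (spectrum ℝ G) :=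
    (Matrix.finite_real_spectrum (A := G)).continuousOn f
  have hsa : IsSelfAdjoint G := hG
  refine ⟨cfc (fun x : ℝ => x⁻¹) G, cfc_predicate (R := ℝ) _ G, ?_, fun R hR => ?_⟩
  · have hid : cfc (fun x : ℝ => x) G = G := cfc_id' ℝ G
    calc G * cfc (fun x : ℝ => x⁻¹) G * G
        = cfc (fun x : ℝ => x) G * cfc (fun x : ℝ => x⁻¹) G * cfc (fun x : ℝ => x) G := by
          rw [hid]
      _ = cfc (fun x : ℝ => x * x⁻¹ * x) G := by
          rw [← cfc_mul _ _ G (hc _) (hc _), ← cfc_mul _ _ G (hc _) (hc _)]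
      _ = G := by simp only [mul_inv_mul_cancel, hid]
  · exact hsa.commute_cfc hR _

open scoped ComplexOrder in
/-- If `R` commutes with the Gram matrix of `W`, then right multiplication of `W` by `R` and by
`Rᴴ` is implemented by left multiplication by a matrix and its adjoint. -/
theorem exists_mul_eq_mul_of_commute_gram {m n : Type*} [Fintype m] [Fintype n] [DecidableEq n]
    (W : Matrix m n ℂ) (R : Matrix n n ℂ) (h : Commute (Wᴴ * W) R) :
    ∃ O : Matrix m m ℂ, O * W = W * R ∧ Oᴴ * W = W * Rᴴ := by
  have hG : (Wᴴ * W).IsHermitian := Matrix.isHermitian_conjTranspose_mul_self W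
  obtain ⟨Y, hY, hGYG, hcomm⟩ := hG.exists_generalized_inverse
  have hstar : Commute (Wᴴ * W) Rᴴ := by
    have := h.star_star
    rwa [Matrix.star_eq_conjTranspose, Matrix.star_eq_conjTranspose, hG.eq] at this
  have hW : W * (Y * (Wᴴ * W)) = W := by
    have : Wᴴ * W * (Y * (Wᴴ * W)) = Wᴴ * W * 1 := by
      rw [← Matrix.mul_assoc, hGYG, Matrix.mul_one]
    rw [← sub_eq_zero, ← Matrix.mul_sub, Matrix.conjTranspose_mul_self_mul_eq_zero,
      Matrix.mul_sub, sub_eq_zero, Matrix.mul_one] at this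
    exact this
  refine ⟨W * (R * Y) * Wᴴ, ?_, ?_⟩
  · calc W * (R * Y) * Wᴴ * W = W * (R * (Y * (Wᴴ * W))) := by simp only [Matrix.mul_assoc]
      _ = W * ((Y * (Wᴴ * W)) * R) := by
        rw [(((hcomm R h).mul_left h)).eq]
      _ = W * R := by rw [← Matrix.mul_assoc, hW]
  · calc (W * (R * Y) * Wᴴ)ᴴ * W = W * (Y * (Rᴴ * (Wᴴ * W))) := by
          simp only [Matrix.conjTranspose_mul, Matrix.conjTranspose_conjTranspose, hY.eq,
            Matrix.mul_assoc]
      _ = W * (Y * (Wᴴ * W)) * Rᴴ := by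
        rw [← hstar.eq]; simp only [Matrix.mul_assoc]
      _ = W * Rᴴ := by rw [hW]

theorem codeProj_eq {A B : Type*} [Fintype A] [Fintype B] {k : ℕ}
    (v : Fin k → A × B → ℂ) : codeProj v = codeIsometry v * (codeIsometry v)ᴴ := by
  ext z z'
  simp [codeProj, codeIsometry, Matrix.mul_apply]

theorem codeIsometry_conjTranspose_mul_self {A B : Type*} [Fintype A] [Fintype B] {k : ℕ}
    (v : Fin k → A × B → ℂ)
    (hv : ∀ i j, (∑ z, (starRingEnd ℂ) (v i z) * v j z) = if i = j then 1 else 0) :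
    (codeIsometry v)ᴴ * codeIsometry v = 1 := by
  ext i j
  simpa [codeIsometry, Matrix.mul_apply, Matrix.one_apply] using hv i j

theorem codeIsometry_mul_mul_conjTranspose {A B : Type*} {k : ℕ}
    (v : Fin k → A × B → ℂ) (x : Matrix (Fin k) (Fin k) ℂ) :
    codeIsometry v * x * (codeIsometry v)ᴴ =
      ∑ i, ∑ j, x j i • (Matrix.of fun z z' => v j z * (starRingEnd ℂ) (v i z')) := by
  ext z z'
  simp only [codeIsometry, Matrix.mul_apply, Matrix.sum_apply, Matrix.smul_apply, Matrix.of_apply,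
    Matrix.conjTranspose_apply, Finset.sum_mul, smul_eq_mul]
  refine Finset.sum_congr rfl fun i _ => Finset.sum_congr rfl fun j _ => ?_
  rw [starRingEnd_apply]
  ring

theorem compress_one_kronecker {A B : Type*} [Fintype A] [DecidableEq A] [Fintype B] {k : ℕ}
    (v : Fin k → A × B → ℂ) (X : Matrix B B ℂ) :
    (codeIsometry v)ᴴ * ((1 : Matrix A A ℂ) ⊗ₖ X) * codeIsometry v =
      ∑ b, ∑ b', X b b' • matrixBlock ((codeReshape v)ᴴ * codeReshape v) b b' := by
  ext i j
  simp only [codeIsometry, codeReshape, matrixBlock, Matrix.mul_apply, Matrix.sum_apply,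
    Matrix.smul_apply, Matrix.of_apply, Matrix.conjTranspose_apply, Finset.sum_mul, smul_eq_mul,
    Fintype.sum_prod_type, Matrix.kroneckerMap_apply, Matrix.one_apply, Finset.mul_sum]
  simp only [ite_mul, mul_ite, one_mul, zero_mul, mul_zero]
  calc _ = ∑ a, ∑ c, ∑ b, star (v i (a, b)) * X b c * v j (a, c) := by
        refine Finset.sum_congr rfl fun a _ => Finset.sum_congr rfl fun c _ => ?_
        rw [Finset.sum_comm]
        simp
    _ = ∑ c, ∑ b, ∑ a, star (v i (a, b)) * X b c * v j (a, c) := by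
        rw [Finset.sum_comm]
        exact Finset.sum_congr rfl fun c _ => Finset.sum_comm
    _ = _ := by
        rw [Finset.sum_comm]
        refine Finset.sum_congr rfl fun b _ => Finset.sum_congr rfl fun c _ =>
          Finset.sum_congr rfl fun a _ => ?_
        ring

theorem commute_compress_iff {A B : Type*} [Fintype A] [DecidableEq A] [Fintype B]
    [DecidableEq B] {k : ℕ} (v : Fin k → A × B → ℂ) (m : Matrix (Fin k) (Fin k) ℂ) :
    (∀ X : Matrix B B ℂ,
        Commute ((codeIsometry v)ᴴ * ((1 : Matrix A A ℂ) ⊗ₖ X) * codeIsometry v) m) ↔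
      Commute ((codeReshape v)ᴴ * codeReshape v) ((1 : Matrix B B ℂ) ⊗ₖ m) := by
  rw [commute_one_kronecker_iff]
  simp only [compress_one_kronecker]
  constructor
  · intro h b b'
    simpa [Matrix.single_apply, ite_and] using h (Matrix.single b b' 1)
  · intro h X
    exact Commute.sum_left _ _ _ fun b _ => Commute.sum_left _ _ _ fun b' _ =>
      (h b b').smul_left _

theorem kronecker_one_mulVec_iff {A B : Type*} [Fintype A] [Fintype B] [DecidableEq B] {k : ℕ}
    (v : Fin k → A × B → ℂ) (O : Matrix A A ℂ)
    (o : Matrix (Fin k) (Fin k) ℂ) :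
    (∀ i, (O ⊗ₖ (1 : Matrix B B ℂ)).mulVec (v i) = ∑ j, o j i • v j) ↔
      O * codeReshape v = codeReshape v * ((1 : Matrix B B ℂ) ⊗ₖ o) := by
  have hl (i a b) : (O ⊗ₖ (1 : Matrix B B ℂ)).mulVec (v i) (a, b) =
      (O * codeReshape v) a (b, i) := by
    simp [Matrix.mulVec, dotProduct, Matrix.mul_apply, Fintype.sum_prod_type, codeReshape,
      Matrix.one_apply]
  have hr (i a b) : (∑ j, o j i • v j) (a, b) =
      (codeReshape v * ((1 : Matrix B B ℂ) ⊗ₖ o)) a (b, i) := by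
    simp [Matrix.mul_apply, Fintype.sum_prod_type_right, codeReshape, Matrix.one_apply, mul_comm]
  constructor
  · intro h
    ext a ⟨b, i⟩
    rw [← hl, ← hr, h]
  · intro h i
    ext ⟨a, b⟩
    rw [hl, hr, h]

theorem exists_commutant_compression_iff {A B : Type*} [Fintype A] [DecidableEq A]
    [Fintype B] {k : ℕ} (v : Fin k → A × B → ℂ)
    (hv : ∀ i j, (∑ z, (starRingEnd ℂ) (v i z) * v j z) = if i = j then 1 else 0)
    (M : Set (Matrix (Fin k) (Fin k) ℂ)) (X : Matrix B B ℂ) :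
    (∃ x' : Matrix (Fin k) (Fin k) ℂ, (∀ m ∈ M, x' * m = m * x') ∧
      codeProj v * ((1 : Matrix A A ℂ) ⊗ₖ X) * codeProj v =
        ∑ i, ∑ j, x' j i • (Matrix.of fun z z' => v j z * (starRingEnd ℂ) (v i z'))) ↔
      ∀ m ∈ M, Commute ((codeIsometry v)ᴴ * ((1 : Matrix A A ℂ) ⊗ₖ X) * codeIsometry v) m := by
  have hV := codeIsometry_conjTranspose_mul_self v hv
  have hP : codeProj v * ((1 : Matrix A A ℂ) ⊗ₖ X) * codeProj v = codeIsometry v *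
      ((codeIsometry v)ᴴ * ((1 : Matrix A A ℂ) ⊗ₖ X) * codeIsometry v) * (codeIsometry v)ᴴ := by
    simp only [codeProj_eq, Matrix.mul_assoc]
  constructor
  · rintro ⟨x', hx', h⟩ m hm
    rw [hP, ← codeIsometry_mul_mul_conjTranspose] at h
    have hcancel (y : Matrix (Fin k) (Fin k) ℂ) :
        (codeIsometry v)ᴴ * (codeIsometry v * y * (codeIsometry v)ᴴ) * codeIsometry v = y := by
      rw [Matrix.mul_assoc, Matrix.mul_assoc, hV, Matrix.mul_one, ← Matrix.mul_assoc, hV,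
        Matrix.one_mul]
    rw [← hcancel ((codeIsometry v)ᴴ * _ * _), h, hcancel]
    exact hx' m hm
  · exact fun h => ⟨_, fun m hm => (h m hm).eq, by rw [hP, codeIsometry_mul_mul_conjTranspose]⟩

/-- **Operator-algebra erasure-correction conditions**: for a code subspace of `ℂ^(A × Ā)`
spanned by an orthonormal family `v : Fin k → ℂ^(A × Ā)` with code projection `P`, and a
von Neumann algebra `M` of logical operators (a star-subalgebra of
`Matrix (Fin k) (Fin k) ℂ`), the following are equivalent:
(2) every `o ∈ M` has a representation `O_A` supported on `A` that, with its adjoint, acts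
correctly on the code subspace;
(3) for every `X` supported on `Ā`, `P * X * P` acts within the code subspace as some
element `x'` of the commutant of `M`. -/
theorem operator_algebra_erasure_correction {A B : Type*}
    [Fintype A] [DecidableEq A] [Nonempty A] [Fintype B] [DecidableEq B] [Nonempty B]
    {k : ℕ} (hk : 0 < k) (v : Fin k → A × B → ℂ)
    (hv : ∀ i j, (∑ z, (starRingEnd ℂ) (v i z) * v j z) = if i = j then 1 else 0)
    (M : StarSubalgebra ℂ (Matrix (Fin k) (Fin k) ℂ)) :
    (∀ o ∈ M, ∃ OA : Matrix A A ℂ,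
      (∀ i, (OA ⊗ₖ (1 : Matrix B B ℂ)).mulVec (v i) = ∑ j, o j i • v j) ∧
      (∀ i, (OA ⊗ₖ (1 : Matrix B B ℂ))ᴴ.mulVec (v i) = ∑ j, oᴴ j i • v j))
    ↔
    (∀ X : Matrix B B ℂ, ∃ x' : Matrix (Fin k) (Fin k) ℂ,
      (∀ m ∈ M, x' * m = m * x') ∧
      codeProj v * ((1 : Matrix A A ℂ) ⊗ₖ X) * codeProj v =
        ∑ i, ∑ j, x' j i •
          (Matrix.of fun z z' => v j z * (starRingEnd ℂ) (v i z'))) := by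
  have h3 := exists_commutant_compression_iff v hv (M : Set (Matrix (Fin k) (Fin k) ℂ))
  simp only [SetLike.mem_coe] at h3
  simp only [h3, Matrix.conjTranspose_kronecker, Matrix.conjTranspose_one,
    kronecker_one_mulVec_iff]
  constructor
  · intro h X m hm
    revert X
    rw [commute_compress_iff]
    obtain ⟨O, hO, hO'⟩ := h m hm
    have hadj : (codeReshape v)ᴴ * O = ((1 : Matrix B B ℂ) ⊗ₖ m) * (codeReshape v)ᴴ := by
      simpa [Matrix.conjTranspose_mul, Matrix.conjTranspose_kronecker] using
        congrArg Matrix.conjTranspose hO'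
    rw [Commute, SemiconjBy, Matrix.mul_assoc, ← hO, ← Matrix.mul_assoc, hadj, Matrix.mul_assoc]
  · intro h o ho
    have hcomm := (commute_compress_iff v o).1 fun X => h X o ho
    simpa [Matrix.conjTranspose_kronecker] using
      exists_mul_eq_mul_of_commute_gram (codeReshape v) _ hcomm
end
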